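/- Let n ≥ 2 and m ≥ 1. For every real ω with m/n ≤ ω ≤ m there exists a totally irrational matrix ξ ∈ ℝ^{n×m} that satisfies Property (C), is not badly approximable (not Property (A)), and has ordinary exponent ω(ξ) = ω. -/

import Mathlib

open Filter

/-- The sup-norm of the `i`-th integer vector `x i`, viewed in `ℝ^m`. -/
noncomputable def Xval {m : ℕ} (x : ℕ → Fin m → ℤ) (i : ℕ) : ℝ :=
  ‖(fun j => (x i j : ℝ))‖

/-- The sup-norm of the remainder `ξ 𝒙ᵢ − 𝒚ᵢ`. -/
noncomputable def Lval {m n : ℕ} (ξ : Matrix (Fin n) (Fin m) ℝ)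
    (x : ℕ → Fin m → ℤ) (y : ℕ → Fin n → ℤ) (i : ℕ) : ℝ :=
  ‖(ξ.mulVec (fun j => (x i j : ℝ)) - (fun k => (y i k : ℝ)))‖

/-- `ξ` is totally irrational: `‖ξ𝒙 − 𝒚‖ > 0` for every nonzero integer pair `(𝒙,𝒚)`. -/
def TotallyIrrational {m n : ℕ} (ξ : Matrix (Fin n) (Fin m) ℝ) : Prop :=
  ∀ (u : Fin m → ℤ) (v : Fin n → ℤ), (u, v) ≠ 0 →
    0 < ‖(ξ.mulVec (fun j => (u j : ℝ)) - (fun k => (v k : ℝ)))‖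

/-- `(𝒙ᵢ, 𝒚ᵢ)_{i}` is a sequence of best approximation vectors for `ξ`
(with respect to the sup norms). -/
structure IsBestApproxSeq {m n : ℕ} (ξ : Matrix (Fin n) (Fin m) ℝ)
    (x : ℕ → Fin m → ℤ) (y : ℕ → Fin n → ℤ) : Prop where
  nonzero : ∀ i, x i ≠ 0
  first : Xval x 0 = 1
  xStrictMono : StrictMono (Xval x)
  lStrictAnti : StrictAnti (Lval ξ x y)
  best : ∀ (i : ℕ) (u : Fin m → ℤ) (v : Fin n → ℤ), u ≠ 0 →
    ‖(fun j => (u j : ℝ))‖ < Xval x (i + 1) →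
    Lval ξ x y i ≤ ‖(ξ.mulVec (fun j => (u j : ℝ)) - (fun k => (v k : ℝ)))‖

/-- Property (A): `ξ` is badly approximable. -/
def PropA {m n : ℕ} (ξ : Matrix (Fin n) (Fin m) ℝ) : Prop :=
  ∃ c : ℝ, 0 < c ∧ ∀ (u : Fin m → ℤ) (v : Fin n → ℤ), u ≠ 0 →
    c ≤ ‖(fun j => (u j : ℝ))‖ ^ m *
        ‖(ξ.mulVec (fun j => (u j : ℝ)) - (fun k => (v k : ℝ)))‖ ^ n

/-- Property (B): the ratios `X_{i+1}/X_i` are bounded. -/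
def PropB {m : ℕ} (x : ℕ → Fin m → ℤ) : Prop :=
  ∃ M : ℝ, ∀ i : ℕ, Xval x (i + 1) / Xval x i ≤ M

/-- Property (C): the ratios `L_i/L_{i+1}` are bounded. -/
def PropC {m n : ℕ} (ξ : Matrix (Fin n) (Fin m) ℝ)
    (x : ℕ → Fin m → ℤ) (y : ℕ → Fin n → ℤ) : Prop :=
  ∃ M : ℝ, ∀ i : ℕ, Lval ξ x y i / Lval ξ x y (i + 1) ≤ M

/-- The ordinary exponent `ω(ξ) = limsup (−log Lᵢ)/(log Xᵢ)`, as a value in `[0,+∞]`. -/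
noncomputable def ordExp {m n : ℕ} (ξ : Matrix (Fin n) (Fin m) ℝ)
    (x : ℕ → Fin m → ℤ) (y : ℕ → Fin n → ℤ) : EReal :=
  limsup (fun i => ((-Real.log (Lval ξ x y i) / Real.log (Xval x i) : ℝ) : EReal)) atTop

/-- The uniform exponent `ω̂(ξ) = liminf (−log Lᵢ)/(log X_{i+1})`, as a value in `[0,+∞]`. -/
noncomputable def unifExp {m n : ℕ} (ξ : Matrix (Fin n) (Fin m) ℝ)
    (x : ℕ → Fin m → ℤ) (y : ℕ → Fin n → ℤ) : EReal :=
  liminf (fun i => ((-Real.log (Lval ξ x y i) / Real.log (Xval x (i + 1)) : ℝ) : EReal)) atTop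

open MeasureTheory in
theorem exists_int_mulVec_le {κ : Type*} [Fintype κ] [DecidableEq κ] (M : Matrix κ κ ℝ)
    (hM : M.det ≠ 0) (r : κ → ℝ) (hr : ∀ i, 0 < r i) (h : |M.det| < ∏ i, r i) :
    ∃ v : κ → ℤ, v ≠ 0 ∧ ∀ i, |M.mulVec (fun j => (v j : ℝ)) i| ≤ r i := by
  set s : Set (κ → ℝ) := Matrix.toLin' M ⁻¹' Set.pi Set.univ (fun i => Set.Icc (-r i) (r i)) with hs
  have hfd := ZSpan.isAddFundamentalDomain (Pi.basisFun ℝ κ) (volume : Measure (κ → ℝ))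
  have hvF : volume (ZSpan.fundamentalDomain (Pi.basisFun ℝ κ)) = 1 := by
    rw [ZSpan.fundamentalDomain_pi_basisFun, Real.volume_pi_Ico]; simp
  have hdet : LinearMap.det (Matrix.toLin' M) ≠ 0 := by simpa using hM
  have hvs : volume s = ENNReal.ofReal (|M.det|⁻¹ * ∏ i, (2 * r i)) := by
    rw [hs, Measure.addHaar_preimage_linearMap _ hdet, Set.pi_univ_Icc,
      Real.volume_Icc_pi, ENNReal.ofReal_mul (by positivity), ENNReal.ofReal_prod_of_nonneg]
    · simp [abs_inv, two_mul]
    · intro i _; have := hr i; positivity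
  have hlt : volume (ZSpan.fundamentalDomain (Pi.basisFun ℝ κ)) *
      2 ^ Module.finrank ℝ (κ → ℝ) < volume s := by
    rw [hvF, hvs, one_mul, Module.finrank_fintype_fun_eq_card, Finset.prod_mul_distrib]
    have h2 : (2 : ENNReal) ^ Fintype.card κ = ENNReal.ofReal (2 ^ Fintype.card κ) := by
      rw [ENNReal.ofReal_pow (by norm_num)]; simp
    have hd : 0 < |M.det| := abs_pos.mpr hM
    rw [h2]
    refine (ENNReal.ofReal_lt_ofReal_iff_of_nonneg (by positivity)).mpr ?_
    rw [Finset.prod_const, Finset.card_univ, inv_mul_eq_div, lt_div_iff₀ hd]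
    gcongr
  have hsym : ∀ x ∈ s, -x ∈ s := by
    intro x hx
    simp only [hs, Set.mem_preimage, Set.mem_univ_pi, Set.mem_Icc, map_neg, Pi.neg_apply] at hx ⊢
    intro i
    constructor <;> linarith [(hx i).1, (hx i).2]
  have hconv : Convex ℝ s := (convex_pi fun i _ => convex_Icc _ _).linear_preimage _
  have : Countable (Submodule.span ℤ (Set.range (Pi.basisFun ℝ κ))).toAddSubgroup :=
    inferInstanceAs (Countable (Submodule.span ℤ (Set.range (Pi.basisFun ℝ κ))))
  obtain ⟨x, hx0, hxs⟩ := exists_ne_zero_mem_lattice_of_measure_mul_two_pow_lt_measure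
    (L := (Submodule.span ℤ (Set.range (Pi.basisFun ℝ κ))).toAddSubgroup) hfd hsym hconv hlt
  obtain ⟨x, hxL⟩ := x
  have hxi := (Pi.basisFun ℝ κ).mem_span_iff_repr_mem ℤ x |>.mp hxL
  choose v hv using hxi
  have hv' : (fun j => (v j : ℝ)) = x := by
    ext j; simpa using hv j
  refine ⟨v, ?_, ?_⟩
  · rintro rfl
    apply hx0
    ext j
    simp [← hv']
  · intro i
    rw [hv']
    have := hxs i (Set.mem_univ i)
    rw [abs_le]
    simpa using this

theorem exists_int_norm_sub_le (κ : Type*) [Fintype κ] [DecidableEq κ] [Nonempty κ] {c : ℝ}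
    (hc : 0 < c) : ∃ R : ℝ, 0 < R ∧ ∀ A : Matrix κ κ ℝ, |A.det| = 1 →
      (∀ v : κ → ℤ, v ≠ 0 → c ≤ ‖A.mulVec (fun j => (v j : ℝ))‖) →
      ∀ z : κ → ℝ, ∃ v : κ → ℤ, ‖A.mulVec (fun j => (v j : ℝ)) - z‖ ≤ R := by
  obtain ⟨d, hd⟩ : ∃ d : ℝ, d = (Fintype.card κ : ℝ) := ⟨_, rfl⟩
  have hd1 : 1 ≤ d := by simp only [hd]; exact_mod_cast Fintype.card_pos
  set a : ℝ := c / (2 * d) with ha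
  have ha0 : 0 < a := by positivity
  have hac : a < c := by rw [ha, div_lt_iff₀ (by positivity)]; nlinarith
  set R0 : ℝ := 2 / a ^ (Fintype.card κ - 1) with hR0
  have hR00 : 0 < R0 := by positivity
  refine ⟨d * (a + R0), by positivity, fun A hA hAc z => ?_⟩
  set S : Set (κ → ℝ) := {x | ‖x‖ ≤ a + R0 ∧ ∃ v : κ → ℤ, x = A.mulVec (fun j => (v j : ℝ))}
    with hS
  have hspan : ⊤ ≤ Submodule.span ℝ S := by
    by_contra hcon
    obtain ⟨f, hf0, hf⟩ := Submodule.exists_le_ker_of_lt_top _ (lt_top_iff_ne_top.mpr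
      (fun h => hcon h.ge))
    obtain ⟨i0, -, hi0⟩ := Finset.exists_max_image Finset.univ
      (fun i => |f (Pi.single i 1)|) Finset.univ_nonempty
    have hfx : ∀ x : κ → ℝ, f x = ∑ i, f (Pi.single i 1) * x i := by
      intro x
      conv_lhs => rw [← Finset.univ_sum_single x, map_sum]
      refine Finset.sum_congr rfl fun i _ => ?_
      have : (Pi.single i (x i) : κ → ℝ) = x i • Pi.single i 1 := by
        rw [← Pi.single_smul]; simp
      rw [this, map_smul, smul_eq_mul, mul_comm]
    have hpos : 0 < |f (Pi.single i0 1)| := by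
      by_contra hneg
      apply hf0
      ext x
      simp only [LinearMap.coe_comp, Function.comp_apply, LinearMap.coe_single,
        LinearMap.zero_apply]
      have h1 := hi0 x (Finset.mem_univ x)
      have h2 := abs_nonneg (f (Pi.single x 1))
      exact abs_eq_zero.mp (by linarith)
    obtain ⟨v, hv0, hv⟩ := exists_int_mulVec_le A (by intro h; simp [h] at hA)
      (Function.update (fun _ => a) i0 R0)
      (by intro i; by_cases h : i = i0
          · subst h; simpa using hR00
          · simpa [h] using ha0)
      (by rw [hA, Finset.prod_update_of_mem (Finset.mem_univ _), Finset.prod_const,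
            Finset.card_sdiff_of_subset (by simp)]
          simp only [Finset.card_univ, Finset.card_singleton, hR0]
          rw [div_mul_cancel₀ _ (by positivity)]; norm_num)
    set x := A.mulVec (fun j => (v j : ℝ)) with hx
    have hxj : ∀ j, j ≠ i0 → |x j| ≤ a := fun j hj => by simpa [hj] using hv j
    have hxi : |x i0| ≤ R0 := by simpa using hv i0
    have hxS : x ∈ S := by
      refine ⟨(pi_norm_le_iff_of_nonneg (by positivity)).mpr fun i => ?_, v, rfl⟩
      rw [Real.norm_eq_abs]
      by_cases h : i = i0
      · subst h; linarith
      · linarith [hxj i h]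
    have hfx0 : f x = 0 := hf (Submodule.subset_span hxS)
    rw [hfx, ← Finset.add_sum_erase _ _ (Finset.mem_univ i0)] at hfx0
    have hbd : |f (Pi.single i0 1)| * |x i0| ≤ |f (Pi.single i0 1)| * (c / 2) := by
      have : f (Pi.single i0 1) * x i0 =
          - ∑ i ∈ Finset.univ.erase i0, f (Pi.single i 1) * x i := by linarith
      rw [← abs_mul, this, abs_neg]
      refine (Finset.abs_sum_le_sum_abs _ _).trans ?_
      calc ∑ i ∈ Finset.univ.erase i0, |f (Pi.single i 1) * x i|
          ≤ ∑ i ∈ Finset.univ.erase i0, |f (Pi.single i0 1)| * a := by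
            refine Finset.sum_le_sum fun i hi => ?_
            rw [abs_mul]
            exact mul_le_mul (hi0 i (Finset.mem_univ i)) (hxj i (Finset.ne_of_mem_erase hi))
              (abs_nonneg _) (abs_nonneg _)
        _ ≤ ∑ i : κ, |f (Pi.single i0 1)| * a :=
            Finset.sum_le_sum_of_subset_of_nonneg (Finset.erase_subset _ _)
              fun _ _ _ => by positivity
        _ = |f (Pi.single i0 1)| * (c / 2) := by
            rw [Finset.sum_const, Finset.card_univ, nsmul_eq_mul, ← hd, ha]; field_simp
    have hxi' : |x i0| ≤ c / 2 := le_of_mul_le_mul_left hbd hpos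
    have : ‖x‖ < c := by
      refine (pi_norm_lt_iff hc).mpr fun i => ?_
      rw [Real.norm_eq_abs]
      by_cases h : i = i0
      · subst h; linarith
      · linarith [hxj i h]
    exact absurd (hAc v hv0) (not_le.mpr this)
  set b := Module.Basis.ofSpan hspan with hb
  have hbS : ∀ i, b i ∈ S := fun i =>
    Module.Basis.ofSpan_subset hspan (Set.mem_range_self i)
  have : Fintype ↑((linearIndepOn_empty ℝ (id : (κ → ℝ) → κ → ℝ)).extend (Set.empty_subset S)) :=
    FiniteDimensional.fintypeBasisIndex b
  have hcard := Module.finrank_eq_card_basis b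
  rw [Module.finrank_fintype_fun_eq_card] at hcard
  choose hbn u hu using hbS
  refine ⟨∑ i, round (b.repr z i) • u i, ?_⟩
  have hz := b.sum_repr z
  have hA' : A.mulVec (fun j => ((∑ i, round (b.repr z i) • u i) j : ℝ)) =
      ∑ i, (round (b.repr z i) : ℝ) • b i := by
    have : (fun j => (((∑ i, round (b.repr z i) • u i) j : ℤ) : ℝ)) =
        ∑ i, (round (b.repr z i) : ℝ) • (fun j => (u i j : ℝ)) := by
      ext j; simp
    rw [this, Matrix.mulVec_sum]
    refine Finset.sum_congr rfl fun i _ => ?_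
    rw [Matrix.mulVec_smul, ← hu i]
  rw [hA']
  nth_rewrite 2 [← hz]
  rw [← Finset.sum_sub_distrib]
  refine (norm_sum_le _ _).trans ?_
  calc _ ≤ ∑ i : ↑((linearIndepOn_empty ℝ (id : (κ → ℝ) → κ → ℝ)).extend (Set.empty_subset S)),
        (a + R0) := by
        refine Finset.sum_le_sum fun i _ => ?_
        rw [← sub_smul, norm_smul, Real.norm_eq_abs, abs_sub_comm]
        have h1 := abs_sub_round (b.repr z i)
        have h2 := hbn i
        nlinarith [norm_nonneg (b i), abs_nonneg (b.repr z i - round (b.repr z i))]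
    _ = d * (a + R0) := by
        rw [Finset.sum_const, Finset.card_univ, ← hcard, nsmul_eq_mul, hd]

/-- The diagonal flow `(e^{-t/m}, …, e^{t/n}, …)` on `ℝ^m × ℝ^n`. -/
noncomputable def flowScale (m n : ℕ) (t : ℝ) : Fin m ⊕ Fin n → ℝ :=
  Sum.elim (fun _ => Real.exp (-(t / m))) (fun _ => Real.exp (t / n))

/-- The unipotent matrix `(x, y) ↦ (x, y + ξ x)`. -/
def shear {m n : ℕ} (ξ : Matrix (Fin n) (Fin m) ℝ) : Matrix (Fin m ⊕ Fin n) (Fin m ⊕ Fin n) ℝ :=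
  Matrix.fromBlocks 1 0 ξ 1

/-- The sup norm of the vector obtained from `w` by applying the shear `ξ` and then the flow at
time `t`. -/
noncomputable def flowNorm {m n : ℕ} (ξ : Matrix (Fin n) (Fin m) ℝ) (t : ℝ)
    (w : Fin m ⊕ Fin n → ℝ) : ℝ :=
  ‖fun i => flowScale m n t i * (shear ξ).mulVec w i‖

section flow

variable {m n : ℕ}

theorem flowScale_pos (t : ℝ) (i : Fin m ⊕ Fin n) : 0 < flowScale m n t i := by
  rcases i with i | i <;> simp [flowScale, Real.exp_pos]

theorem flowScale_add (s t : ℝ) (i : Fin m ⊕ Fin n) :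
    flowScale m n (s + t) i = flowScale m n s i * flowScale m n t i := by
  rcases i with i | i <;> simp only [flowScale, Sum.elim_inl, Sum.elim_inr, ← Real.exp_add] <;>
    congr 1 <;> ring

theorem prod_flowScale (hm : 1 ≤ m) (hn : 1 ≤ n) (t : ℝ) : ∏ i, flowScale m n t i = 1 := by
  have hm' : (m : ℝ) ≠ 0 := by positivity
  have hn' : (n : ℝ) ≠ 0 := by positivity
  simp only [flowScale, Fintype.prod_sum_type, Sum.elim_inl, Sum.elim_inr, Finset.prod_const,
    Finset.card_univ, Fintype.card_fin, ← Real.exp_nat_mul, ← Real.exp_add]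
  rw [Real.exp_eq_one_iff]
  field_simp
  ring

theorem shear_mulVec_inl (ξ : Matrix (Fin n) (Fin m) ℝ) (w : Fin m ⊕ Fin n → ℝ) (j : Fin m) :
    (shear ξ).mulVec w (Sum.inl j) = w (Sum.inl j) := by
  rw [shear, Matrix.fromBlocks_mulVec]; simp

theorem shear_mulVec_inr (ξ : Matrix (Fin n) (Fin m) ℝ) (w : Fin m ⊕ Fin n → ℝ) (k : Fin n) :
    (shear ξ).mulVec w (Sum.inr k) = w (Sum.inr k) + ∑ j, ξ k j * w (Sum.inl j) := by
  rw [shear, Matrix.fromBlocks_mulVec]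
  simp [Matrix.mulVec, dotProduct, add_comm]

theorem det_shear (ξ : Matrix (Fin n) (Fin m) ℝ) : (shear ξ).det = 1 := by
  simp [shear]

variable {ξ ξ' : Matrix (Fin n) (Fin m) ℝ} {s t : ℝ} {w : Fin m ⊕ Fin n → ℝ}

theorem flowNorm_nonneg : 0 ≤ flowNorm ξ t w := norm_nonneg _

theorem flowNorm_le_iff {r : ℝ} (hr : 0 ≤ r) :
    flowNorm ξ t w ≤ r ↔ ∀ i, flowScale m n t i * |(shear ξ).mulVec w i| ≤ r := by
  rw [flowNorm, pi_norm_le_iff_of_nonneg hr]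
  simp only [norm_mul, Real.norm_eq_abs, abs_of_pos (flowScale_pos _ _)]

theorem le_flowNorm (i : Fin m ⊕ Fin n) :
    flowScale m n t i * |(shear ξ).mulVec w i| ≤ flowNorm ξ t w :=
  (flowNorm_le_iff flowNorm_nonneg).mp le_rfl i

theorem flowNorm_inl_le (j : Fin m) :
    Real.exp (-(t / m)) * |w (Sum.inl j)| ≤ flowNorm ξ t w := by
  simpa [flowScale, shear_mulVec_inl] using le_flowNorm (ξ := ξ) (t := t) (w := w) (Sum.inl j)

theorem flowNorm_inr_le (k : Fin n) :
    Real.exp (t / n) * |w (Sum.inr k) + ∑ j, ξ k j * w (Sum.inl j)| ≤ flowNorm ξ t w := by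
  simpa [flowScale, shear_mulVec_inr] using le_flowNorm (ξ := ξ) (t := t) (w := w) (Sum.inr k)

theorem flowNorm_le_of_forall {r : ℝ} (hr : 0 ≤ r)
    (h₁ : ∀ j, Real.exp (-(t / m)) * |w (Sum.inl j)| ≤ r)
    (h₂ : ∀ k, Real.exp (t / n) * |w (Sum.inr k) + ∑ j, ξ k j * w (Sum.inl j)| ≤ r) :
    flowNorm ξ t w ≤ r := by
  rw [flowNorm_le_iff hr]
  rintro (i | i)
  · simpa [flowScale, shear_mulVec_inl] using h₁ i
  · simpa [flowScale, shear_mulVec_inr] using h₂ i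

theorem flowNorm_smul (a : ℝ) : flowNorm ξ t (a • w) = |a| * flowNorm ξ t w := by
  rw [flowNorm, flowNorm, ← Real.norm_eq_abs, ← norm_smul]
  congr 1
  ext i
  simp only [Matrix.mulVec_smul, Pi.smul_apply, smul_eq_mul]
  ring

theorem flowNorm_add_le (hs : 0 ≤ s) :
    flowNorm ξ (t + s) w ≤ Real.exp (s / n) * flowNorm ξ t w := by
  rw [flowNorm_le_iff (mul_nonneg (Real.exp_pos _).le flowNorm_nonneg)]
  intro i
  rw [add_comm, flowScale_add, mul_assoc]
  refine mul_le_mul ?_ (le_flowNorm i) (mul_nonneg (flowScale_pos _ _).le (abs_nonneg _))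
    (Real.exp_pos _).le
  rcases i with i | i
  · simp only [flowScale, Sum.elim_inl]
    refine Real.exp_le_exp.mpr ?_
    have : 0 ≤ s / m := by positivity
    have : 0 ≤ s / n := by positivity
    linarith
  · simp [flowScale]

theorem flowNorm_le_of_sub_le {C T : ℝ} (hC : 0 ≤ C) (hT : t ≤ T)
    (h : ∀ k j, |ξ' k j - ξ k j| ≤ C * Real.exp (-((1 / m + 1 / n) * T))) :
    flowNorm ξ' t w ≤ (1 + m * C) * flowNorm ξ t w := by
  have hN := flowNorm_nonneg (ξ := ξ) (t := t) (w := w)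
  refine flowNorm_le_of_forall (by positivity) (fun j => ?_) (fun k => ?_)
  · refine (flowNorm_inl_le j).trans (le_mul_of_one_le_left hN ?_)
    have : 0 ≤ m * C := by positivity
    linarith
  · have h1 : w (Sum.inr k) + ∑ j, ξ' k j * w (Sum.inl j) =
        (w (Sum.inr k) + ∑ j, ξ k j * w (Sum.inl j)) +
          ∑ j, (ξ' k j - ξ k j) * w (Sum.inl j) := by
      rw [add_assoc, ← Finset.sum_add_distrib]
      congr 2; ext j; ring
    have h2 : Real.exp (t / n) * |∑ j, (ξ' k j - ξ k j) * w (Sum.inl j)| ≤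
        m * C * flowNorm ξ t w := by
      calc _ ≤ Real.exp (t / n) * ∑ j, |(ξ' k j - ξ k j) * w (Sum.inl j)| := by
            gcongr; exact Finset.abs_sum_le_sum_abs _ _
        _ = ∑ j, Real.exp (t / n) * |(ξ' k j - ξ k j) * w (Sum.inl j)| := Finset.mul_sum _ _ _
        _ ≤ ∑ _j : Fin m, C * flowNorm ξ t w := by
            refine Finset.sum_le_sum fun j _ => ?_
            have h3 : Real.exp (t / n) * Real.exp (-((1 / m + 1 / n) * T)) ≤
                Real.exp (-(t / m)) := by
              rw [← Real.exp_add, Real.exp_le_exp]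
              have : (1 / m + 1 / n) * t ≤ (1 / m + 1 / n : ℝ) * T := by gcongr
              have e : (1 / m + 1 / n : ℝ) * t = t / m + t / n := by ring
              linarith
            rw [abs_mul]
            calc _ ≤ Real.exp (t / n) *
                  ((C * Real.exp (-((1 / m + 1 / n) * T))) * |w (Sum.inl j)|) := by
                  gcongr; exact h k j
              _ = C * ((Real.exp (t / n) * Real.exp (-((1 / m + 1 / n) * T))) *
                    |w (Sum.inl j)|) := by ring
              _ ≤ C * (Real.exp (-(t / m)) * |w (Sum.inl j)|) := by gcongr
              _ ≤ C * flowNorm ξ t w := by gcongr; exact flowNorm_inl_le j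
        _ = m * C * flowNorm ξ t w := by simp; ring
    rw [h1]
    calc _ ≤ Real.exp (t / n) * (|w (Sum.inr k) + ∑ j, ξ k j * w (Sum.inl j)| +
          |∑ j, (ξ' k j - ξ k j) * w (Sum.inl j)|) := by gcongr; exact abs_add_le _ _
      _ ≤ flowNorm ξ t w + m * C * flowNorm ξ t w := by
          rw [mul_add]; exact add_le_add (flowNorm_inr_le k) h2
      _ = _ := by ring

theorem exists_flowNorm_le_two (hm : 1 ≤ m) (hn : 1 ≤ n) (ξ : Matrix (Fin n) (Fin m) ℝ) (t : ℝ) :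
    ∃ v : Fin m ⊕ Fin n → ℤ, v ≠ 0 ∧ flowNorm ξ t (fun j => (v j : ℝ)) ≤ 2 := by
  have hp := prod_flowScale hm hn t
  have : Nonempty (Fin m ⊕ Fin n) := ⟨Sum.inl ⟨0, hm⟩⟩
  obtain ⟨v, hv0, hv⟩ := exists_int_mulVec_le (shear ξ) (by simp [det_shear])
    (fun i => 2 * (flowScale m n t i)⁻¹)
    (fun i => mul_pos two_pos (inv_pos.mpr (flowScale_pos _ _)))
    (by rw [det_shear, Finset.prod_mul_distrib, Finset.prod_inv_distrib, hp]
        simp only [abs_one, Finset.prod_const, Finset.card_univ, inv_one, mul_one]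
        exact one_lt_pow₀ one_lt_two Fintype.card_ne_zero)
  refine ⟨v, hv0, (flowNorm_le_iff two_pos.le).mpr fun i => ?_⟩
  have h := hv i
  rw [← div_eq_mul_inv, le_div_iff₀ (flowScale_pos _ _)] at h
  linarith

end flow

theorem Matrix.abs_mul_apply_le {ι κ μ : Type*} [Fintype κ] {A : Matrix ι κ ℝ} {B : Matrix κ μ ℝ}
    {a b : ℝ} (hA : ∀ i j, |A i j| ≤ a) (hB : ∀ i j, |B i j| ≤ b) (ha : 0 ≤ a) (i : ι) (j : μ) :
    |(A * B) i j| ≤ Fintype.card κ * (a * b) := by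
  rw [Matrix.mul_apply]
  refine (Finset.abs_sum_le_sum_abs _ _).trans ?_
  refine (Finset.sum_le_sum (g := fun _ => a * b) fun k _ => ?_).trans (by simp)
  rw [abs_mul]
  exact mul_le_mul (hA i k) (hB k j) (abs_nonneg _) ha

theorem Matrix.det_one_add_ne_zero {κ : Type*} [Fintype κ] [DecidableEq κ] {E : Matrix κ κ ℝ}
    {e : ℝ} (hE : ∀ i j, |E i j| ≤ e) (he : Fintype.card κ * e < 1) : (1 + E).det ≠ 0 := by
  refine det_ne_zero_of_sum_row_lt_diag fun k => ?_
  have h1 : ∑ j ∈ Finset.univ.erase k, ‖(1 + E) k j‖ = ∑ j ∈ Finset.univ.erase k, |E k j| := by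
    refine Finset.sum_congr rfl fun j hj => ?_
    rw [Matrix.add_apply, Matrix.one_apply_ne (Finset.ne_of_mem_erase hj).symm, zero_add,
      Real.norm_eq_abs]
  have h2 : ∑ j, |E k j| ≤ Fintype.card κ * e :=
    (Finset.sum_le_sum (g := fun _ => e) fun j _ => hE k j).trans (by simp)
  rw [← Finset.sum_erase_add _ _ (Finset.mem_univ k)] at h2
  rw [h1, Matrix.add_apply, Matrix.one_apply_eq, Real.norm_eq_abs]
  have h3 := abs_sub_abs_le_abs_sub 1 (-E k k)
  rw [abs_neg, abs_one, sub_neg_eq_add] at h3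
  linarith

section glue

variable {m n : ℕ}

theorem exists_shear_mul_one_add (hm : 1 ≤ m) (hn : 1 ≤ n)
    {E : Matrix (Fin m ⊕ Fin n) (Fin m ⊕ Fin n) ℝ}
    (hE : ∀ i j, |E i j| ≤ 1 / (20 * (m + n : ℝ) ^ 2)) {ζ : Matrix (Fin n) (Fin m) ℝ}
    (hζ : ∀ k j, |ζ k j| ≤ 1) :
    ∃ (η : Matrix (Fin n) (Fin m) ℝ) (F : Matrix (Fin m ⊕ Fin n) (Fin m ⊕ Fin n) ℝ),
      (∀ k j, |η k j| ≤ 4) ∧ (∀ i j, |F i j| ≤ 1 / (2 * (m + n : ℝ))) ∧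
      (∀ k j, F (Sum.inr k) (Sum.inl j) = 0) ∧
      shear η * (1 + E) = (1 + F) * shear ζ := by
  obtain ⟨d, hd⟩ : ∃ d : ℝ, d = (m + n : ℝ) := ⟨_, rfl⟩
  have hm1 : (1 : ℝ) ≤ m := by exact_mod_cast hm
  have hn1 : (1 : ℝ) ≤ n := by exact_mod_cast hn
  rw [← hd] at hE ⊢
  obtain ⟨e, he⟩ : ∃ e : ℝ, e = 1 / (20 * d ^ 2) := ⟨_, rfl⟩
  rw [← he] at hE
  have hd2 : 2 ≤ d := by linarith
  have he0 : 0 < e := by rw [he]; positivity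
  have hde : d * (d * e) = 1 / 20 := by rw [he]; field_simp
  have hde1 : d * e ≤ 1 / 40 := by nlinarith
  have he1 : e ≤ 1 / 80 := by nlinarith
  obtain ⟨E₁₁, E₁₂, E₂₁, E₂₂, rfl⟩ : ∃ E₁₁ E₁₂ E₂₁ E₂₂, E = Matrix.fromBlocks E₁₁ E₁₂ E₂₁ E₂₂ :=
    ⟨_, _, _, _, (Matrix.fromBlocks_toBlocks E).symm⟩
  have h₁₁ : ∀ i j, |E₁₁ i j| ≤ e := fun i j => hE (Sum.inl i) (Sum.inl j)
  have h₁₂ : ∀ i j, |E₁₂ i j| ≤ e := fun i j => hE (Sum.inl i) (Sum.inr j)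
  have h₂₁ : ∀ i j, |E₂₁ i j| ≤ e := fun i j => hE (Sum.inr i) (Sum.inl j)
  have h₂₂ : ∀ i j, |E₂₂ i j| ≤ e := fun i j => hE (Sum.inr i) (Sum.inr j)
  set G := E₁₁ - E₁₂ * ζ with hG
  have hGb : ∀ i j, |G i j| ≤ d * e := by
    intro i j
    have h1 := Matrix.abs_mul_apply_le h₁₂ hζ he0.le i j
    rw [Fintype.card_fin] at h1
    have h2 := abs_sub (E₁₁ i j) ((E₁₂ * ζ) i j)
    have h3 := h₁₁ i j
    rw [hG, Matrix.sub_apply]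
    have : e + n * e ≤ d * e := by rw [hd]; nlinarith
    linarith
  have hmd : m * (d * e) ≤ 1 / 20 := by
    rw [← hde]; gcongr; linarith
  have hdet : (1 + G).det ≠ 0 :=
    Matrix.det_one_add_ne_zero hGb (by rw [Fintype.card_fin]; linarith)
  set H := ζ + E₂₂ * ζ - E₂₁ with hH
  have hHb : ∀ k j, |H k j| ≤ 2 := by
    intro k j
    have h1 := Matrix.abs_mul_apply_le h₂₂ hζ he0.le k j
    rw [Fintype.card_fin] at h1
    have h2 := abs_sub ((ζ + E₂₂ * ζ) k j) (E₂₁ k j)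
    have h3 := abs_add_le (ζ k j) ((E₂₂ * ζ) k j)
    have h4 := h₂₁ k j
    have h5 := hζ k j
    rw [hH, Matrix.sub_apply]
    rw [Matrix.add_apply] at h2 ⊢
    have : n * e ≤ d * e := by gcongr; linarith
    linarith
  set η := H * (1 + G)⁻¹ with hη
  have hηG : η + η * G = H := by
    have : η * (1 + G) = H := by
      rw [hη, Matrix.mul_assoc, Matrix.nonsing_inv_mul _ (Ne.isUnit hdet), Matrix.mul_one]
    rw [← this, Matrix.mul_add, Matrix.mul_one]
  have hηb : ∀ k j, |η k j| ≤ 4 := by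
    intro k
    have : Nonempty (Fin m) := ⟨⟨0, hm⟩⟩
    obtain ⟨j0, -, hj0⟩ := Finset.exists_max_image Finset.univ (fun j => |η k j|)
      Finset.univ_nonempty
    have h1 : |(η * G) k j0| ≤ m * (|η k j0| * (d * e)) := by
      rw [Matrix.mul_apply]
      refine (Finset.abs_sum_le_sum_abs _ _).trans ?_
      refine (Finset.sum_le_sum (g := fun _ => |η k j0| * (d * e)) fun i hi => ?_).trans
        (by simp)
      rw [abs_mul]
      exact mul_le_mul (hj0 i hi) (hGb i j0) (abs_nonneg _) (abs_nonneg _)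
    have h2 : η k j0 = H k j0 - (η * G) k j0 := by
      rw [← hηG, Matrix.add_apply]; ring
    have h3 : |η k j0| ≤ |H k j0| + |(η * G) k j0| := by
      conv_lhs => rw [h2]
      exact abs_sub _ _
    have h4 := hHb k j0
    have h5 : m * (|η k j0| * (d * e)) ≤ |η k j0| * (1 / 20) := by
      calc _ = |η k j0| * (m * (d * e)) := by ring
        _ ≤ _ := by gcongr
    intro j
    have h6 := hj0 j (Finset.mem_univ j)
    linarith
  have hηE : ∀ i j, |(η * E₁₂) i j| ≤ 4 * (d * e) := by
    intro i j
    refine (Matrix.abs_mul_apply_le hηb h₁₂ (by norm_num) i j).trans ?_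
    rw [Fintype.card_fin]
    have : m * e ≤ d * e := by gcongr; linarith
    linarith
  have h5 : 1 / (2 * d) = 10 * (d * e) := by rw [he]; field_simp; norm_num
  have hed : e ≤ d * e := le_mul_of_one_le_left he0.le (by linarith)
  refine ⟨η, Matrix.fromBlocks G E₁₂ 0 (E₂₂ + η * E₁₂), hηb, ?_, fun k j => rfl, ?_⟩
  · rw [h5]
    rintro (i | i) (j | j)
    · simp only [Matrix.fromBlocks_apply₁₁]; linarith [hGb i j]
    · simp only [Matrix.fromBlocks_apply₁₂]; linarith [h₁₂ i j]
    · simp only [Matrix.fromBlocks_apply₂₁, Matrix.zero_apply, abs_zero]; linarith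
    · simp only [Matrix.fromBlocks_apply₂₂, Matrix.add_apply]
      linarith [abs_add_le (E₂₂ i j) ((η * E₁₂) i j), h₂₂ i j, hηE i j]
  · rw [← Matrix.fromBlocks_one, Matrix.fromBlocks_add, Matrix.fromBlocks_add, shear, shear,
      Matrix.fromBlocks_multiply, Matrix.fromBlocks_multiply]
    congr 1
    · simp only [hG, Matrix.mul_one, Matrix.one_mul, Matrix.zero_mul, zero_add, add_zero, add_assoc,
        sub_add_cancel]
    · simp
    · have : η * (1 + E₁₁) + E₂₁ = η + η * G + η * E₁₂ * ζ + E₂₁ := by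
        simp only [hG, Matrix.mul_add, Matrix.mul_sub, Matrix.mul_one, Matrix.mul_assoc]; abel
      simp only [Matrix.one_mul, Matrix.mul_one, zero_add]
      rw [this, hηG, hH]
      simp only [Matrix.add_mul, Matrix.one_mul]; abel
    · simp only [Matrix.one_mul, Matrix.mul_one, Matrix.mul_zero, zero_add]
      rw [add_left_comm, add_comm (η * E₁₂)]

theorem norm_flowScale_mul_one_add (hm : 1 ≤ m)
    {F : Matrix (Fin m ⊕ Fin n) (Fin m ⊕ Fin n) ℝ}
    (hF : ∀ i j, |F i j| ≤ 1 / (2 * (m + n : ℝ)))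
    (hF0 : ∀ k j, F (Sum.inr k) (Sum.inl j) = 0) {s : ℝ} (hs : 0 ≤ s) (u : Fin m ⊕ Fin n → ℝ) :
    1 / 2 * ‖fun i => flowScale m n s i * u i‖ ≤
      ‖fun i => flowScale m n s i * (1 + F).mulVec u i‖ ∧
    ‖fun i => flowScale m n s i * (1 + F).mulVec u i‖ ≤
      2 * ‖fun i => flowScale m n s i * u i‖ := by
  set p : Fin m ⊕ Fin n → ℝ := fun i => flowScale m n s i * u i with hp
  set q : Fin m ⊕ Fin n → ℝ := fun i => flowScale m n s i * F.mulVec u i with hq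
  have hm1 : (1 : ℝ) ≤ m := by exact_mod_cast hm
  have hn0 : (0 : ℝ) ≤ n := by positivity
  have hsum : (fun i => flowScale m n s i * (1 + F).mulVec u i) = p + q := by
    ext i
    simp only [Matrix.add_mulVec, Matrix.one_mulVec, Pi.add_apply, hp, hq]
    ring
  have hb : ‖q‖ ≤ 1 / 2 * ‖p‖ := by
    refine (pi_norm_le_iff_of_nonneg (by positivity)).mpr fun i => ?_
    have hterm : ∀ j, ‖flowScale m n s i * (F i j * u j)‖ ≤ 1 / (2 * (m + n : ℝ)) * ‖p‖ := by
      intro j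
      have hpj := norm_le_pi_norm p j
      rw [hp] at hpj
      simp only [norm_mul, Real.norm_eq_abs, abs_of_pos (flowScale_pos _ _)] at hpj ⊢
      have h0 : flowScale m n s i * |F i j| ≤ 1 / (2 * (m + n : ℝ)) * flowScale m n s j := by
        by_cases hz : F i j = 0
        · rw [hz, abs_zero, mul_zero]
          exact mul_nonneg (by positivity) (flowScale_pos _ _).le
        · rw [mul_comm]
          refine mul_le_mul (hF i j) ?_ (flowScale_pos _ _).le (by positivity)
          have h1 : 0 ≤ s / m := by positivity
          have h2 : 0 ≤ s / n := by positivity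
          rcases i with i | i <;> rcases j with j | j <;>
            simp only [flowScale, Sum.elim_inl, Sum.elim_inr, le_refl]
          · exact Real.exp_le_exp.mpr (by linarith)
          · exact absurd (hF0 i j) hz
      calc flowScale m n s i * (|F i j| * |u j|) = flowScale m n s i * |F i j| * |u j| := by ring
        _ ≤ 1 / (2 * (m + n : ℝ)) * flowScale m n s j * |u j| := by gcongr
        _ = 1 / (2 * (m + n : ℝ)) * (flowScale m n s j * |u j|) := by ring
        _ ≤ _ := by gcongr
    rw [hq]
    simp only [Matrix.mulVec, dotProduct, Finset.mul_sum]
    refine (norm_sum_le _ _).trans ((Finset.sum_le_sum fun j _ => hterm j).trans ?_)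
    rw [Finset.sum_const, Finset.card_univ, Fintype.card_sum, Fintype.card_fin, Fintype.card_fin,
      nsmul_eq_mul]
    push_cast
    apply le_of_eq
    field_simp
  rw [hsum]
  have h1 := norm_add_le p q
  have h2 := norm_sub_le_norm_add p q
  have h3 := norm_nonneg p
  exact ⟨by linarith, by linarith⟩

end glue

/-- Every nonzero integer vector has norm at least `c` at time `t` along the flow of `ξ`. -/
def FlowSeparated {m n : ℕ} (c : ℝ) (ξ : Matrix (Fin n) (Fin m) ℝ) (t : ℝ) : Prop :=
  ∀ v : Fin m ⊕ Fin n → ℤ, v ≠ 0 → c ≤ flowNorm ξ t (fun i => (v i : ℝ))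

theorem exists_gluing {m n : ℕ} (hm : 1 ≤ m) (hn : 1 ≤ n) {c : ℝ} (hc : 0 < c)
    {B : Matrix (Fin m ⊕ Fin n) (Fin m ⊕ Fin n) ℝ} (hB : B.det ≠ 0) :
    ∃ N : ℝ, 1 ≤ N ∧ ∀ (ξ : Matrix (Fin n) (Fin m) ℝ) (t : ℝ), FlowSeparated c ξ t →
      ∃ γ : Matrix (Fin m ⊕ Fin n) (Fin m ⊕ Fin n) ℤ, γ.det ≠ 0 ∧
        |(γ.det : ℝ)| ≤ (m + n).factorial * (2 * N) ^ (m + n) * |B.det| ∧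
        ∀ ζ : Matrix (Fin n) (Fin m) ℝ, (∀ k j, |ζ k j| ≤ 1) →
          ∃ ξ' : Matrix (Fin n) (Fin m) ℝ,
            (∀ k j, |ξ' k j - ξ k j| ≤ 4 * Real.exp (-((1 / m + 1 / n) * t))) ∧
            ∀ s : ℝ, 0 ≤ s → ∀ w : Fin m ⊕ Fin n → ℝ,
              N / 2 * flowNorm ζ s (B.mulVec w) ≤
                flowNorm ξ' (t + s) ((γ.map (Int.cast : ℤ → ℝ)).mulVec w) ∧
              flowNorm ξ' (t + s) ((γ.map (Int.cast : ℤ → ℝ)).mulVec w) ≤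
                2 * N * flowNorm ζ s (B.mulVec w) := by
  have : Nonempty (Fin m ⊕ Fin n) := ⟨Sum.inl ⟨0, hm⟩⟩
  have hm1 : (1 : ℝ) ≤ m := by exact_mod_cast hm
  have hn1 : (1 : ℝ) ≤ n := by exact_mod_cast hn
  obtain ⟨R, hR, hcov⟩ := exists_int_norm_sub_le (Fin m ⊕ Fin n) hc
  obtain ⟨b, hb⟩ : ∃ b : ℝ, ∀ i j, |B⁻¹ i j| ≤ b := by
    obtain ⟨b, hb⟩ := (Set.finite_range fun p : (Fin m ⊕ Fin n) × (Fin m ⊕ Fin n) =>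
      |B⁻¹ p.1 p.2|).bddAbove
    exact ⟨b, fun i j => hb ⟨(i, j), rfl⟩⟩
  have hb0 : 0 ≤ b := (abs_nonneg _).trans (hb (Sum.inl ⟨0, hm⟩) (Sum.inl ⟨0, hm⟩))
  obtain ⟨d, hd⟩ : ∃ d : ℝ, d = (m + n : ℝ) := ⟨_, rfl⟩
  have hd2 : 2 ≤ d := by linarith
  have hcard : ((Fintype.card (Fin m ⊕ Fin n) : ℕ) : ℝ) = d := by simp [hd]
  set N : ℝ := 1 + 20 * d ^ 2 * (d * (R * b)) with hN
  have hN1 : 1 ≤ N := by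
    have : 0 ≤ 20 * d ^ 2 * (d * (R * b)) := by positivity
    linarith
  have hN0 : 0 < N := by linarith
  refine ⟨N, hN1, fun ξ t hξ => ?_⟩
  set A := Matrix.diagonal (flowScale m n t) * shear ξ with hA
  have hAv : ∀ w i, A.mulVec w i = flowScale m n t i * (shear ξ).mulVec w i := fun w i => by
    rw [hA, ← Matrix.mulVec_mulVec, Matrix.mulVec_diagonal]
  have hAdet : A.det = 1 := by
    rw [hA, Matrix.det_mul, Matrix.det_diagonal, prod_flowScale hm hn, det_shear, one_mul]
  have hApt := hcov A (by rw [hAdet, abs_one]) (fun v hv => by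
    have := hξ v hv
    rw [flowNorm] at this
    convert this using 2
    ext i; exact hAv _ i)
  choose g hg using fun j => hApt (fun i => N * B i j)
  set γ : Matrix (Fin m ⊕ Fin n) (Fin m ⊕ Fin n) ℤ := Matrix.of fun i j => g j i with hγ
  set γ' := γ.map (Int.cast : ℤ → ℝ) with hγ'
  set F := A * γ' - N • B with hF
  have hFb : ∀ i j, |F i j| ≤ R := by
    intro i j
    have := (norm_le_pi_norm _ i).trans (hg j)
    rw [Real.norm_eq_abs, Pi.sub_apply] at this
    rw [hF, Matrix.sub_apply, Matrix.smul_apply, smul_eq_mul]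
    exact this
  set E := N⁻¹ • (F * B⁻¹) with hE
  have hEb : ∀ i j, |E i j| ≤ 1 / (20 * (m + n : ℝ) ^ 2) := by
    intro i j
    rw [← hd, hE, Matrix.smul_apply, smul_eq_mul, abs_mul, abs_of_pos (inv_pos.mpr hN0),
      inv_mul_le_iff₀ hN0, mul_one_div, le_div_iff₀ (by positivity)]
    have h1 := Matrix.abs_mul_apply_le hFb hb hR.le i j
    rw [hcard] at h1
    have h2 : |(F * B⁻¹) i j| * (20 * d ^ 2) ≤ d * (R * b) * (20 * d ^ 2) := by gcongr
    linarith
  have hkey : A * γ' = N • ((1 + E) * B) := by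
    have hFB : F * B⁻¹ * B = F := by
      rw [Matrix.mul_assoc, Matrix.nonsing_inv_mul _ (Ne.isUnit hB), Matrix.mul_one]
    rw [Matrix.add_mul, Matrix.one_mul, hE, Matrix.smul_mul, hFB, smul_add, smul_smul,
      mul_inv_cancel₀ hN0.ne', one_smul, hF, add_sub_cancel]
  have hdetγ : (γ.det : ℝ) = N ^ (m + n) * ((1 + E).det * B.det) := by
    have h1 : (γ.det : ℝ) = γ'.det := by
      rw [hγ']; exact Int.cast_det γ
    have h2 := congrArg Matrix.det hkey
    rw [Matrix.det_mul, hAdet, one_mul, Matrix.det_smul, Matrix.det_mul] at h2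
    rw [h1, h2]; simp
  have he1 : 1 / (20 * d ^ 2) ≤ 1 := by
    rw [div_le_one (by positivity)]; nlinarith
  have hEdet : (1 + E).det ≠ 0 := by
    refine Matrix.det_one_add_ne_zero hEb ?_
    rw [hcard, ← hd, mul_one_div, div_lt_one (by positivity)]
    nlinarith
  have hEdet' : |(1 + E).det| ≤ (m + n).factorial * 2 ^ (m + n) := by
    have := Matrix.det_le (A := 1 + E) (abv := AbsoluteValue.abs) (x := 2) (fun i j => by
      have h1 := hEb i j
      rw [← hd] at h1
      have h2 : |(1 : Matrix (Fin m ⊕ Fin n) (Fin m ⊕ Fin n) ℝ) i j| ≤ 1 := by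
        by_cases h : i = j <;> simp [Matrix.one_apply, h]
      rw [AbsoluteValue.abs_apply, Matrix.add_apply]
      linarith [abs_add_le ((1 : Matrix (Fin m ⊕ Fin n) (Fin m ⊕ Fin n) ℝ) i j) (E i j)])
    simpa [AbsoluteValue.abs_apply] using this
  refine ⟨γ, ?_, ?_, fun ζ hζ => ?_⟩
  · intro h
    rw [h, Int.cast_zero] at hdetγ
    have : N ^ (m + n) * ((1 + E).det * B.det) ≠ 0 := by positivity
    exact this hdetγ.symm
  · rw [hdetγ, abs_mul, abs_mul, abs_of_pos (by positivity : 0 < N ^ (m + n)), ← mul_assoc,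
      mul_pow]
    refine mul_le_mul_of_nonneg_right ?_ (abs_nonneg _)
    calc _ ≤ N ^ (m + n) * ((m + n).factorial * 2 ^ (m + n)) := by gcongr
      _ = _ := by ring
  · obtain ⟨η, G, hη, hG, hG0, hglue⟩ := exists_shear_mul_one_add hm hn hEb hζ
    refine ⟨Matrix.of fun k j => ξ k j + Real.exp (-((1 / m + 1 / n) * t)) * η k j,
      fun k j => ?_, fun s hs w => ?_⟩
    · rw [Matrix.of_apply, add_sub_cancel_left, abs_mul, abs_of_pos (Real.exp_pos _), mul_comm]
      gcongr
      exact hη k j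
    · set ξ' : Matrix (Fin n) (Fin m) ℝ :=
        Matrix.of fun k j => ξ k j + Real.exp (-((1 / m + 1 / n) * t)) * η k j with hξ'
      have hflow : ∀ u : Fin m ⊕ Fin n → ℝ, ∀ i,
          flowScale m n t i * (shear ξ').mulVec u i = (shear η).mulVec (A.mulVec u) i := by
        rintro u (i | i)
        · rw [shear_mulVec_inl, shear_mulVec_inl, hAv, shear_mulVec_inl]
        · simp only [shear_mulVec_inr, hAv, shear_mulVec_inl, flowScale, Sum.elim_inr,
            Sum.elim_inl, hξ', Matrix.of_apply]
          rw [mul_add, mul_add, add_assoc]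
          congr 1
          rw [Finset.mul_sum, Finset.mul_sum, ← Finset.sum_add_distrib]
          refine Finset.sum_congr rfl fun j _ => ?_
          have : Real.exp (-(t / m)) =
              Real.exp (t / n) * Real.exp (-((1 / m + 1 / n) * t)) := by
            rw [← Real.exp_add]; congr 1; ring
          rw [this]; ring
      have hvec : (shear η).mulVec (A.mulVec (γ'.mulVec w)) =
          N • (1 + G).mulVec ((shear ζ).mulVec (B.mulVec w)) := by
        rw [Matrix.mulVec_mulVec _ A, hkey, Matrix.smul_mulVec, Matrix.mulVec_smul,
          Matrix.mulVec_mulVec, ← Matrix.mul_assoc, hglue, Matrix.mulVec_mulVec,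
          Matrix.mulVec_mulVec]
      have hnorm : flowNorm ξ' (t + s) (γ'.mulVec w) =
          N * ‖fun i => flowScale m n s i *
            (1 + G).mulVec ((shear ζ).mulVec (B.mulVec w)) i‖ := by
        rw [flowNorm]
        conv_rhs => rw [← abs_of_pos hN0, ← Real.norm_eq_abs, ← norm_smul]
        congr 1
        ext i
        rw [add_comm t s, flowScale_add, mul_assoc, hflow, hvec]
        simp only [Pi.smul_apply, smul_eq_mul]
        ring
      obtain ⟨h1, h2⟩ := norm_flowScale_mul_one_add hm hG hG0 hs ((shear ζ).mulVec (B.mulVec w))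
      rw [hnorm]
      constructor
      · calc N / 2 * flowNorm ζ s (B.mulVec w) = N * (1 / 2 * flowNorm ζ s (B.mulVec w)) := by ring
          _ ≤ _ := by gcongr; exact h1
      · calc _ ≤ N * (2 * flowNorm ζ s (B.mulVec w)) := by gcongr; exact h2
          _ = _ := by ring

section normForm

open Polynomial

/-- The polynomial `∏ (X - 4 (i + 1)) + 2`, which is irreducible and has only real roots. -/
noncomputable def shiftedProd (D : ℕ) : ℤ[X] :=
  ∏ i : Fin D, (X - C (4 * ((i : ℤ) + 1))) + C 2

variable {D : ℕ}

theorem monic_prod_X_sub_C_and_natDegree (D : ℕ) :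
    (∏ i : Fin D, (X - C (4 * ((i : ℤ) + 1)))).Monic ∧
      (∏ i : Fin D, (X - C (4 * ((i : ℤ) + 1)))).natDegree = D :=
  ⟨monic_prod_of_monic _ _ fun i _ => monic_X_sub_C _, by
    rw [natDegree_prod_of_monic _ _ fun i _ => monic_X_sub_C _]
    simp only [natDegree_X_sub_C, Finset.sum_const, Finset.card_univ, Fintype.card_fin, smul_eq_mul,
      mul_one]⟩

theorem natDegree_shiftedProd (D : ℕ) : (shiftedProd D).natDegree = D := by
  rw [shiftedProd, natDegree_add_C, (monic_prod_X_sub_C_and_natDegree D).2]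

theorem monic_shiftedProd (hD : 0 < D) : (shiftedProd D).Monic := by
  obtain ⟨h1, h2⟩ := monic_prod_X_sub_C_and_natDegree D
  refine h1.add_of_left ?_
  rw [degree_eq_natDegree h1.ne_zero, h2]
  exact degree_C_le.trans_lt (by exact_mod_cast hD)

theorem irreducible_shiftedProd (hD : 0 < D) : Irreducible (shiftedProd D) := by
  have hmap : (shiftedProd D).map (Int.castRingHom (ZMod 4)) = X ^ D + C 2 := by
    have h4 : ∀ a : ℤ, Int.castRingHom (ZMod 4) (4 * a) = 0 := fun a => by
      rw [eq_intCast, ZMod.intCast_zmod_eq_zero_iff_dvd]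
      exact dvd_mul_right _ _
    simp only [shiftedProd, Polynomial.map_add, Polynomial.map_prod, Polynomial.map_sub, map_X,
      Polynomial.map_C, h4]
    simp
  have hcoeff : ∀ k, (((shiftedProd D).coeff k : ℤ) : ZMod 4) =
      (X ^ D + C 2 : (ZMod 4)[X]).coeff k := by
    intro k
    rw [← hmap, coeff_map]; rfl
  refine IsEisensteinAt.irreducible
    (show (shiftedProd D).IsEisensteinAt (Ideal.span {2}) from ⟨?_, fun {k} hk => ?_, ?_⟩)
    ((Ideal.span_singleton_prime (by norm_num)).mpr Int.prime_two)
    (monic_shiftedProd hD).isPrimitive (by rw [natDegree_shiftedProd]; exact hD)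
  · rw [(monic_shiftedProd hD).leadingCoeff, Ideal.mem_span_singleton]
    norm_num
  · rw [natDegree_shiftedProd] at hk
    have h := hcoeff k
    rw [coeff_add, coeff_X_pow, if_neg hk.ne, zero_add, coeff_C] at h
    rw [Ideal.mem_span_singleton]
    split_ifs at h
    · have h2 := (ZMod.intCast_eq_intCast_iff_dvd_sub _ 2 4).mp (by simpa using h)
      have : (2 : ℤ) ∣ 2 - (shiftedProd D).coeff k := dvd_trans (by norm_num) h2
      omega
    · have h2 := (ZMod.intCast_zmod_eq_zero_iff_dvd _ 4).mp h
      exact dvd_trans (by norm_num) h2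
  · have h := hcoeff 0
    rw [coeff_add, coeff_X_pow, if_neg hD.ne, zero_add, coeff_C, if_pos rfl] at h
    rw [Ideal.span_singleton_pow, Ideal.mem_span_singleton]
    intro h2
    have h3 := (ZMod.intCast_eq_intCast_iff_dvd_sub _ 2 4).mp (by simpa using h)
    norm_num at h2 h3
    omega

theorem aeval_shiftedProd (x : ℝ) :
    aeval x (shiftedProd D) = ∏ i : Fin D, (x - 4 * ((i : ℝ) + 1)) + 2 := by
  simp only [shiftedProd, map_add, map_prod, map_sub, aeval_X, aeval_C]
  simp

theorem exists_strictMono_roots_shiftedProd (hD : 2 ≤ D) :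
    ∃ r : Fin D → ℝ, Function.Injective r ∧ ∀ i, aeval (r i) (shiftedProd D) = 0 := by
  set P : ℝ → ℝ := fun x => ∏ i : Fin D, (x - 4 * ((i : ℝ) + 1)) with hP
  have hbig : ∀ j : ℕ, 4 ≤ |P (4 * j + 2)| := by
    intro j
    rw [hP, Finset.abs_prod]
    have h1 : ∀ i : Fin D, 2 ≤ |(4 * j + 2 : ℝ) - 4 * ((i : ℝ) + 1)| := by
      intro i
      rcases le_or_gt j i with h | h
      · have : (j : ℝ) ≤ i := by exact_mod_cast h
        rw [le_abs]; right; linarith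
      · have : (i : ℝ) + 1 ≤ j := by exact_mod_cast h
        rw [le_abs]; left; linarith
    calc (4 : ℝ) = 2 ^ 2 := by norm_num
      _ ≤ 2 ^ D := pow_le_pow_right₀ one_le_two hD
      _ = ∏ _i : Fin D, (2 : ℝ) := by simp
      _ ≤ _ := Finset.prod_le_prod (fun _ _ => by norm_num) fun i _ => h1 i
  have hsign : ∀ j : Fin D, P (4 * j + 2) * P (4 * (j + 1) + 2) < 0 := by
    intro j
    rw [hP, ← Finset.prod_mul_distrib, ← Finset.mul_prod_erase _ _ (Finset.mem_univ j)]
    refine mul_neg_of_neg_of_pos (by nlinarith) (Finset.prod_pos fun i hi => ?_)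
    rcases lt_or_gt_of_ne (Finset.ne_of_mem_erase hi) with h | h
    · have : (i : ℝ) + 1 ≤ j := by exact_mod_cast h
      exact mul_pos (by linarith) (by linarith)
    · have : (j : ℝ) + 1 ≤ i := by exact_mod_cast h
      exact mul_pos_of_neg_of_neg (by linarith) (by linarith)
  have hcont : Continuous fun x => P x + 2 := by
    simp only [hP]; fun_prop
  have hroot : ∀ j : Fin D, ∃ x : ℝ, 4 * j + 2 ≤ x ∧ x < 4 * (j + 1) + 2 ∧ P x + 2 = 0 := by
    intro j
    have h1 := hbig j
    have h2 := hbig (j + 1)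
    push_cast at h2
    have h3 := hsign j
    have hmem : (0 : ℝ) ∈ Set.uIcc (P (4 * j + 2) + 2) (P (4 * (j + 1) + 2) + 2) := by
      rw [Set.mem_uIcc]
      rw [le_abs] at h1 h2
      rcases h1 with h1 | h1 <;> rcases h2 with h2 | h2
      · nlinarith
      · right; constructor <;> linarith
      · left; constructor <;> linarith
      · nlinarith
    obtain ⟨x, hx, hx0⟩ := intermediate_value_uIcc hcont.continuousOn hmem
    rw [Set.uIcc_of_le (by linarith)] at hx
    refine ⟨x, hx.1, lt_of_le_of_ne hx.2 ?_, hx0⟩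
    rintro rfl
    have : P (4 * (j + 1) + 2) = -2 := by linarith
    rw [this] at h2
    norm_num at h2
  choose r hr1 hr2 hr3 using hroot
  refine ⟨r, ?_, fun i => by rw [aeval_shiftedProd]; exact hr3 i⟩
  refine StrictMono.injective fun i j hij => ?_
  have : (i : ℝ) + 1 ≤ j := by exact_mod_cast hij
  linarith [hr2 i, hr1 j]

theorem exists_matrix_one_le_prod (hD : 2 ≤ D) :
    ∃ B : Matrix (Fin D) (Fin D) ℝ, B.det ≠ 0 ∧
      ∀ v : Fin D → ℤ, v ≠ 0 → 1 ≤ ∏ i, |B.mulVec (fun j => (v j : ℝ)) i| := by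
  obtain ⟨r, hinj, hr⟩ := exists_strictMono_roots_shiftedProd hD
  refine ⟨Matrix.vandermonde r, Matrix.det_vandermonde_ne_zero_iff.mpr hinj, fun v hv => ?_⟩
  have hD0 : 0 < D := by omega
  set f := shiftedProd D with hf
  have hfm : f.Monic := monic_shiftedProd hD0
  have hfdeg : f.natDegree = D := natDegree_shiftedProd D
  set p : ℤ[X] := ∑ j : Fin D, C (v j) * X ^ (j : ℕ) with hp
  have hpdeg : p.degree < D := by
    refine (degree_sum_le _ _).trans_lt ((Finset.sup_lt_iff
      (by exact_mod_cast WithBot.bot_lt_coe D)).mpr fun j _ => ?_)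
    exact (degree_C_mul_X_pow_le _ _).trans_lt (by exact_mod_cast j.2)
  have hpcoeff : ∀ j : Fin D, p.coeff j = v j := by
    intro j
    simp only [hp, finsetSum_coeff, coeff_C_mul, coeff_X_pow]
    rw [Finset.sum_eq_single j]
    · simp
    · intro i _ hij
      rw [if_neg (fun h => hij (Fin.ext h.symm)), mul_zero]
    · simp
  have hp0 : p ≠ 0 := by
    intro h
    apply hv
    ext j
    rw [← hpcoeff, h, coeff_zero]; rfl
  have hev : ∀ i, (Matrix.vandermonde r).mulVec (fun j => (v j : ℝ)) i = aeval (r i) p := by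
    intro i
    simp [hp, Matrix.mulVec, dotProduct, Matrix.vandermonde_apply, mul_comm]
  have hirr : Irreducible (f.map (algebraMap ℤ ℚ)) :=
    (hfm.irreducible_iff_irreducible_map_fraction_map).mp (irreducible_shiftedProd hD0)
  have hne : ∀ i, aeval (r i) p ≠ 0 := by
    intro i h
    have h1 : aeval (r i) (f.map (algebraMap ℤ ℚ)) = 0 := by
      rw [aeval_map_algebraMap]; exact hr i
    have h2 := minpoly.eq_of_irreducible_of_monic hirr h1 (hfm.map _)
    have h3 : (minpoly ℚ (r i)).degree ≤ (p.map (algebraMap ℤ ℚ)).degree :=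
      minpoly.degree_le_of_ne_zero ℚ (r i)
        ((Polynomial.map_ne_zero_iff (algebraMap ℤ ℚ).injective_int).mpr hp0)
        (by rw [aeval_map_algebraMap]; exact h)
    rw [← h2, hfm.degree_map, degree_eq_natDegree hfm.ne_zero, hfdeg] at h3
    exact absurd (h3.trans degree_map_le) (not_le.mpr hpdeg)
  set g := f.map (Int.castRingHom ℝ) with hg
  have hgm : g.Monic := hfm.map _
  have hgdeg : g.natDegree = D := by rw [hg, hfm.natDegree_map, hfdeg]
  have hroots : g.roots = Finset.univ.val.map r := by
    symm
    refine Multiset.eq_of_le_of_card_le ?_ ?_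
    · rw [Multiset.le_iff_subset (Multiset.Nodup.map hinj Finset.univ.nodup)]
      intro x hx
      obtain ⟨i, -, rfl⟩ := Multiset.mem_map.mp hx
      rw [mem_roots hgm.ne_zero, IsRoot.def, hg, eval_map]
      exact hr i
    · rw [Multiset.card_map, Finset.card_val, Finset.card_univ, Fintype.card_fin, ← hgdeg]
      exact g.card_roots'
  have hsplit : g.Splits := by
    rw [splits_iff_card_roots, hroots, hgdeg]; simp
  have hres := resultant_eq_prod_eval g (p.map (Int.castRingHom ℝ)) p.natDegree
    natDegree_map_le hsplit
  rw [hgm.leadingCoeff, one_pow, one_mul, hroots, Multiset.map_map, hgdeg, hg, resultant_map_map]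
    at hres
  have hres' : ((resultant f p D p.natDegree : ℤ) : ℝ) = ∏ i, aeval (r i) p := by
    rw [eq_intCast] at hres
    rw [hres]
    refine congrArg Multiset.prod (Multiset.map_congr rfl fun i _ => ?_)
    rw [Function.comp_apply, eval_map]; rfl
  have h0 : resultant f p D p.natDegree ≠ 0 := by
    intro h
    rw [h, Int.cast_zero] at hres'
    exact (Finset.prod_ne_zero_iff.mpr fun i _ => hne i) hres'.symm
  simp only [hev]
  rw [← Finset.abs_prod, ← hres']
  exact_mod_cast Int.one_le_abs h0

end normForm

theorem exists_matrix_fixing_coord {κ : Type*} [Fintype κ] [DecidableEq κ] (o : κ)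
    (hκ : 3 ≤ Fintype.card κ) :
    ∃ B : Matrix κ κ ℝ, B.det ≠ 0 ∧ (∀ w, B.mulVec w o = w o) ∧
      ∀ w : κ → ℤ, w ≠ 0 → w o = 0 →
        1 ≤ ∏ i ∈ Finset.univ.erase o, |B.mulVec (fun j => (w j : ℝ)) i| := by
  have hcard : Fintype.card {i // ¬ i = o} = Fintype.card κ - 1 := by
    rw [Fintype.card_subtype_compl]; simp
  obtain ⟨e⟩ : Nonempty ({i // ¬ i = o} ≃ Fin (Fintype.card κ - 1)) :=
    ⟨Fintype.equivFinOfCardEq hcard⟩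
  obtain ⟨B₁, hB₁, hprod⟩ := exists_matrix_one_le_prod (D := Fintype.card κ - 1) (by omega)
  set σ := Equiv.sumCompl (fun i : κ => i = o) with hσ
  set M : Matrix ({i // i = o} ⊕ {i // ¬ i = o}) ({i // i = o} ⊕ {i // ¬ i = o}) ℝ :=
    Matrix.fromBlocks 1 0 0 (B₁.submatrix e e) with hM
  have hmul : ∀ w x, (M.submatrix σ.symm σ.symm).mulVec w (σ x) = M.mulVec (w ∘ σ) x := by
    intro w x
    rw [Matrix.submatrix_mulVec_equiv]
    simp
  refine ⟨M.submatrix σ.symm σ.symm, ?_, fun w => ?_, fun w hw hwo => ?_⟩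
  · rw [Matrix.det_submatrix_equiv_self, hM, Matrix.det_fromBlocks_zero₁₂,
      Matrix.det_submatrix_equiv_self]
    simpa using hB₁
  · have := hmul w (Sum.inl ⟨o, rfl⟩)
    rw [hM, Matrix.fromBlocks_mulVec] at this
    simpa [hσ] using this
  · have hpr := hprod (fun j => w (e.symm j).1) (by
      intro h
      apply hw
      ext i
      by_cases hi : i = o
      · rw [hi, hwo]; rfl
      · simpa using congrFun h (e ⟨i, hi⟩))
    refine hpr.trans (le_of_eq ?_)
    rw [Finset.prod_subtype (p := fun i => ¬ i = o) _ (by simp)]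
    refine (Fintype.prod_equiv e _ _ fun i => ?_).symm
    have := hmul (fun j => (w j : ℝ)) (Sum.inr i)
    rw [hM, Matrix.fromBlocks_mulVec] at this
    have hi : σ (Sum.inr i) = i := rfl
    rw [hi] at this
    rw [this]
    simp only [Sum.elim_inr, Matrix.zero_mulVec, zero_add, Matrix.submatrix_mulVec_equiv,
      Function.comp_apply]
    rfl

theorem exists_excursion {m n D : ℕ} (hm : 1 ≤ m) (hn : 2 ≤ n) (hD : D + 1 = m + n) :
    ∃ B : Matrix (Fin m ⊕ Fin n) (Fin m ⊕ Fin n) ℝ, B.det ≠ 0 ∧ ∃ C : ℝ, 0 < C ∧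
      ∀ T : ℝ, 0 ≤ T → ∃ ζ : Matrix (Fin n) (Fin m) ℝ, (∀ k j, |ζ k j| ≤ 1) ∧
        ∀ s : ℝ, 0 ≤ s → s ≤ T →
          (∀ w : Fin m ⊕ Fin n → ℤ, w ≠ 0 →
            1 / 2 * Real.exp (-(min (s / n) ((T - s) / m) / D)) ≤
              flowNorm ζ s (B.mulVec fun i => (w i : ℝ))) ∧
          ∃ w : Fin m ⊕ Fin n → ℤ, w ≠ 0 ∧
            flowNorm ζ s (B.mulVec fun i => (w i : ℝ)) ≤
              C * Real.exp (-(min (s / n) ((T - s) / m) / D)) := by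
  obtain ⟨j₀⟩ : Nonempty (Fin m) := ⟨⟨0, hm⟩⟩
  obtain ⟨k₀⟩ : Nonempty (Fin n) := ⟨⟨0, by omega⟩⟩
  have hκ : Fintype.card (Fin m ⊕ Fin n) = D + 1 := by simp [hD]
  obtain ⟨B, hB, hBo, hBprod⟩ := exists_matrix_fixing_coord (Sum.inr k₀ : Fin m ⊕ Fin n)
    (by omega)
  set o : Fin m ⊕ Fin n := Sum.inr k₀ with ho
  set e : Fin m ⊕ Fin n := Sum.inl j₀ with he
  have heo : e ∈ Finset.univ.erase o := by simp [he, ho]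
  have hDpos : (0 : ℝ) < D := by exact_mod_cast (by omega : 0 < D)
  refine ⟨B, hB, 2 * |B.det| + 2, by positivity, fun T hT => ?_⟩
  set ε := Real.exp (-(T / m)) with hε
  set ζ : Matrix (Fin n) (Fin m) ℝ := Matrix.single k₀ j₀ ε with hζ
  have hm0 : (0 : ℝ) < m := by exact_mod_cast hm
  have hn0 : (0 : ℝ) < n := by exact_mod_cast (by omega : 0 < n)
  have hε1 : ε ≤ 1 := Real.exp_le_one_iff.mpr (by have := div_nonneg hT hm0.le; linarith)
  refine ⟨ζ, fun k j => ?_, fun s hs hsT => ?_⟩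
  · rw [hζ, Matrix.single_apply]
    split_ifs
    · rw [abs_of_pos (Real.exp_pos _)]; exact hε1
    · simp
  have hshear_o : ∀ u, (shear ζ).mulVec u o = u o + ε * u e := by
    intro u
    rw [ho, shear_mulVec_inr, he, hζ, Finset.sum_eq_single j₀]
    · simp
    · intro j _ hj; simp [hj.symm]
    · simp
  have hshear : ∀ u i, i ≠ o → (shear ζ).mulVec u i = u i := by
    rintro u (i | i) hi
    · rw [shear_mulVec_inl]
    · have : k₀ ≠ i := fun h => hi (by rw [ho, h])
      rw [shear_mulVec_inr, hζ]
      simp [this]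
  set M := min (s / n) ((T - s) / m) with hM
  set δ := min 0 ((T - s) / m - s / n) with hδ
  have hMδ : M = s / n + δ := by
    rw [hM, hδ, ← min_add_add_left]; simp
  have hM0 : 0 ≤ M := le_min (by positivity) (div_nonneg (by linarith) hm0.le)
  set r : Fin m ⊕ Fin n → ℝ :=
    fun i => (flowScale m n s i)⁻¹ * (if i = e then Real.exp δ else 1) with hr
  have hr0 : ∀ i, 0 < r i := fun i => mul_pos (inv_pos.mpr (flowScale_pos _ _)) (by
    split_ifs
    · exact Real.exp_pos _
    · exact one_pos)
  have hso : flowScale m n s o = Real.exp (s / n) := rfl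
  have hse : flowScale m n s e = Real.exp (-(s / m)) := rfl
  have hprod_r : ∏ i ∈ Finset.univ.erase o, r i = Real.exp M := by
    have h1 := prod_flowScale hm (by omega : 1 ≤ n) s
    rw [← Finset.mul_prod_erase _ _ (Finset.mem_univ o)] at h1
    rw [hr, Finset.prod_mul_distrib, Finset.prod_inv_distrib, Finset.prod_ite_eq', if_pos heo,
      ← eq_inv_of_mul_eq_one_left h1, hso, ← Real.exp_add, hMδ]
  have hcard_o : (Finset.univ.erase o).card = D := by
    rw [Finset.card_erase_of_mem (Finset.mem_univ _), Finset.card_univ, hκ]; rfl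
  have hprod_rl : ∀ l : ℝ, ∏ i ∈ Finset.univ.erase o, (l * r i) = l ^ D * Real.exp M := by
    intro l
    rw [Finset.prod_mul_distrib, Finset.prod_const, hcard_o, hprod_r]
  have hexpD : Real.exp (-(M / D)) ^ D * Real.exp M = 1 := by
    rw [← Real.exp_nat_mul, ← Real.exp_add, Real.exp_eq_one_iff]
    field_simp
    ring
  constructor
  · intro w hw
    set u := B.mulVec fun i => (w i : ℝ) with hu
    have huo : u o = w o := hBo _
    obtain ⟨l, hl⟩ : ∃ l, l = flowNorm ζ s u := ⟨_, rfl⟩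
    rw [← hl]
    have hl0 : 0 ≤ l := by rw [hl]; exact flowNorm_nonneg
    have hle : ∀ i, flowScale m n s i * |(shear ζ).mulVec u i| ≤ l := fun i => by
      rw [hl]; exact le_flowNorm i
    have hle_o := hle o
    rw [hshear_o, hso, huo] at hle_o
    have hle_e := hle e
    rw [hshear u e (Finset.ne_of_mem_erase heo), hse, Real.exp_neg,
      inv_mul_le_iff₀ (Real.exp_pos _)] at hle_e
    by_cases hwo : w o = 0
    · have hur : ∀ i ∈ Finset.univ.erase o, |u i| ≤ l * r i := by
        intro i hi
        have h1 := hle i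
        rw [hshear u i (Finset.ne_of_mem_erase hi)] at h1
        rw [hr]
        by_cases hie : i = e
        · simp only [hie, if_true, hse]
          rw [Real.exp_neg, inv_inv, ← Real.exp_add]
          rw [hwo, Int.cast_zero, zero_add, abs_mul, abs_of_pos (Real.exp_pos _), ← mul_assoc,
            ← Real.exp_add] at hle_o
          rcases min_choice 0 ((T - s) / m - s / n) with h | h
          · rw [hδ, h, add_zero, mul_comm]; exact hle_e
          · rw [hδ, h]
            have e1 : s / m + ((T - s) / m - s / n) = -(s / n + -(T / m)) := by ring
            rw [e1, Real.exp_neg, ← div_eq_mul_inv, le_div_iff₀ (Real.exp_pos _), mul_comm]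
            exact hle_o
        · simp only [hie, if_false, mul_one]
          rw [← div_eq_mul_inv, le_div_iff₀ (flowScale_pos _ _), mul_comm]
          exact h1
      have h1 := (hBprod w hw hwo).trans (Finset.prod_le_prod (fun _ _ => abs_nonneg _) hur)
      rw [hprod_rl, ← hexpD] at h1
      have h2 := le_of_mul_le_mul_right h1 (Real.exp_pos M)
      have h3 := le_of_pow_le_pow_left₀ (by omega : D ≠ 0) hl0 h2
      linarith [Real.exp_pos (-(M / D))]
    · have h1 : (1 : ℝ) ≤ |(w o : ℝ)| := by exact_mod_cast Int.one_le_abs hwo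
      have h2 : |(w o : ℝ)| ≤ |(w o : ℝ) + ε * u e| + |ε * u e| := by
        have := abs_sub ((w o : ℝ) + ε * u e) (ε * u e)
        rwa [add_sub_cancel_right] at this
      have h3 : |(w o : ℝ) + ε * u e| ≤ l := by
        refine le_trans (le_mul_of_one_le_left (abs_nonneg _) ?_) hle_o
        exact Real.one_le_exp (by positivity)
      have h4 : |ε * u e| ≤ l := by
        rw [abs_mul, abs_of_pos (Real.exp_pos _)]
        calc ε * |u e| ≤ ε * (Real.exp (s / m) * l) := by gcongr
          _ = Real.exp (-(T / m) + s / m) * l := by rw [Real.exp_add, hε]; ring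
          _ ≤ 1 * l := by
            gcongr
            refine Real.exp_le_one_iff.mpr ?_
            have : s / m ≤ T / m := by gcongr
            linarith
          _ = l := one_mul l
      have h5 : Real.exp (-(M / D)) ≤ 1 := by
        refine Real.exp_le_one_iff.mpr ?_
        have := div_nonneg hM0 hDpos.le
        linarith
      linarith
  · set l := (2 * |B.det| + 2) * Real.exp (-(M / D)) with hl
    have hl0 : 0 < l := by positivity
    obtain ⟨w, hw0, hw⟩ := exists_int_mulVec_le B hB
      (fun i => if i = o then 1 / 2 else l * r i)
      (fun i => by split_ifs; exacts [by norm_num, mul_pos hl0 (hr0 i)])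
      (by
        rw [← Finset.mul_prod_erase _ _ (Finset.mem_univ o), if_pos rfl,
          Finset.prod_congr rfl fun i hi => if_neg (Finset.ne_of_mem_erase hi), hprod_rl, hl,
          mul_pow, mul_assoc, hexpD, mul_one]
        have h1 : 2 * |B.det| + 2 ≤ (2 * |B.det| + 2) ^ D :=
          le_self_pow₀ (by linarith [abs_nonneg B.det]) (by omega)
        linarith)
    set u := B.mulVec fun i => (w i : ℝ) with hu
    have huo : u o = w o := hBo _
    have hwo : w o = 0 := by
      have h1 := hw o
      rw [huo, if_pos rfl] at h1
      by_contra h2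
      have h3 : (1 : ℝ) ≤ |(w o : ℝ)| := by exact_mod_cast Int.one_le_abs h2
      linarith
    have hur : ∀ i, i ≠ o → |u i| ≤ l * r i := fun i hi => by simpa [hi] using hw i
    have hδ0 : Real.exp δ ≤ 1 := Real.exp_le_one_iff.mpr (min_le_left _ _)
    refine ⟨w, hw0, (flowNorm_le_iff hl0.le).mpr fun i => ?_⟩
    by_cases hi : i = o
    · have h1 := hur e (Finset.ne_of_mem_erase heo)
      rw [hi, hshear_o, hso, ← hu, huo, hwo, Int.cast_zero, zero_add, abs_mul,
        abs_of_pos (Real.exp_pos _)]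
      simp only [hr, hse, if_true] at h1
      rw [Real.exp_neg, inv_inv] at h1
      have hδ' : δ ≤ (T - s) / m - s / n := min_le_right _ _
      calc Real.exp (s / n) * (ε * |u e|)
          ≤ Real.exp (s / n) * (ε * (l * (Real.exp (s / m) * Real.exp δ))) := by gcongr
        _ = l * Real.exp (s / n + (-(T / m)) + s / m + δ) := by
            simp only [Real.exp_add, hε]; ring
        _ ≤ l * 1 := by
            gcongr
            refine Real.exp_le_one_iff.mpr ?_
            have e1 : (T - s) / m = T / m - s / m := by ring
            linarith
        _ = l := mul_one l
    · rw [hshear u i hi]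
      have h1 := hur i hi
      have h2 : flowScale m n s i * (l * r i) ≤ l := by
        rw [hr]
        have h3 := flowScale_pos (m := m) (n := n) s i
        have h4 : (if i = e then Real.exp δ else 1) ≤ (1 : ℝ) := by
          split_ifs
          exacts [hδ0, le_rfl]
        calc _ = l * (if i = e then Real.exp δ else 1) := by field_simp
          _ ≤ l * 1 := by gcongr
          _ = l := mul_one l
      exact (mul_le_mul_of_nonneg_left h1 (flowScale_pos _ _).le).trans h2

section avoidance

theorem Finset.card_le_add_one_of_int (s : Finset ℤ) {u l : ℝ} (hl : 0 ≤ l)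
    (h : ∀ z ∈ s, u ≤ z ∧ (z : ℝ) ≤ u + l) : (s.card : ℝ) ≤ l + 1 := by
  have hsub : s ⊆ Finset.Icc ⌈u⌉ ⌊u + l⌋ := fun z hz =>
    Finset.mem_Icc.mpr ⟨Int.ceil_le.mpr (h z hz).1, Int.le_floor.mpr (h z hz).2⟩
  have h1 : (s.card : ℤ) ≤ max (⌊u + l⌋ + 1 - ⌈u⌉) 0 := by
    have := Finset.card_le_card hsub
    rw [Int.card_Icc] at this
    omega
  have h2 : (s.card : ℝ) ≤ max ((⌊u + l⌋ : ℝ) + 1 - ⌈u⌉) 0 := by exact_mod_cast h1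
  refine h2.trans (max_le ?_ (by linarith))
  linarith [Int.floor_le (u + l), Int.le_ceil u]

theorem card_fin_near_int_le {q : ℕ} {a b r : ℝ} (ha : a ≠ 0) (hr : 0 < r) (hr' : r ≤ 1 / 2)
    (h1 : 1 ≤ r * q) (haq : |a| ≤ r * q) [DecidablePred fun p : Fin q =>
      ∃ z : ℤ, |(p : ℝ) / q * a + b + z| ≤ r] :
    ((Finset.univ.filter fun p : Fin q => ∃ z : ℤ, |(p : ℝ) / q * a + b + z| ≤ r).card : ℝ) ≤
      9 * r * q * max 1 (1 / |a|) := by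
  classical
  have hq0 : (0 : ℝ) < q := by
    by_contra h
    nlinarith
  have ha0 : 0 < |a| := abs_pos.mpr ha
  set S := Finset.univ.filter fun p : Fin q => ∃ z : ℤ, |(p : ℝ) / q * a + b + z| ≤ r with hS
  have hmem : ∀ p ∈ S, ∃ z : ℤ, |(p : ℝ) / q * a + b + z| ≤ r := fun p hp =>
    (Finset.mem_filter.mp hp).2
  choose! z hz using hmem
  have himage : ((S.image z).card : ℝ) ≤ |a| + 2 := by
    have := Finset.card_le_add_one_of_int (S.image z) (u := -b - r - max a 0) (l := |a| + 1)
      (by linarith) (fun y hy => by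
        obtain ⟨p, hp, rfl⟩ := Finset.mem_image.mp hy
        have h2 := abs_le.mp (hz p hp)
        have hp0 : (0 : ℝ) ≤ (p : ℝ) / q := by positivity
        have hp1 : (p : ℝ) / q ≤ 1 := by
          rw [div_le_one hq0]; exact_mod_cast p.2.le
        have h3 : (p : ℝ) / q * a ≤ max a 0 := by
          rcases le_total 0 a with h | h
          · rw [max_eq_left h]; nlinarith
          · rw [max_eq_right h]; nlinarith
        have h4 : max a 0 - |a| ≤ (p : ℝ) / q * a := by
          rcases le_total 0 a with h | h
          · rw [max_eq_left h, abs_of_nonneg h]; nlinarith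
          · rw [max_eq_right h, abs_of_nonpos h]; nlinarith
        constructor <;> linarith)
    linarith
  have hfib : ∀ y ∈ S.image z, ((S.filter fun p => z p = y).card : ℝ) ≤ 2 * r * q / |a| + 1 := by
    intro y _
    have hinj : Function.Injective (fun p : Fin q => (p : ℤ)) := fun p p' h =>
      Fin.ext (Int.ofNat_inj.mp h)
    rw [← Finset.card_image_of_injective _ hinj]
    refine Finset.card_le_add_one_of_int _ (u := (-(b + y) / a - r / |a|) * q) (by positivity)
      fun i hi => ?_
    obtain ⟨p, hp, rfl⟩ := Finset.mem_image.mp hi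
    obtain ⟨hpS, hpy⟩ := Finset.mem_filter.mp hp
    have h2 := hz p hpS
    rw [hpy] at h2
    have h3 : |((p : ℝ) / q - -(b + y) / a)| ≤ r / |a| := by
      rw [le_div_iff₀ ha0, ← abs_mul]
      have h4 : ((p : ℝ) / q - -(b + y) / a) * a = (p : ℝ) / q * a + b + y := by
        rw [sub_mul, div_mul_cancel₀ _ ha]; ring
      rwa [h4]
    have h4 := abs_le.mp h3
    have h5 : ((p : ℤ) : ℝ) = (p : ℝ) / q * q := by
      rw [div_mul_cancel₀ _ hq0.ne']; simp
    rw [h5]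
    constructor
    · gcongr; linarith
    · have : (p : ℝ) / q * q ≤ (-(b + y) / a + r / |a|) * q := by gcongr; linarith
      calc _ ≤ _ := this
        _ = _ := by ring
  have hcard : (S.card : ℝ) ≤ (|a| + 2) * (2 * r * q / |a| + 1) := by
    have h2 : (S.card : ℝ) = ∑ y ∈ S.image z, ((S.filter fun p => z p = y).card : ℝ) := by
      rw [Finset.card_eq_sum_card_image z S]; push_cast; rfl
    rw [h2]
    calc _ ≤ ∑ y ∈ S.image z, (2 * r * q / |a| + 1) := Finset.sum_le_sum hfib
      _ = (S.image z).card * (2 * r * q / |a| + 1) := by rw [Finset.sum_const, nsmul_eq_mul]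
      _ ≤ _ := by gcongr
  refine hcard.trans ?_
  have e1 : (|a| + 2) * (2 * r * q / |a| + 1) = 2 * (r * q) + |a| + 4 * (r * q) * (1 / |a|) + 2 := by
    field_simp; ring
  have e2 : 9 * r * q * max 1 (1 / |a|) =
      5 * (r * q) * max 1 (1 / |a|) + 4 * (r * q) * max 1 (1 / |a|) := by ring
  rw [e1, e2]
  have h6 : 5 * (r * q) * 1 ≤ 5 * (r * q) * max 1 (1 / |a|) := by gcongr; exact le_max_left _ _
  have h7 : 4 * (r * q) * (1 / |a|) ≤ 4 * (r * q) * max 1 (1 / |a|) := by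
    gcongr; exact le_max_right _ _
  linarith

open Classical in
theorem card_row_near_int_le {m q : ℕ} {x : Fin m → ℝ} {b r : ℝ} (hx : x ≠ 0) (hr : 0 < r)
    (hr' : r ≤ 1 / 2) (h1 : 1 ≤ r * q) (hxq : ‖x‖ ≤ r * q) :
    ((Finset.univ.filter fun f : Fin m → Fin q =>
      ∃ z : ℤ, |∑ j, (f j : ℝ) / q * x j + b + z| ≤ r).card : ℝ) ≤
      9 * r * max 1 (1 / ‖x‖) * q ^ m := by
  obtain ⟨i, hi⟩ : ∃ i, |x i| = ‖x‖ := by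
    obtain ⟨i₀, _⟩ := Function.ne_iff.mp hx
    have : Nonempty (Fin m) := ⟨i₀⟩
    obtain ⟨i, -, hi⟩ := Finset.exists_max_image Finset.univ (fun i => |x i|)
      Finset.univ_nonempty
    refine ⟨i, le_antisymm (norm_le_pi_norm x i) ?_⟩
    exact (pi_norm_le_iff_of_nonneg (abs_nonneg _)).mpr fun j => hi j (Finset.mem_univ _)
  have hxi : x i ≠ 0 := by
    rw [← abs_pos, hi]; exact norm_pos_iff.mpr hx
  set Q := Finset.univ.filter fun f : Fin m → Fin q =>
      ∃ z : ℤ, |∑ j, (f j : ℝ) / q * x j + b + z| ≤ r with hQ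
  have hcount : (Q.card : ℝ) = ∑ g : {j // j ≠ i} → Fin q, ((Finset.univ.filter fun p : Fin q =>
      (Equiv.funSplitAt i (Fin q)).symm (p, g) ∈ Q).card : ℝ) := by
    have h2 : (Q.card : ℝ) = ∑ f : Fin m → Fin q, if f ∈ Q then (1 : ℝ) else 0 := by simp
    rw [h2, ← (Equiv.funSplitAt i (Fin q)).symm.sum_comp, Fintype.sum_prod_type_right]
    simp
  rw [hcount]
  have hfib : ∀ g : {j // j ≠ i} → Fin q, ((Finset.univ.filter fun p : Fin q =>
      (Equiv.funSplitAt i (Fin q)).symm (p, g) ∈ Q).card : ℝ) ≤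
      9 * r * q * max 1 (1 / ‖x‖) := by
    intro g
    rw [← hi]
    refine le_trans ?_ (card_fin_near_int_le (q := q) (b := ∑ j : {j // j ≠ i}, (g j : ℝ) / q * x j + b) hxi hr hr' h1
      (hi ▸ hxq))
    gcongr with p
    intro hp
    obtain ⟨z, hz⟩ := (Finset.mem_filter.mp hp).2
    refine ⟨z, ?_⟩
    convert hz using 2
    rw [Fintype.sum_eq_add_sum_subtype_ne _ i, ← add_assoc]
    congr 2
    congr 1
    · simp [Equiv.funSplitAt, Equiv.piSplitAt]
    · refine Finset.sum_congr rfl fun j _ => ?_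
      simp [Equiv.funSplitAt, Equiv.piSplitAt, j.2]
  refine (Finset.sum_le_sum fun g _ => hfib g).trans ?_
  rw [Finset.sum_const, nsmul_eq_mul, Finset.card_univ, Fintype.card_fun]
  have hm : m - 1 + 1 = m := by have := i.pos; omega
  simp only [Fintype.card_subtype_compl, Fintype.card_fin, Fintype.card_unique]
  have hpow : (q : ℝ) ^ m = q ^ (m - 1) * q := by rw [← pow_succ, hm]
  rw [hpow]
  refine le_of_eq ?_
  push_cast; ring

open Classical in
theorem exists_matrix_avoiding {ι : Type*} {m n : ℕ} (S : Finset ι) (x : ι → Fin m → ℝ)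
    (b : ι → Fin n → ℝ) {r : ℝ} (hr : 0 < r) (hr' : r ≤ 1 / 2) (hx : ∀ i ∈ S, x i ≠ 0)
    (hsum : ∑ i ∈ S, (9 * r * max 1 (1 / ‖x i‖)) ^ n < 1) :
    ∃ ζ : Matrix (Fin n) (Fin m) ℝ, (∀ k j, |ζ k j| ≤ 1) ∧
      ∀ i ∈ S, ∃ k, ∀ z : ℤ, r < |∑ j, ζ k j * x i j + b i k + z| := by
  obtain ⟨q, hq⟩ := exists_nat_ge ((1 + ∑ i ∈ S, ‖x i‖) / r)
  rw [div_le_iff₀ hr, mul_comm] at hq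
  have hxq : ∀ i ∈ S, ‖x i‖ ≤ r * q := fun i hi => by
    have := Finset.single_le_sum (f := fun i => ‖x i‖) (fun i _ => norm_nonneg _) hi
    linarith
  have h1 : 1 ≤ r * q := by
    have := Finset.sum_nonneg (s := S) (f := fun i => ‖x i‖) (fun i _ => norm_nonneg _)
    linarith
  have hq0 : (0 : ℝ) < q := by
    by_contra h
    nlinarith
  set bad : ι → Finset (Fin n → Fin m → Fin q) := fun i =>
    Fintype.piFinset fun k => Finset.univ.filter fun f : Fin m → Fin q =>
      ∃ z : ℤ, |∑ j, (f j : ℝ) / q * x i j + b i k + z| ≤ r with hbad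
  have hbadcard : ∀ i ∈ S, ((bad i).card : ℝ) ≤
      (9 * r * max 1 (1 / ‖x i‖)) ^ n * (q ^ m) ^ n := by
    intro i hi
    rw [hbad, Fintype.card_piFinset]
    push_cast
    rw [← mul_pow]
    calc _ ≤ ∏ _k : Fin n, (9 * r * max 1 (1 / ‖x i‖) * (q : ℝ) ^ m) := by
          refine Finset.prod_le_prod (fun _ _ => Nat.cast_nonneg _) fun k _ => ?_
          exact card_row_near_int_le (hx i hi) hr hr' h1 (hxq i hi)
      _ = _ := by simp
  have hex : ∃ P, P ∉ S.biUnion bad := by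
    by_contra! h
    have h2 : (Finset.univ : Finset (Fin n → Fin m → Fin q)) ⊆ S.biUnion bad := fun P _ => h P
    have h3 := (Finset.card_le_card h2).trans Finset.card_biUnion_le
    have h4 : (((q : ℝ) ^ m) ^ n) ≤ ∑ i ∈ S, ((bad i).card : ℝ) := by
      have h5 : ((Finset.univ : Finset (Fin n → Fin m → Fin q)).card : ℝ) = (((q : ℝ) ^ m) ^ n) := by
        simp
      rw [← h5]
      exact_mod_cast h3
    have h6 := h4.trans (Finset.sum_le_sum hbadcard)
    rw [← Finset.sum_mul] at h6
    have h7 : (0 : ℝ) < (q ^ m) ^ n := by positivity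
    nlinarith
  obtain ⟨P, hP⟩ := hex
  refine ⟨fun k j => (P k j : ℝ) / q, fun k j => ?_, fun i hi => ?_⟩
  · rw [abs_of_nonneg (by positivity), div_le_one hq0]
    exact_mod_cast (P k j).2.le
  · by_contra! h
    refine hP (Finset.mem_biUnion.mpr ⟨i, hi, Fintype.mem_piFinset.mpr fun k => ?_⟩)
    exact Finset.mem_filter.mpr ⟨Finset.mem_univ _, h k⟩

end avoidance

section latticeAvoidance

theorem Matrix.exists_finset_representatives {κ : Type*} [Fintype κ] [DecidableEq κ]
    {γ : Matrix κ κ ℤ} (hγ : γ.det ≠ 0) :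
    ∃ R : Finset (κ → ℤ), R.card ≤ γ.det.natAbs ∧
      ∀ v : κ → ℤ, ∃ ρ ∈ R, ∃ u : κ → ℤ, v = ρ + γ.mulVec u := by
  classical
  have hinj : Function.Injective γ.mulVecLin := by
    rw [Matrix.coe_mulVecLin]
    exact Matrix.mulVec_injective_of_det_ne_zero hγ
  have hcard := Submodule.natAbs_det_equiv (LinearMap.range γ.mulVecLin)
    (LinearEquiv.ofInjective γ.mulVecLin hinj)
  have hdet : LinearMap.det γ.mulVecLin = γ.det := LinearMap.det_toLin' γ
  have hcard' : γ.det.natAbs = Nat.card ((κ → ℤ) ⧸ LinearMap.range γ.mulVecLin) := by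
    rw [← hdet, ← hcard]; rfl
  have hfin : Finite ((κ → ℤ) ⧸ LinearMap.range γ.mulVecLin) :=
    Nat.finite_of_card_ne_zero (by rw [← hcard']; exact Int.natAbs_ne_zero.mpr hγ)
  have := Fintype.ofFinite ((κ → ℤ) ⧸ LinearMap.range γ.mulVecLin)
  refine ⟨Finset.univ.image fun q : (κ → ℤ) ⧸ LinearMap.range γ.mulVecLin => q.out, ?_,
    fun v => ⟨_, Finset.mem_image_of_mem _ (Finset.mem_univ (Submodule.Quotient.mk v)), ?_⟩⟩
  · rw [hcard', Nat.card_eq_fintype_card]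
    exact Finset.card_image_le
  · have h1 : (Submodule.Quotient.mk (Quotient.out (Submodule.Quotient.mk v :
        (κ → ℤ) ⧸ LinearMap.range γ.mulVecLin)) : (κ → ℤ) ⧸ LinearMap.range γ.mulVecLin) =
        Submodule.Quotient.mk v := Quotient.out_eq _
    obtain ⟨u, hu⟩ := (Submodule.Quotient.eq _).mp h1.symm
    exact ⟨u, by rw [← Matrix.mulVecLin_apply, hu]; abel⟩

theorem Matrix.exists_int_eq_det_mul {κ : Type*} [Fintype κ] [DecidableEq κ] (γ : Matrix κ κ ℤ)
    {w : κ → ℝ} {v : κ → ℤ}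
    (h : (γ.map (Int.cast : ℤ → ℝ)).mulVec w = fun i => (v i : ℝ)) (i : κ) :
    ∃ z : ℤ, (γ.det : ℝ) * w i = z := by
  refine ⟨γ.adjugate.mulVec v i, ?_⟩
  have h1 : (γ.adjugate.map (Int.cast : ℤ → ℝ)).mulVec
      ((γ.map (Int.cast : ℤ → ℝ)).mulVec w) = (γ.det : ℝ) • w := by
    have h2 : γ.adjugate.map (Int.cast : ℤ → ℝ) * γ.map (Int.cast : ℤ → ℝ) =
        (γ.det : ℝ) • (1 : Matrix κ κ ℝ) := by
      have h3 := congrArg (fun M : Matrix κ κ ℤ => M.map (Int.castRingHom ℝ)) γ.adjugate_mul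
      simp only [Matrix.map_mul] at h3
      refine h3.trans ?_
      ext a b
      simp only [Matrix.map_apply, Matrix.smul_apply, Matrix.one_apply]
      split_ifs <;> simp
    rw [Matrix.mulVec_mulVec, h2, Matrix.smul_mulVec, Matrix.one_mulVec]
  have h3 := congrFun h1 i
  rw [h, Pi.smul_apply, smul_eq_mul] at h3
  rw [← h3]
  simp [Matrix.mulVec, dotProduct]

/-- The integer vectors `k` with `‖x + k‖ ≤ A`. -/
noncomputable def intBox {m : ℕ} (x : Fin m → ℝ) (A : ℝ) : Finset (Fin m → ℤ) :=
  Fintype.piFinset fun j => Finset.Icc ⌈-A - x j⌉ ⌊A - x j⌋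

theorem mem_intBox {m : ℕ} {x : Fin m → ℝ} {A : ℝ} {k : Fin m → ℤ} :
    k ∈ intBox x A ↔ ∀ j, |x j + k j| ≤ A := by
  simp only [intBox, Fintype.mem_piFinset, Finset.mem_Icc, Int.ceil_le, Int.le_floor, abs_le]
  refine forall_congr' fun j => ?_
  constructor <;> rintro ⟨h1, h2⟩ <;> constructor <;> linarith

theorem card_intBox_le {m : ℕ} (x : Fin m → ℝ) {A : ℝ} (hA : 0 ≤ A) :
    ((intBox x A).card : ℝ) ≤ (2 * A + 1) ^ m := by
  rw [intBox, Fintype.card_piFinset]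
  push_cast
  calc _ ≤ ∏ _j : Fin m, (2 * A + 1) := by
        refine Finset.prod_le_prod (fun _ _ => Nat.cast_nonneg _) fun j _ => ?_
        refine Finset.card_le_add_one_of_int _ (u := -A - x j) (by linarith) fun z hz => ?_
        obtain ⟨h1, h2⟩ := Finset.mem_Icc.mp hz
        have h1 := Int.ceil_le.mp h1
        have h2 := Int.le_floor.mp h2
        constructor <;> linarith
    _ = _ := by simp

open Classical in
theorem exists_matrix_lattice_avoiding {m n : ℕ}
    {γ : Matrix (Fin m ⊕ Fin n) (Fin m ⊕ Fin n) ℤ} (hγ : γ.det ≠ 0) {A r : ℝ} (hA : 1 ≤ A)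
    (hAγ : |(γ.det : ℝ)| ^ n ≤ A ^ m) (hr : 0 < r)
    (hsmall : |(γ.det : ℝ)| * (9 * r) ^ n * (2 * 3 ^ m * A ^ m) < 1) :
    ∃ ζ : Matrix (Fin n) (Fin m) ℝ, (∀ k j, |ζ k j| ≤ 1) ∧
      ∀ (w : Fin m ⊕ Fin n → ℝ) (v : Fin m ⊕ Fin n → ℤ), w ≠ 0 →
        (γ.map (Int.cast : ℤ → ℝ)).mulVec w = (fun i => (v i : ℝ)) →
        (∃ j, A < |w (Sum.inl j)|) ∨ ∃ k, r < |(shear ζ).mulVec w (Sum.inr k)| := by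
  obtain ⟨R, hRcard, hR⟩ := Matrix.exists_finset_representatives hγ
  set I : ℝ := |(γ.det : ℝ)| with hI
  have hI1 : 1 ≤ I := by rw [hI]; exact_mod_cast Int.one_le_abs hγ
  have hγ' : (γ.det : ℝ) ≠ 0 := by exact_mod_cast hγ
  have hRI : (R.card : ℝ) ≤ I := by
    rw [hI, ← Int.cast_abs, ← Int.natCast_natAbs]; exact_mod_cast hRcard
  have hrI : 9 * r * I < 1 := by
    by_contra! h
    have h1 : 1 ≤ (9 * r * I) ^ n := one_le_pow₀ h
    have h2 : (9 * r * I) ^ n ≤ (9 * r) ^ n * A ^ m := by rw [mul_pow]; gcongr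
    have h3 : (1 : ℝ) ≤ 3 ^ m := one_le_pow₀ (by norm_num)
    have h4 : 1 * ((9 * r) ^ n * A ^ m) * 1 ≤ I * ((9 * r) ^ n * A ^ m) * (2 * 3 ^ m) := by
      gcongr; linarith
    nlinarith
  set G := γ.map (Int.cast : ℤ → ℝ) with hG
  have hGdet : IsUnit G.det := by
    have : G.det = γ.det := (Int.cast_det γ).symm
    rw [this]; exact hγ'.isUnit
  have hGinv : ∀ u, G.mulVec (G⁻¹.mulVec u) = u := fun u => by
    rw [Matrix.mulVec_mulVec, Matrix.mul_nonsing_inv _ hGdet, Matrix.one_mulVec]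
  have hGinj : ∀ u u', G.mulVec u = G.mulVec u' → u = u' := fun u u' h => by
    have := congrArg G⁻¹.mulVec h
    simpa [Matrix.mulVec_mulVec, Matrix.nonsing_inv_mul _ hGdet] using this
  set p : (Fin m ⊕ Fin n → ℤ) → Fin m ⊕ Fin n → ℝ :=
    fun ρ => G⁻¹.mulVec fun i => (ρ i : ℝ) with hp
  set x : (Σ _ : Fin m ⊕ Fin n → ℤ, Fin m → ℤ) → Fin m → ℝ :=
    fun i j => p i.1 (Sum.inl j) + i.2 j with hx
  set S := (R.sigma fun ρ => intBox (fun j => p ρ (Sum.inl j)) A).filter fun i => x i ≠ 0 with hS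
  have hGmap : ∀ u : Fin m ⊕ Fin n → ℤ, G.mulVec (fun i => (u i : ℝ)) =
      fun i => ((γ.mulVec u i : ℤ) : ℝ) := fun u => by
    ext i; simp [hG, Matrix.mulVec, dotProduct]
  have hcoord : ∀ ρ k j, p ρ (Sum.inl j) + (k : ℤ) ≠ 0 →
      1 / I ≤ |p ρ (Sum.inl j) + (k : ℤ)| := by
    intro ρ k j h0
    obtain ⟨z, hz⟩ := Matrix.exists_int_eq_det_mul γ (hGinv fun i => (ρ i : ℝ)) (Sum.inl j)
    have h1 : (γ.det : ℝ) * (p ρ (Sum.inl j) + k) = ((z + γ.det * k : ℤ) : ℝ) := by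
      rw [Int.cast_add, Int.cast_mul, ← hz, mul_add]
    have h2 : z + γ.det * k ≠ 0 := fun h => by
      rw [h, Int.cast_zero] at h1
      exact (mul_ne_zero hγ' h0) h1
    have h3 : (1 : ℝ) ≤ |((z + γ.det * k : ℤ) : ℝ)| := by exact_mod_cast Int.one_le_abs h2
    rw [← h1, abs_mul] at h3
    rw [div_le_iff₀ (by linarith)]
    linarith
  have hsum : ∑ i ∈ S, (9 * r * max 1 (1 / ‖x i‖)) ^ n < 1 := by
    set f : (Σ _ : Fin m ⊕ Fin n → ℤ, Fin m → ℤ) → ℝ := fun i =>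
      (9 * r) ^ n * (1 + if i.2 ∈ intBox (fun j => p i.1 (Sum.inl j)) 1 then I ^ n else 0) with hf
    have h1 : ∀ i ∈ S, (9 * r * max 1 (1 / ‖x i‖)) ^ n ≤ f i := by
      intro i hi
      have hxi := (Finset.mem_filter.mp hi).2
      obtain ⟨j, hj⟩ := Function.ne_iff.mp hxi
      have hnorm : 1 / I ≤ ‖x i‖ := (hcoord i.1 (i.2 j) j hj).trans (norm_le_pi_norm (x i) j)
      have hpos : 0 < ‖x i‖ := norm_pos_iff.mpr hxi
      rw [mul_pow]
      refine mul_le_mul_of_nonneg_left ?_ (by positivity)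
      by_cases h : ‖x i‖ ≤ 1
      · rw [if_pos (mem_intBox.mpr fun j => (norm_le_pi_norm (x i) j).trans h)]
        have : max 1 (1 / ‖x i‖) ≤ I :=
          max_le hI1 ((one_div_le hpos (by linarith)).mpr hnorm)
        calc _ ≤ I ^ n := by gcongr
          _ ≤ _ := by linarith
      · have : max 1 (1 / ‖x i‖) = 1 := max_eq_left ((div_le_one hpos).mpr (by linarith))
        rw [this, one_pow]
        split_ifs <;> simp; positivity
    have hf0 : ∀ i, 0 ≤ f i := fun i => by
      rw [hf]; simp only; split_ifs <;> positivity
    have h2 : ∀ ρ ∈ R, ∑ k ∈ intBox (fun j => p ρ (Sum.inl j)) A, f ⟨ρ, k⟩ ≤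
        (9 * r) ^ n * (2 * 3 ^ m * A ^ m) := by
      intro ρ _
      simp only [hf]
      rw [← Finset.mul_sum, Finset.sum_add_distrib, Finset.sum_ite, Finset.sum_const_zero,
        add_zero, Finset.sum_const, Finset.sum_const, nsmul_eq_mul, nsmul_eq_mul, mul_one]
      have h3 : ((intBox (fun j => p ρ (Sum.inl j)) A).card : ℝ) ≤ 3 ^ m * A ^ m := by
        refine (card_intBox_le _ (by linarith)).trans ?_
        rw [← mul_pow]
        gcongr; linarith
      have h4 : (((intBox (fun j => p ρ (Sum.inl j)) A).filter fun k =>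
          k ∈ intBox (fun j => p ρ (Sum.inl j)) 1).card : ℝ) ≤ 3 ^ m := by
        refine le_trans ?_ ((card_intBox_le (fun j => p ρ (Sum.inl j)) zero_le_one).trans_eq
          (by norm_num))
        gcongr
        exact fun k hk => (Finset.mem_filter.mp hk).2
      calc _ ≤ (9 * r) ^ n * (3 ^ m * A ^ m + 3 ^ m * A ^ m) := by gcongr
        _ = _ := by ring
    calc _ ≤ ∑ i ∈ S, f i := Finset.sum_le_sum h1
      _ ≤ ∑ i ∈ R.sigma fun ρ => intBox (fun j => p ρ (Sum.inl j)) A, f i :=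
          Finset.sum_le_sum_of_subset_of_nonneg (Finset.filter_subset _ _) fun i _ _ => hf0 i
      _ = ∑ ρ ∈ R, ∑ k ∈ intBox (fun j => p ρ (Sum.inl j)) A, f ⟨ρ, k⟩ := Finset.sum_sigma _ _ _
      _ ≤ ∑ _ρ ∈ R, (9 * r) ^ n * (2 * 3 ^ m * A ^ m) := Finset.sum_le_sum h2
      _ = R.card * ((9 * r) ^ n * (2 * 3 ^ m * A ^ m)) := by rw [Finset.sum_const, nsmul_eq_mul]
      _ ≤ I * ((9 * r) ^ n * (2 * 3 ^ m * A ^ m)) := by gcongr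
      _ < 1 := by rw [← mul_assoc]; exact hsmall
  obtain ⟨ζ, hζ1, hζ⟩ := exists_matrix_avoiding S x (fun i k => p i.1 (Sum.inr k)) hr
    (by nlinarith) (fun i hi => (Finset.mem_filter.mp hi).2) hsum
  refine ⟨ζ, hζ1, fun w v hw hwv => ?_⟩
  obtain ⟨ρ, hρ, u, hu⟩ := hR v
  have hwρ : ∀ i, w i = p ρ i + u i := by
    have : w = p ρ + fun i => (u i : ℝ) := by
      refine hGinj _ _ ?_
      rw [hwv, Matrix.mulVec_add, hp, hGinv, hGmap, hu]
      ext i; simp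
    exact fun i => congrFun this i
  have hshear : ∀ k, (shear ζ).mulVec w (Sum.inr k) =
      ∑ j, ζ k j * w (Sum.inl j) + p ρ (Sum.inr k) + u (Sum.inr k) := fun k => by
    rw [shear_mulVec_inr, hwρ]; ring
  by_cases hxA : ∀ j, |w (Sum.inl j)| ≤ A
  · right
    by_cases hx0 : ∀ j, w (Sum.inl j) = 0
    · obtain ⟨i, hi⟩ := Function.ne_iff.mp hw
      rcases i with j | k
      · exact absurd (hx0 j) hi
      · refine ⟨k, ?_⟩
        rw [shear_mulVec_inr]
        simp only [hx0, mul_zero, Finset.sum_const_zero, add_zero]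
        obtain ⟨z, hz⟩ := Matrix.exists_int_eq_det_mul γ hwv (Sum.inr k)
        have h1 : z ≠ 0 := fun h => by
          rw [h, Int.cast_zero] at hz
          exact mul_ne_zero hγ' hi hz
        have h2 : (1 : ℝ) ≤ |(z : ℝ)| := by exact_mod_cast Int.one_le_abs h1
        rw [← hz, abs_mul] at h2
        by_contra! h3
        nlinarith
    · push Not at hx0
      obtain ⟨j, hj⟩ := hx0
      have hmem : (⟨ρ, fun j => u (Sum.inl j)⟩ : Σ _ : Fin m ⊕ Fin n → ℤ, Fin m → ℤ) ∈ S := by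
        refine Finset.mem_filter.mpr ⟨Finset.mem_sigma.mpr ⟨hρ, mem_intBox.mpr fun j => ?_⟩, ?_⟩
        · have := hxA j
          rwa [hwρ] at this
        · refine Function.ne_iff.mpr ⟨j, ?_⟩
          have := hj
          rwa [hwρ] at this
      obtain ⟨k, hk⟩ := hζ _ hmem
      refine ⟨k, ?_⟩
      have := hk (u (Sum.inr k))
      rw [hshear]
      simpa only [hwρ] using this
  · left
    push Not at hxA
    exact hxA

end latticeAvoidance

theorem Matrix.exists_map_mulVec_eq {κ : Type*} [Fintype κ] [DecidableEq κ]
    {γ : Matrix κ κ ℤ} (hγ : γ.det ≠ 0) (v : κ → ℤ) :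
    ∃ w : κ → ℝ, (v ≠ 0 → w ≠ 0) ∧
      (γ.map (Int.cast : ℤ → ℝ)).mulVec w = fun i => (v i : ℝ) := by
  have hG : IsUnit (γ.map (Int.cast : ℤ → ℝ)).det := by
    have : (γ.map (Int.cast : ℤ → ℝ)).det = γ.det := (Int.cast_det γ).symm
    rw [this, isUnit_iff_ne_zero]; exact_mod_cast hγ
  have h1 : (γ.map (Int.cast : ℤ → ℝ)).mulVec
      ((γ.map (Int.cast : ℤ → ℝ))⁻¹.mulVec fun i => (v i : ℝ)) = fun i => (v i : ℝ) := by
    rw [Matrix.mulVec_mulVec, Matrix.mul_nonsing_inv _ hG, Matrix.one_mulVec]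
  refine ⟨_, fun hv hw => hv ?_, h1⟩
  rw [hw, Matrix.mulVec_zero] at h1
  ext i
  have := congrFun h1 i
  simpa using this.symm

theorem exists_recovery {m n : ℕ} (hm : 1 ≤ m) (hn : 1 ≤ n) :
    ∃ c₀ : ℝ, 0 < c₀ ∧ ∀ c : ℝ, 0 < c → ∃ K : ℝ, 0 < K ∧
      ∀ (ξ : Matrix (Fin n) (Fin m) ℝ) (t : ℝ), FlowSeparated c ξ t →
        ∃ ξ' : Matrix (Fin n) (Fin m) ℝ,
          (∀ k j, |ξ' k j - ξ k j| ≤ 4 * Real.exp (-((1 / m + 1 / n) * t))) ∧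
          FlowSeparated c₀ ξ' (t + K) := by
  have hm0 : (0 : ℝ) < m := by exact_mod_cast hm
  have hn0 : (0 : ℝ) < n := by exact_mod_cast hn
  set κ₀ : ℝ := 1 / (4 * 9 ^ n * 3 ^ m) with hκ₀
  have hκ₀0 : 0 < κ₀ := by positivity
  set c₁ : ℝ := min 1 (κ₀ / ((m + n).factorial * 2 ^ (m + n))) with hc₁
  have hc₁0 : 0 < c₁ := by positivity
  refine ⟨c₁ / 2, by positivity, fun c hc => ?_⟩
  obtain ⟨N, hN1, hglue⟩ := exists_gluing (m := m) (n := n) hm hn hc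
    (B := 1) (by simp)
  have hN0 : 0 < N := by linarith
  set J : ℝ := (m + n).factorial * (2 * N) ^ (m + n) with hJ
  have hJ2 : 2 ≤ J := by
    have h1 : (1 : ℝ) ≤ (m + n).factorial := by exact_mod_cast Nat.succ_le_of_lt (Nat.factorial_pos _)
    have h2 : 2 * N ≤ (2 * N) ^ (m + n) := le_self_pow₀ (by linarith) (by omega)
    nlinarith
  set A : ℝ := J ^ n with hA
  have hA2 : 2 ≤ A := hJ2.trans (le_self_pow₀ (by linarith) (by omega))
  have hNA : 1 < N * A := by nlinarith
  refine ⟨m * Real.log (N * A), mul_pos hm0 (Real.log_pos hNA), fun ξ t hξ => ?_⟩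
  set K := m * Real.log (N * A) with hK
  have hKm : Real.exp (K / m) = N * A := by
    rw [hK, mul_div_cancel_left₀ _ hm0.ne', Real.exp_log (by linarith)]
  have hK0 : 0 ≤ K := (mul_pos hm0 (Real.log_pos hNA)).le
  have hKn : Real.exp (K / n) ^ n = (N * A) ^ m := by
    rw [← hKm, ← Real.exp_nat_mul, ← Real.exp_nat_mul]
    congr 1; field_simp
  obtain ⟨γ, hγ, hγJ, hγglue⟩ := hglue ξ t hξ
  rw [Matrix.det_one, abs_one, mul_one] at hγJ
  set I : ℝ := |(γ.det : ℝ)| with hI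
  have hI1 : 1 ≤ I := by rw [hI]; exact_mod_cast Int.one_le_abs hγ
  set r : ℝ := (κ₀ / (I * A ^ m)) ^ (1 / (n : ℝ)) with hr
  have hbase : 0 < κ₀ / (I * A ^ m) := by positivity
  have hr0 : 0 < r := Real.rpow_pos_of_pos hbase _
  have hrn : r ^ n = κ₀ / (I * A ^ m) := by
    rw [hr, one_div, Real.rpow_inv_natCast_pow hbase.le (by omega)]
  obtain ⟨ζ, hζ1, hζ⟩ := exists_matrix_lattice_avoiding hγ (A := A) (r := r) (by linarith)
    (by
      rw [← hI]
      calc I ^ n ≤ A := by rw [hA]; gcongr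
        _ ≤ A ^ m := le_self_pow₀ (by linarith) (by omega)) hr0
    (by
      rw [← hI, mul_pow, hrn, hκ₀]
      have : I * (9 ^ n * (1 / (4 * 9 ^ n * 3 ^ m) / (I * A ^ m))) * (2 * 3 ^ m * A ^ m) = 1 / 2 := by
        field_simp; norm_num
      rw [this]; norm_num)
  obtain ⟨ξ', hξ', hflow⟩ := hγglue ζ hζ1
  refine ⟨ξ', hξ', fun v hv => ?_⟩
  obtain ⟨w, hw0, hw⟩ := Matrix.exists_map_mulVec_eq hγ v
  have h1 := (hflow K hK0 w).1
  rw [hw, Matrix.one_mulVec] at h1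
  refine le_trans ?_ h1
  have h2 : c₁ ≤ N * flowNorm ζ K w := by
    rcases hζ w v (hw0 hv) hw with ⟨j, hj⟩ | ⟨k, hk⟩
    · have h3 := flowNorm_inl_le (ξ := ζ) (t := K) (w := w) j
      rw [Real.exp_neg, hKm] at h3
      calc c₁ ≤ 1 := min_le_left _ _
        _ = N * ((N * A)⁻¹ * A) := by field_simp
        _ ≤ N * ((N * A)⁻¹ * |w (Sum.inl j)|) := by gcongr
        _ ≤ _ := by gcongr
    · have h3 := le_flowNorm (ξ := ζ) (t := K) (w := w) (Sum.inr k)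
      have h4 : flowScale m n K (Sum.inr k) = Real.exp (K / n) := rfl
      rw [h4] at h3
      have h5 : c₁ ≤ N * (Real.exp (K / n) * r) := by
        refine le_of_pow_le_pow_left₀ (by omega : n ≠ 0) (by positivity) ?_
        rw [mul_pow, mul_pow, hKn, hrn]
        calc c₁ ^ n ≤ c₁ := pow_le_of_le_one hc₁0.le (min_le_left _ _) (by omega)
          _ ≤ κ₀ / ((m + n).factorial * 2 ^ (m + n)) := min_le_right _ _
          _ = κ₀ * N ^ (m + n) / J := by rw [hJ, mul_pow]; field_simp
          _ ≤ κ₀ * N ^ (m + n) / I := by gcongr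
          _ = _ := by rw [mul_pow, pow_add]; field_simp
      calc c₁ ≤ _ := h5
        _ ≤ N * (Real.exp (K / n) * |(shear ζ).mulVec w (Sum.inr k)|) := by gcongr
        _ ≤ _ := by gcongr
  linarith

/-- The tent function on `[0, T]` with slopes `1 / (n D)` and `-1 / (m D)`, extended by zero. -/
noncomputable def tent (m n D : ℕ) (T s : ℝ) : ℝ :=
  max 0 (min (s / n) ((T - s) / m)) / D

section construction

variable {m n D : ℕ}

theorem FlowSeparated.mono {c c' : ℝ} (h : c' ≤ c) {ξ : Matrix (Fin n) (Fin m) ℝ} {t : ℝ}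
    (hξ : FlowSeparated c ξ t) : FlowSeparated c' ξ t :=
  fun v hv => h.trans (hξ v hv)

theorem flowSeparated_zero : FlowSeparated 1 (0 : Matrix (Fin n) (Fin m) ℝ) 0 := by
  intro v hv
  obtain ⟨i, hi⟩ := Function.ne_iff.mp hv
  have h1 : (1 : ℝ) ≤ |(v i : ℝ)| := by exact_mod_cast Int.one_le_abs hi
  refine h1.trans ?_
  rcases i with j | k
  · simpa using flowNorm_inl_le (ξ := (0 : Matrix (Fin n) (Fin m) ℝ)) (t := 0)
      (w := fun i => (v i : ℝ)) j
  · simpa using flowNorm_inr_le (ξ := (0 : Matrix (Fin n) (Fin m) ℝ)) (t := 0)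
      (w := fun i => (v i : ℝ)) k

theorem tent_eq {T s : ℝ} (h0 : 0 ≤ s) (hT : s ≤ T) :
    tent m n D T s = min (s / n) ((T - s) / m) / D := by
  rw [tent, max_eq_right]
  exact le_min (by positivity) (div_nonneg (by linarith) (Nat.cast_nonneg _))

theorem tent_of_le {T s : ℝ} (hT : T ≤ s) : tent m n D T s = 0 := by
  rw [tent, max_eq_left, zero_div]
  exact (min_le_right _ _).trans (div_nonpos_of_nonpos_of_nonneg (by linarith) (Nat.cast_nonneg _))

theorem exists_excursion_glued (hm : 1 ≤ m) (hn : 2 ≤ n) (hD : D + 1 = m + n) {c₀ : ℝ}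
    (hc₀ : 0 < c₀) :
    ∃ c > 0, ∃ C > 0, ∀ (ξ : Matrix (Fin n) (Fin m) ℝ) (t : ℝ), FlowSeparated c₀ ξ t →
      ∀ T : ℝ, 0 ≤ T → ∃ ξ' : Matrix (Fin n) (Fin m) ℝ,
        (∀ k j, |ξ' k j - ξ k j| ≤ 4 * Real.exp (-((1 / m + 1 / n) * t))) ∧
        ∀ s : ℝ, 0 ≤ s → s ≤ T →
          FlowSeparated (c * Real.exp (-tent m n D T s)) ξ' (t + s) ∧
          ∃ v : Fin m ⊕ Fin n → ℤ, v ≠ 0 ∧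
            flowNorm ξ' (t + s) (fun i => (v i : ℝ)) ≤ C * Real.exp (-tent m n D T s) := by
  obtain ⟨B, hB, C, hC, hexc⟩ := exists_excursion hm hn hD
  obtain ⟨N, hN1, hglue⟩ := exists_gluing hm (by omega) hc₀ hB
  have hN0 : 0 < N := by linarith
  have hB0 : 0 < |B.det| := abs_pos.mpr hB
  set J : ℝ := (m + n).factorial * (2 * N) ^ (m + n) * |B.det| with hJ
  have hJ0 : 0 < J := by positivity
  refine ⟨1 / (4 * J), by positivity, 2 * N * C, by positivity, fun ξ t hξ T hT => ?_⟩
  obtain ⟨γ, hγ, hγJ, hγglue⟩ := hglue ξ t hξ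
  obtain ⟨ζ, hζ1, hζ⟩ := hexc T hT
  obtain ⟨ξ', hξ', hflow⟩ := hγglue ζ hζ1
  have hγ' : (γ.det : ℝ) ≠ 0 := by exact_mod_cast hγ
  refine ⟨ξ', hξ', fun s hs hsT => ?_⟩
  rw [tent_eq hs hsT]
  obtain ⟨hlow, w₀, hw₀, hup⟩ := hζ s hs hsT
  set E := Real.exp (-(min (s / n) ((T - s) / m) / D)) with hE
  have hE0 : 0 < E := Real.exp_pos _
  refine ⟨fun v hv => ?_, γ.mulVec w₀, fun h => hw₀ ?_, ?_⟩
  · obtain ⟨w, hw0, hw⟩ := Matrix.exists_map_mulVec_eq hγ v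
    choose u hu using Matrix.exists_int_eq_det_mul γ hw
    have hu' : (fun i => (u i : ℝ)) = (γ.det : ℝ) • w := by
      ext i; rw [← hu, Pi.smul_apply, smul_eq_mul]
    have hu0 : u ≠ 0 := fun h => by
      rw [h] at hu'
      have h1 : (γ.det : ℝ) • w = 0 := by rw [← hu']; ext i; simp
      exact (smul_ne_zero hγ' (hw0 hv)) h1
    have h1 := hlow u hu0
    rw [hu', Matrix.mulVec_smul, flowNorm_smul] at h1
    have h2 := (hflow s hs w).1
    rw [hw] at h2
    refine le_trans ?_ h2
    have h3 : flowNorm ζ s (B.mulVec w) * |(γ.det : ℝ)| ≤ flowNorm ζ s (B.mulVec w) * J :=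
      mul_le_mul_of_nonneg_left hγJ flowNorm_nonneg
    have h4 : 1 / 2 * E / J ≤ flowNorm ζ s (B.mulVec w) := by
      rw [div_le_iff₀ hJ0]; linarith
    calc 1 / (4 * J) * E = 1 / 2 * (1 / 2 * E / J) := by field_simp; norm_num
      _ ≤ N / 2 * flowNorm ζ s (B.mulVec w) := by gcongr
  · exact Matrix.mulVec_injective_of_det_ne_zero hγ (h.trans (Matrix.mulVec_zero _).symm)
  · have h1 := (hflow s hs fun i => (w₀ i : ℝ)).2
    have h2 : (γ.map (Int.cast : ℤ → ℝ)).mulVec (fun i => (w₀ i : ℝ)) =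
        fun i => ((γ.mulVec w₀ i : ℤ) : ℝ) := by
      ext i; simp [Matrix.mulVec, dotProduct]
    rw [h2] at h1
    calc _ ≤ _ := h1
      _ ≤ 2 * N * (C * E) := by gcongr
      _ = _ := by ring

theorem exists_stage (hm : 1 ≤ m) (hn : 2 ≤ n) (hD : D + 1 = m + n) :
    ∃ c₀ > 0, ∃ c > 0, ∃ C > 0, ∃ K > 0, c₀ ≤ 1 ∧
      ∀ (ξ : Matrix (Fin n) (Fin m) ℝ) (t : ℝ), FlowSeparated c₀ ξ t →
        ∀ T : ℝ, 0 ≤ T → ∃ ξ' : Matrix (Fin n) (Fin m) ℝ,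
          (∀ k j, |ξ' k j - ξ k j| ≤ 8 * Real.exp (-((1 / m + 1 / n) * t))) ∧
          FlowSeparated c₀ ξ' (t + T + K) ∧
          ∀ s : ℝ, 0 ≤ s → s ≤ T + K →
            FlowSeparated (c * Real.exp (-tent m n D T s)) ξ' (t + s) ∧
            ∃ v : Fin m ⊕ Fin n → ℤ, v ≠ 0 ∧
              flowNorm ξ' (t + s) (fun i => (v i : ℝ)) ≤ C * Real.exp (-tent m n D T s) := by
  obtain ⟨c₀', hc₀', hrec⟩ := exists_recovery (n := n) hm (by omega)
  obtain ⟨c₀, hc₀⟩ : ∃ c₀, c₀ = min c₀' 1 := ⟨_, rfl⟩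
  have hc₀0 : 0 < c₀ := by rw [hc₀]; exact lt_min hc₀' one_pos
  obtain ⟨c, hc, C, hC, hexc⟩ := exists_excursion_glued hm hn hD hc₀0
  obtain ⟨K, hK, hrecK⟩ := hrec c hc
  have hm0 : (0 : ℝ) < m := by exact_mod_cast hm
  refine ⟨c₀, hc₀0, min (c / (1 + m * 4)) (c₀ * Real.exp (-(K / n))), by positivity,
    max ((1 + m * 4) * C) 2, by positivity, K, hK, hc₀ ▸ min_le_right _ _, fun ξ t hξ T hT => ?_⟩
  obtain ⟨ξ₁, hξ₁, h₁⟩ := hexc ξ t hξ T hT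
  obtain ⟨ξ₂, hξ₂, h₂⟩ := hrecK ξ₁ (t + T) (by
    have := (h₁ T hT le_rfl).1
    rwa [tent_of_le le_rfl, neg_zero, Real.exp_zero, mul_one] at this)
  have h₂' : FlowSeparated c₀ ξ₂ (t + T + K) := h₂.mono (hc₀ ▸ min_le_left _ _)
  refine ⟨ξ₂, fun k j => ?_, h₂', fun s hs hsT => ?_⟩
  · have e1 : Real.exp (-((1 / m + 1 / n) * (t + T))) ≤ Real.exp (-((1 / m + 1 / n) * t)) := by
      gcongr
      linarith
    have := abs_sub_le (ξ₂ k j) (ξ₁ k j) (ξ k j)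
    linarith [hξ₁ k j, hξ₂ k j]
  · rcases le_total s T with hsT' | hsT'
    · obtain ⟨hl, v₀, hv₀, hu⟩ := h₁ s hs hsT'
      refine ⟨fun v hv => ?_, v₀, hv₀, ?_⟩
      · have h3 := flowNorm_le_of_sub_le (ξ := ξ₂) (ξ' := ξ₁) (w := fun i => (v i : ℝ))
          (by norm_num : (0 : ℝ) ≤ 4) (by linarith : t + s ≤ t + T)
          (fun k j => by rw [abs_sub_comm]; exact hξ₂ k j)
        have h4 := (hl v hv).trans h3
        calc _ ≤ c / (1 + m * 4) * Real.exp (-tent m n D T s) := by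
              gcongr; exact min_le_left _ _
          _ = c * Real.exp (-tent m n D T s) / (1 + m * 4) := by ring
          _ ≤ _ := by rw [div_le_iff₀ (by positivity)]; linarith
      · have h3 := flowNorm_le_of_sub_le (ξ := ξ₁) (ξ' := ξ₂) (w := fun i => (v₀ i : ℝ))
          (by norm_num : (0 : ℝ) ≤ 4) (by linarith : t + s ≤ t + T) hξ₂
        calc _ ≤ (1 + m * 4) * (C * Real.exp (-tent m n D T s)) := h3.trans (by gcongr)
          _ = (1 + m * 4) * C * Real.exp (-tent m n D T s) := by ring
          _ ≤ _ := by gcongr; exact le_max_left _ _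
    · rw [tent_of_le hsT', neg_zero, Real.exp_zero, mul_one, mul_one]
      refine ⟨fun v hv => ?_, ?_⟩
      · have h3 := flowNorm_add_le (ξ := ξ₂) (t := t + s) (s := T + K - s)
          (w := fun i => (v i : ℝ)) (by linarith)
        have e1 : t + s + (T + K - s) = t + T + K := by ring
        rw [e1] at h3
        have h4 : Real.exp ((T + K - s) / n) ≤ Real.exp (K / n) := by gcongr; linarith
        have h5 := (h₂' v hv).trans (h3.trans (mul_le_mul_of_nonneg_right h4 flowNorm_nonneg))
        refine (min_le_right _ _).trans ?_
        rw [Real.exp_neg, ← div_eq_mul_inv, div_le_iff₀ (Real.exp_pos _)]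
        linarith
      · obtain ⟨v, hv, h3⟩ := exists_flowNorm_le_two hm (by omega) ξ₂ (t + s)
        exact ⟨v, hv, h3.trans (le_max_right _ _)⟩

theorem exists_matrix_following_tents (hm : 1 ≤ m) (hn : 2 ≤ n) (hD : D + 1 = m + n) :
    ∃ K > 0, ∃ c > 0, ∃ C > 0, ∀ t T : ℕ → ℝ, t 0 = 0 → (∀ k, 0 ≤ T k) →
      (∀ k, t (k + 1) = t k + T k + K) →
      ∃ ξ : Matrix (Fin n) (Fin m) ℝ, ∀ (k : ℕ) (s : ℝ), 0 ≤ s → s ≤ T k + K →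
        FlowSeparated (c * Real.exp (-tent m n D (T k) s)) ξ (t k + s) ∧
        ∃ v : Fin m ⊕ Fin n → ℤ, v ≠ 0 ∧
          flowNorm ξ (t k + s) (fun i => (v i : ℝ)) ≤ C * Real.exp (-tent m n D (T k) s) := by
  obtain ⟨c₀, hc₀, c, hc, C, hC, K, hK, hc₀1, hstage⟩ := exists_stage hm hn hD
  have hm0 : (0 : ℝ) < m := by exact_mod_cast hm
  have hn0 : (0 : ℝ) < n := by exact_mod_cast (by omega : 0 < n)
  obtain ⟨τ, hτ⟩ : ∃ τ : ℝ, τ = 1 / m + 1 / n := ⟨_, rfl⟩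
  have hτ0 : 0 < τ := by rw [hτ]; positivity
  simp only [← hτ] at hstage
  set q := Real.exp (-(τ * K)) with hq
  have hq1 : q < 1 := by
    rw [hq, Real.exp_lt_one_iff]; nlinarith
  set C' := 8 / (1 - q) with hC'
  have hC'0 : 0 < C' := div_pos (by norm_num) (by linarith)
  refine ⟨K, hK, c / (1 + m * C'), by positivity, (1 + m * C') * C, by positivity,
    fun t T ht0 hT ht => ?_⟩
  have htmono : ∀ k i, t k + i * K ≤ t (k + i) := by
    intro k i
    induction i with
    | zero => simp
    | succ i ih =>
      rw [← add_assoc, ht]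
      push_cast
      linarith [hT (k + i)]
  choose! F hF using hstage
  set Ξ : ℕ → Matrix (Fin n) (Fin m) ℝ := fun k => Nat.rec 0 (fun k ξ => F ξ (t k) (T k)) k with hΞ
  have hΞs : ∀ k, Ξ (k + 1) = F (Ξ k) (t k) (T k) := fun k => rfl
  have hsep : ∀ k, FlowSeparated c₀ (Ξ k) (t k) := by
    intro k
    induction k with
    | zero => rw [ht0]; exact flowSeparated_zero.mono hc₀1
    | succ k ih => rw [hΞs, ht]; exact (hF _ _ ih _ (hT k)).2.1
  have hstep : ∀ k a b, |Ξ (k + 1) a b - Ξ k a b| ≤ 8 * Real.exp (-(τ * t k)) := by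
    intro k
    rw [hΞs]
    exact (hF _ _ (hsep k) _ (hT k)).1
  have hgeom : ∀ k a b i, dist (Ξ (k + i) a b) (Ξ (k + (i + 1)) a b) ≤
      8 * Real.exp (-(τ * t k)) * q ^ i := by
    intro k a b i
    rw [dist_comm, Real.dist_eq, ← add_assoc]
    refine (hstep (k + i) a b).trans ?_
    rw [mul_assoc, hq, ← Real.exp_nat_mul, ← Real.exp_add]
    gcongr
    nlinarith [htmono k i]
  have hlim : ∀ a b, ∃ l, Filter.Tendsto (fun k => Ξ k a b) Filter.atTop (nhds l) := by
    intro a b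
    refine cauchySeq_tendsto_of_complete (cauchySeq_of_le_geometric q (8 * Real.exp (-(τ * t 0))) hq1 fun i => ?_)
    simpa only [zero_add] using hgeom 0 a b i
  choose ξ hξ using hlim
  have hdist : ∀ k a b, |Ξ k a b - ξ a b| ≤ C' * Real.exp (-(τ * t k)) := by
    intro k a b
    have h1 := dist_le_of_le_geometric_of_tendsto₀ q _ hq1 (hgeom k a b)
      ((Filter.tendsto_add_atTop_iff_nat k).mpr (hξ a b) |>.congr fun i => by rw [add_comm])
    rw [Real.dist_eq, add_zero] at h1
    refine h1.trans_eq ?_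
    rw [hC']; ring
  refine ⟨ξ, fun k s hs hsT => ?_⟩
  obtain ⟨-, -, h1⟩ := hF _ _ (hsep k) _ (hT k)
  rw [← hΞs] at h1
  obtain ⟨hl, v₀, hv₀, hu⟩ := h1 s hs hsT
  have hle : t k + s ≤ t (k + 1) := by rw [ht]; linarith
  refine ⟨fun v hv => ?_, v₀, hv₀, ?_⟩
  · have h2 := flowNorm_le_of_sub_le (ξ := ξ) (ξ' := Ξ (k + 1)) (w := fun i => (v i : ℝ))
      hC'0.le hle (fun a b => by rw [← hτ]; exact hdist (k + 1) a b)
    have h3 := (hl v hv).trans h2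
    rw [div_mul_eq_mul_div, div_le_iff₀ (by positivity)]
    linarith
  · have h2 := flowNorm_le_of_sub_le (ξ := Ξ (k + 1)) (ξ' := ξ) (w := fun i => (v₀ i : ℝ))
      hC'0.le hle (fun a b => by rw [← hτ, abs_sub_comm]; exact hdist (k + 1) a b)
    refine h2.trans ?_
    rw [mul_assoc]
    gcongr

end construction

section profile

variable {m n D : ℕ}

theorem tent_nonneg {T s : ℝ} : 0 ≤ tent m n D T s :=
  div_nonneg (le_max_left _ _) (Nat.cast_nonneg _)

theorem tent_zero {T : ℝ} : tent m n D T 0 = 0 := by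
  rw [tent, max_eq_left, zero_div]
  simp

theorem tent_add_le {T s σ : ℝ} (hσ : 0 ≤ σ) :
    tent m n D T (s + σ) ≤ tent m n D T s + σ / (n * D) := by
  rw [tent, tent, ← div_div, ← add_div]
  gcongr
  have h0 : 0 ≤ σ / n := by positivity
  refine max_le (add_nonneg (le_max_left _ _) h0) ?_
  refine le_trans ?_ (add_le_add_left (le_max_right _ _) _)
  rw [← min_add_add_right]
  refine min_le_min (add_div _ _ _).le ?_
  have h1 : (T - (s + σ)) / m ≤ (T - s) / m := by gcongr; linarith
  linarith

theorem tent_le_mul {e a T s : ℝ} (hm : 1 ≤ m) (hn : 1 ≤ n) (he : 0 ≤ e) (hne : n * e ≤ 1)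
    (ha : 0 ≤ a) (hT : T * (1 - n * e) = (m + n) * e * a) (hs : 0 ≤ s) :
    tent m n D T s ≤ e / D * (a + s) := by
  have hm0 : (0 : ℝ) < m := by exact_mod_cast hm
  have hn0 : (0 : ℝ) < n := by exact_mod_cast hn
  rw [tent, div_mul_eq_mul_div]
  gcongr
  refine max_le (by positivity) ?_
  set M := min (s / n) ((T - s) / m) with hM
  have h1 : n * M ≤ s := by
    have := min_le_left (s / n) ((T - s) / m)
    rwa [← hM, le_div_iff₀ hn0, mul_comm] at this
  have h2 : m * M ≤ T - s := by
    have := min_le_right (s / n) ((T - s) / m)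
    rwa [← hM, le_div_iff₀ hm0, mul_comm] at this
  have h3 : (m * e + 1) * (n * M) ≤ (m * e + 1) * s := by gcongr
  have h4 : (1 - n * e) * (m * M) ≤ (1 - n * e) * (T - s) := by gcongr
  have h5 : (m + n : ℝ) * M ≤ (m + n) * (e * (a + s)) := by linarith
  exact le_of_mul_le_mul_left h5 (by positivity)

theorem tent_peak {T : ℝ} (hm : 1 ≤ m) (hn : 1 ≤ n) (hT : 0 ≤ T) :
    tent m n D T (n * T / (m + n)) = T / (m + n) / D := by
  have hm0 : (0 : ℝ) < m := by exact_mod_cast hm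
  have hn0 : (0 : ℝ) < n := by exact_mod_cast hn
  have h1 : n * T / (m + n) / n = T / (m + n) := by field_simp
  have h2 : (T - n * T / (m + n)) / m = T / (m + n) := by field_simp; ring
  rw [tent, h1, h2, min_self, max_eq_right (by positivity)]

theorem exists_slopes {η e : ℝ} (hη : 0 ≤ η) (he : 0 < e) (hηe : η ≤ e) :
    ∃ f : ℕ → ℝ, (∀ k, 0 < f k ∧ f k < e) ∧ Filter.Tendsto f Filter.atTop (nhds η) ∧
      Filter.Tendsto (fun k => f k * k) Filter.atTop Filter.atTop := by
  set a : ℕ → ℝ := fun k => 1 / √(k + 1 : ℝ) with ha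
  have ha0 : ∀ k, 0 < a k := fun k => by positivity
  have ha1 : ∀ k, a k ≤ 1 := fun k => by
    rw [ha, div_le_one (by positivity), Real.one_le_sqrt]
    have : (0 : ℝ) ≤ k := Nat.cast_nonneg k
    linarith
  have hs : Filter.Tendsto (fun k : ℕ => √(k + 1 : ℝ)) Filter.atTop Filter.atTop :=
    Real.tendsto_sqrt_atTop.comp
      (Filter.tendsto_atTop_add_const_right _ _ tendsto_natCast_atTop_atTop)
  have hlim : Filter.Tendsto a Filter.atTop (nhds 0) := by
    simp only [ha, one_div]
    exact hs.inv_tendsto_atTop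
  refine ⟨fun k => (1 - a k) * η + a k * (e / 2), fun k => ⟨?_, ?_⟩, ?_, ?_⟩
  · have h1 : 0 ≤ (1 - a k) * η := mul_nonneg (by linarith [ha1 k]) hη
    have h2 : 0 < a k * (e / 2) := mul_pos (ha0 k) (by linarith)
    linarith
  · have h1 : (1 - a k) * η ≤ (1 - a k) * e := by gcongr; linarith [ha1 k]
    have h2 : 0 < a k * (e / 2) := mul_pos (ha0 k) (by linarith)
    linarith
  · simpa using ((hlim.const_sub 1).mul_const η).add (hlim.mul_const (e / 2))
  · refine Filter.tendsto_atTop_mono' _ ?_ (hs.const_mul_atTop (by positivity : 0 < e / 4))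
    filter_upwards [Filter.eventually_ge_atTop 1] with k hk
    have hk1 : (1 : ℝ) ≤ k := by exact_mod_cast hk
    have h1 : 0 ≤ (1 - a k) * η * k := mul_nonneg (mul_nonneg (by linarith [ha1 k]) hη) (by linarith)
    have h2 : √(k + 1 : ℝ) ≤ a k * (2 * k) := by
      simp only [ha]
      rw [one_div, ← div_eq_inv_mul, le_div_iff₀ (by positivity),
        Real.mul_self_sqrt (by linarith)]
      linarith
    nlinarith

theorem exists_matrix_following_profile (hm : 1 ≤ m) (hn : 2 ≤ n) (hD : D + 1 = m + n) {η : ℝ}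
    (hη : 0 ≤ η) (hηD : η ≤ 1 / (n * D)) :
    ∃ ξ : Matrix (Fin n) (Fin m) ℝ, ∃ c > 0, ∃ C > 0, ∃ h : ℝ → ℝ,
      (∀ t, 0 ≤ t → FlowSeparated (c * Real.exp (-h t)) ξ t ∧
        ∃ v : Fin m ⊕ Fin n → ℤ, v ≠ 0 ∧
          flowNorm ξ t (fun i => (v i : ℝ)) ≤ C * Real.exp (-h t)) ∧
      h 0 = 0 ∧ (∀ t, 0 ≤ t → 0 ≤ h t) ∧
      (∀ t σ, 0 ≤ t → 0 ≤ σ → h (t + σ) ≤ h t + σ / (n * D)) ∧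
      (∀ δ > 0, ∃ t₀, ∀ t, t₀ ≤ t → h t ≤ (η + δ) * t) ∧
      ∀ δ > 0, ∀ t₀, ∃ t, t₀ ≤ t ∧ (η - δ) * t ≤ h t ∧ t₀ ≤ h t := by
  have hm0 : (0 : ℝ) < m := by exact_mod_cast hm
  have hn0 : (0 : ℝ) < n := by exact_mod_cast (by omega : 0 < n)
  have hD0 : (0 : ℝ) < D := by exact_mod_cast (by omega : 0 < D)
  obtain ⟨K, hK, c, hc, C, hC, hmain⟩ := exists_matrix_following_tents hm hn hD
  obtain ⟨f, hf, hfη, hfk⟩ := exists_slopes hη (by positivity : 0 < 1 / ((n : ℝ) * D)) hηD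
  have hf1 : ∀ k, n * (D * f k) < 1 := fun k => by
    have := (hf k).2
    rw [lt_div_iff₀ (by positivity)] at this
    linarith
  set φ : ℕ → ℝ := fun k => (m + n) * (D * f k) / (1 - n * (D * f k)) with hφ
  have hφ0 : ∀ k, 0 ≤ φ k := fun k => by
    have h1 := (hf k).1.le
    have h2 := hf1 k
    exact div_nonneg (by positivity) (by linarith)
  set t : ℕ → ℝ := fun k => Nat.rec 0 (fun k s => s + φ k * s + K) k with ht
  set T : ℕ → ℝ := fun k => φ k * t k with hT
  have ht0 : t 0 = 0 := rfl
  have hts : ∀ k, t (k + 1) = t k + T k + K := fun k => rfl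
  have htK : ∀ k : ℕ, K * k ≤ t k := by
    intro k
    induction k with
    | zero => simp [ht0]
    | succ k ih =>
      have h1 : 0 ≤ t k := le_trans (by positivity) ih
      rw [hts, hT]
      push_cast
      nlinarith [mul_nonneg (hφ0 k) h1]
  have htnn : ∀ k, 0 ≤ t k := fun k => le_trans (by positivity) (htK k)
  have hTnn : ∀ k, 0 ≤ T k := fun k => mul_nonneg (hφ0 k) (htnn k)
  have htmono : Monotone t := monotone_nat_of_le_succ fun k => by rw [hts]; linarith [hTnn k]
  have hTeq : ∀ k, T k * (1 - n * (D * f k)) = (m + n) * (D * f k) * t k := fun k => by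
    have h1 : 1 - n * (D * f k) ≠ 0 := by linarith [hf1 k]
    have h2 : φ k * (1 - n * (D * f k)) = (m + n) * (D * f k) := div_mul_cancel₀ _ h1
    rw [← h2]
    ring
  have hTtop : Filter.Tendsto T Filter.atTop Filter.atTop := by
    refine Filter.tendsto_atTop_mono (fun k => ?_)
      (hfk.const_mul_atTop (by positivity : 0 < (m + n) * D * K))
    have h1 := hf k
    calc (m + n) * D * K * (f k * k) = (m + n) * (D * f k) * (K * k) := by ring
      _ ≤ (m + n) * (D * f k) * t k := by
          have := h1.1
          gcongr
          exact htK k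
      _ = T k * (1 - n * (D * f k)) := (hTeq k).symm
      _ ≤ T k * 1 := by
          gcongr
          · exact hTnn k
          · have := h1.1
            have : 0 ≤ n * (D * f k) := by positivity
            linarith
      _ = T k := mul_one _
  have hidx : ∀ s, ∃ k, s < t (k + 1) := fun s => by
    obtain ⟨k, hk⟩ := exists_nat_gt (s / K)
    refine ⟨k, ?_⟩
    rw [div_lt_iff₀ hK, mul_comm] at hk
    exact hk.trans_le ((htK k).trans (htmono k.le_succ))
  classical
  set κ : ℝ → ℕ := fun s => Nat.find (hidx s) with hκ
  have hκlt : ∀ s, s < t (κ s + 1) := fun s => Nat.find_spec (hidx s)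
  have hκle : ∀ s, 0 ≤ s → t (κ s) ≤ s := by
    intro s hs
    rcases hk : κ s with _ | k
    · rw [ht0]; exact hs
    · have : k < κ s := by omega
      exact not_lt.mp (Nat.find_min (hidx s) this)
  have hκge : ∀ s k, t k ≤ s → k ≤ κ s := fun s k hks => by
    by_contra! hlt
    have := htmono (Nat.succ_le_of_lt hlt)
    linarith [hκlt s]
  have hκeq : ∀ s k, t k ≤ s → s < t (k + 1) → κ s = k := fun s k h1 h2 =>
    le_antisymm (Nat.find_min' (hidx s) h2) (hκge s k h1)
  obtain ⟨ξ, hξ⟩ := hmain t T ht0 hTnn hts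
  have htent : ∀ s, 0 ≤ s → tent m n D (T (κ s)) (s - t (κ s)) ≤ f (κ s) * s := by
    intro s hs
    have h1 := tent_le_mul (D := D) (e := D * f (κ s)) hm (by omega : 1 ≤ n)
      (by have := (hf (κ s)).1; positivity) (hf1 _).le (htnn (κ s)) (hTeq _)
      (sub_nonneg.mpr (hκle s hs))
    rwa [mul_div_cancel_left₀ _ hD0.ne', add_sub_cancel] at h1
  refine ⟨ξ, c, hc, C, hC, fun s => tent m n D (T (κ s)) (s - t (κ s)), fun s hs => ?_, ?_,
    fun _ _ => tent_nonneg, fun s σ hs hσ => ?_, fun δ hδ => ?_, fun δ hδ t₀ => ?_⟩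
  · have h1 := hξ (κ s) (s - t (κ s)) (sub_nonneg.mpr (hκle s hs)) (by
      have := hκlt s
      rw [hts] at this
      linarith)
    rwa [add_sub_cancel] at h1
  · have h1 := hκeq 0 0 ht0.le (by rw [hts, ht0]; linarith [hTnn 0])
    simp only [h1, ht0, sub_zero]
    exact tent_zero
  · rcases (hκge (s + σ) (κ s) ((hκle s hs).trans (by linarith))).eq_or_lt with h1 | h1
    · simp only [← h1]
      rw [add_sub_right_comm]
      exact tent_add_le hσ
    · have h2 : t (κ s + 1) ≤ t (κ (s + σ)) := htmono h1
      have h3 := hκlt s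
      have h4 := hκle (s + σ) (by linarith)
      have h5 := tent_add_le (m := m) (n := n) (D := D) (T := T (κ (s + σ))) (s := 0)
        (sub_nonneg.mpr h4)
      rw [zero_add, tent_zero, zero_add] at h5
      refine h5.trans ?_
      have h6 : (s + σ - t (κ (s + σ))) / (n * D) ≤ σ / (n * D) := by gcongr; linarith
      linarith [tent_nonneg (m := m) (n := n) (D := D) (T := T (κ s)) (s := s - t (κ s))]
  · obtain ⟨k₀, hk₀⟩ := Filter.eventually_atTop.mp
      (hfη.eventually (gt_mem_nhds (by linarith : η < η + δ)))
    refine ⟨t k₀, fun s hs => ?_⟩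
    have hs0 := (htnn k₀).trans hs
    refine (htent s hs0).trans ?_
    gcongr
    exact (hk₀ _ (hκge s k₀ hs)).le
  · obtain ⟨k₀, hk₀⟩ := Filter.eventually_atTop.mp
      (hfη.eventually (lt_mem_nhds (by linarith : η - δ < η)))
    obtain ⟨k₁, hk₁⟩ := Filter.eventually_atTop.mp
      (hTtop.eventually_ge_atTop ((m + n) * D * |t₀|))
    obtain ⟨k₂, hk₂⟩ := exists_nat_ge (t₀ / K)
    rw [div_le_iff₀ hK] at hk₂
    set k := max k₀ (max k₁ k₂) with hk
    have hTk := hTnn k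
    have hpeak : 0 ≤ n * T k / (m + n) := by positivity
    have hpeak' : n * T k / (m + n) ≤ T k := by
      rw [div_le_iff₀ (by positivity)]
      nlinarith
    have hκk := hκeq (t k + n * T k / (m + n)) k (by linarith) (by rw [hts]; linarith)
    have hval : f k * (t k + n * T k / (m + n)) = T k / (m + n) / D := by
      have := hTeq k
      field_simp
      linarith
    refine ⟨t k + n * T k / (m + n), ?_, ?_, ?_⟩
    · have h1 : (k₂ : ℝ) ≤ k := by exact_mod_cast (le_max_right _ _).trans (le_max_right _ _)
      have h2 : K * k₂ ≤ K * k := by gcongr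
      linarith [htK k]
    · simp only [hκk, add_sub_cancel_left]
      rw [tent_peak hm (by omega) hTk, ← hval]
      have := htnn k
      gcongr
      exact (hk₀ k (le_max_left _ _)).le
    · simp only [hκk, add_sub_cancel_left]
      rw [tent_peak hm (by omega) hTk, div_div, le_div_iff₀ (by positivity)]
      have h1 := hk₁ k ((le_max_left _ _).trans (le_max_right _ _))
      have h2 : t₀ * ((m + n) * D) ≤ |t₀| * ((m + n) * D) := by gcongr; exact le_abs_self _
      linarith

end profile

theorem exists_minimal_points {α : Type*} {N : α → ℕ} {ψ : α → ℝ}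
    (hfin : ∀ Q, {a | N a ≤ Q}.Finite) (hN : ∀ a, 1 ≤ N a) (h₁ : ∃ a, N a = 1)
    (hsmall : ∀ a, ∃ b, ψ b < ψ a) :
    ∃ s : ℕ → α, N (s 0) = 1 ∧ StrictMono (fun i => N (s i)) ∧ StrictAnti (fun i => ψ (s i)) ∧
      ∀ i b, N b < N (s (i + 1)) → ψ (s i) ≤ ψ b := by
  have hmin : ∀ Q, (∃ a, N a ≤ Q) → ∃ a, N a ≤ Q ∧ ∀ b, N b ≤ Q → ψ a ≤ ψ b := fun Q hQ =>
    Set.exists_min_image _ ψ (hfin Q) hQ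
  have hstep : ∀ a : {a // ∀ b, N b ≤ N a → ψ a ≤ ψ b}, ∃ b : {a // ∀ b, N b ≤ N a → ψ a ≤ ψ b},
      N a < N b ∧ ψ b < ψ a ∧ ∀ c, N c < N b → ψ a ≤ ψ c := by
    classical
    rintro ⟨a, ha⟩
    have hex : ∃ Q, ∃ c, N c = Q ∧ ψ c < ψ a := by
      obtain ⟨c, hc⟩ := hsmall a
      exact ⟨_, c, rfl, hc⟩
    obtain ⟨c, hcQ, hc⟩ := Nat.find_spec hex
    have hlt : ∀ c, N c < Nat.find hex → ψ a ≤ ψ c := fun c hc => by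
      by_contra! h
      exact Nat.find_min hex hc ⟨c, rfl, h⟩
    obtain ⟨b, hbQ, hb⟩ := hmin (Nat.find hex) ⟨c, hcQ.le⟩
    have hba : ψ b < ψ a := (hb c hcQ.le).trans_lt hc
    have hbQ' : N b = Nat.find hex := hbQ.antisymm (Nat.find_min' hex ⟨b, rfl, hba⟩)
    refine ⟨⟨b, fun e he => hb e (he.trans hbQ)⟩, ?_, hba, fun e he => hlt e (hbQ' ▸ he)⟩
    by_contra! h
    exact (ha b h).not_gt hba
  choose next hnext using hstep
  obtain ⟨a₁, ha₁⟩ := h₁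
  obtain ⟨a₀, ha₀, hmin₀⟩ := hmin 1 ⟨a₁, ha₁.le⟩
  let s : ℕ → {a // ∀ b, N b ≤ N a → ψ a ≤ ψ b} := fun i =>
    Nat.rec ⟨a₀, fun b hb => hmin₀ b (hb.trans ha₀)⟩ (fun _ a => next a) i
  refine ⟨fun i => (s i).1, ha₀.antisymm (hN a₀), strictMono_nat_of_lt_succ fun i => (hnext (s i)).1,
    strictAnti_nat_of_succ_lt fun i => (hnext (s i)).2.1, ?_⟩
  exact fun i => (hnext (s i)).2.2

theorem norm_intCast_eq_sup_natAbs {m : ℕ} (u : Fin m → ℤ) :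
    ‖(fun j => (u j : ℝ))‖ = (Finset.univ.sup fun j => (u j).natAbs : ℕ) := by
  have habs : ∀ j, ‖(u j : ℝ)‖ = ((u j).natAbs : ℝ) := fun j => by
    rw [Real.norm_eq_abs, Nat.cast_natAbs, Int.cast_abs]
  refine le_antisymm ((pi_norm_le_iff_of_nonneg (Nat.cast_nonneg _)).2 fun j => ?_) ?_
  · rw [habs]
    exact_mod_cast Finset.le_sup (f := fun j => (u j).natAbs) (Finset.mem_univ j)
  · have h : (Finset.univ.sup fun j => (u j).natAbs) ≤ ⌊‖(fun j => (u j : ℝ))‖⌋₊ :=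
      Finset.sup_le fun j _ => Nat.le_floor (by
        rw [← habs]
        exact norm_le_pi_norm (fun j => (u j : ℝ)) j)
    exact (Nat.cast_le.2 h).trans (Nat.floor_le (norm_nonneg _))

theorem finite_setOf_sup_natAbs_le (m Q : ℕ) :
    {u : Fin m → ℤ | (Finset.univ.sup fun j => (u j).natAbs) ≤ Q}.Finite := by
  refine (Set.finite_Icc (fun _ => -(Q : ℤ)) (fun _ => (Q : ℤ))).subset fun u hu => ?_
  have h : ∀ j, (u j).natAbs ≤ Q := fun j =>
    (Finset.le_sup (f := fun j => (u j).natAbs) (Finset.mem_univ j)).trans hu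
  exact ⟨fun j => by have := h j; dsimp only; omega, fun j => by have := h j; dsimp only; omega⟩

theorem norm_sub_round_le {n : ℕ} (a : Fin n → ℝ) (v : Fin n → ℤ) :
    ‖a - (fun k => (round (a k) : ℝ))‖ ≤ ‖a - (fun k => (v k : ℝ))‖ :=
  (pi_norm_le_iff_of_nonneg (norm_nonneg _)).2 fun k =>
    (round_le (a k) (v k)).trans (norm_le_pi_norm (a - fun k => (v k : ℝ)) k)

theorem norm_sub_round_le_half {n : ℕ} (a : Fin n → ℝ) :
    ‖a - (fun k => (round (a k) : ℝ))‖ ≤ 1 / 2 :=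
  (pi_norm_le_iff_of_nonneg (by norm_num)).2 fun k => abs_sub_round (a k)

theorem exists_isBestApproxSeq {m n : ℕ} (hm : 1 ≤ m) {ξ : Matrix (Fin n) (Fin m) ℝ}
    (hξ : TotallyIrrational ξ)
    (hsmall : ∀ ε > 0, ∃ (u : Fin m → ℤ) (v : Fin n → ℤ), u ≠ 0 ∧
      ‖ξ.mulVec (fun j => (u j : ℝ)) - (fun k => (v k : ℝ))‖ < ε) :
    ∃ (x : ℕ → Fin m → ℤ) (y : ℕ → Fin n → ℤ), IsBestApproxSeq ξ x y ∧
      Lval ξ x y 0 ≤ 1 / 2 := by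
  let r : (Fin m → ℤ) → Fin n → ℤ := fun u k => round (ξ.mulVec (fun j => (u j : ℝ)) k)
  let ψ : (Fin m → ℤ) → ℝ := fun u => ‖ξ.mulVec (fun j => (u j : ℝ)) - (fun k => (r u k : ℝ))‖
  let N : (Fin m → ℤ) → ℕ := fun u => Finset.univ.sup fun j => (u j).natAbs
  have hψ : ∀ u (v : Fin n → ℤ), ψ u ≤ ‖ξ.mulVec (fun j => (u j : ℝ)) - (fun k => (v k : ℝ))‖ := fun u v =>
    norm_sub_round_le _ v
  have hψ0 : ∀ u, u ≠ 0 → 0 < ψ u := fun u hu => hξ u (r u) fun h => hu (congrArg Prod.fst h)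
  obtain ⟨s, hs₁, hs₂, hs₃, hs₄⟩ := exists_minimal_points (α := {u : Fin m → ℤ // u ≠ 0})
    (N := fun u => N u) (ψ := fun u => ψ u)
    (fun Q => (finite_setOf_sup_natAbs_le m Q).preimage Subtype.val_injective.injOn)
    (fun u => by
      by_contra! h
      refine u.2 (funext fun j => ?_)
      have h1 : ((u : Fin m → ℤ) j).natAbs ≤ N u :=
        Finset.le_sup (f := fun j => ((u : Fin m → ℤ) j).natAbs) (Finset.mem_univ j)
      rw [Pi.zero_apply]
      omega)
    (by
      refine ⟨⟨fun _ => 1, fun h => by simpa using congrFun h ⟨0, hm⟩⟩, ?_⟩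
      exact Finset.sup_const ⟨⟨0, hm⟩, Finset.mem_univ _⟩ 1)
    (fun u => by
      obtain ⟨u', v', hu', h⟩ := hsmall (ψ u) (hψ0 u u.2)
      exact ⟨⟨u', hu'⟩, (hψ u' v').trans_lt h⟩)
  have hX : ∀ i, Xval (fun i => (s i : Fin m → ℤ)) i = N (s i) := fun i =>
    norm_intCast_eq_sup_natAbs _
  refine ⟨fun i => s i, fun i => r (s i), ⟨fun i => (s i).2, ?_, ?_, hs₃, fun i u v hu h => ?_⟩,
    norm_sub_round_le_half _⟩
  · rw [hX, hs₁, Nat.cast_one]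
  · intro i j hij
    rw [hX, hX]
    exact_mod_cast hs₂ hij
  · rw [hX, norm_intCast_eq_sup_natAbs] at h
    exact (hs₄ i ⟨u, hu⟩ (by exact_mod_cast h)).trans (hψ u v)

section flow_profile

variable {m n : ℕ} {ξ : Matrix (Fin n) (Fin m) ℝ} {c C θ : ℝ} {h : ℝ → ℝ}

/-- The first minimum of the flow orbit of `ξ` at time `t` is comparable to `exp (-h t)`, where
`h` starts at `0`, is nonnegative, and grows at rate at most `θ`. -/
structure HasFlowProfile (ξ : Matrix (Fin n) (Fin m) ℝ) (c C θ : ℝ) (h : ℝ → ℝ) : Prop where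
  lower_pos : 0 < c
  upper_pos : 0 < C
  separated : ∀ t, 0 ≤ t → FlowSeparated (c * Real.exp (-h t)) ξ t
  short : ∀ t, 0 ≤ t → ∃ v : Fin m ⊕ Fin n → ℤ, v ≠ 0 ∧
    flowNorm ξ t (fun i => (v i : ℝ)) ≤ C * Real.exp (-h t)
  profile_zero : h 0 = 0
  profile_nonneg : ∀ t, 0 ≤ t → 0 ≤ h t
  profile_add_le : ∀ t σ, 0 ≤ t → 0 ≤ σ → h (t + σ) ≤ h t + θ * σ

namespace HasFlowProfile

theorem profile_le (H : HasFlowProfile ξ c C θ h) {t : ℝ} (ht : 0 ≤ t) : h t ≤ θ * t := by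
  simpa [H.profile_zero] using H.profile_add_le 0 t le_rfl ht

theorem le_of_forall_le (H : HasFlowProfile ξ c C θ h) {t r : ℝ} (ht : 0 ≤ t)
    {u : Fin m → ℤ} {v : Fin n → ℤ} (huv : (u, v) ≠ 0)
    (hu : Real.exp (-(t / m)) * ‖(fun j => (u j : ℝ))‖ ≤ r)
    (hv : Real.exp (t / n) * ‖ξ.mulVec (fun j => (u j : ℝ)) - (fun k => (v k : ℝ))‖ ≤ r) :
    c * Real.exp (-h t) ≤ r := by
  have hne : Sum.elim u (-v) ≠ 0 := fun h0 => huv (Prod.ext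
    (funext fun j => by simpa using congrFun h0 (Sum.inl j))
    (funext fun k => by simpa using congrFun h0 (Sum.inr k)))
  refine (H.separated t ht _ hne).trans (flowNorm_le_of_forall
    (le_trans (by positivity) hu) (fun j => le_trans ?_ hu) (fun k => le_trans ?_ hv))
  · gcongr
    exact norm_le_pi_norm (fun j => (u j : ℝ)) j
  · gcongr
    have hk := norm_le_pi_norm (ξ.mulVec (fun j => (u j : ℝ)) - (fun k => (v k : ℝ))) k
    rw [Pi.sub_apply, Real.norm_eq_abs] at hk
    refine le_trans (le_of_eq ?_) hk
    congr 1
    simp only [Matrix.mulVec, dotProduct, Sum.elim_inl, Sum.elim_inr, Pi.neg_apply, Int.cast_neg]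
    ring

theorem exists_short (H : HasFlowProfile ξ c C θ h) {t : ℝ} (ht : 0 ≤ t) :
    ∃ (u : Fin m → ℤ) (v : Fin n → ℤ), (u, v) ≠ 0 ∧
      Real.exp (-(t / m)) * ‖(fun j => (u j : ℝ))‖ ≤ C * Real.exp (-h t) ∧
      Real.exp (t / n) * ‖ξ.mulVec (fun j => (u j : ℝ)) - (fun k => (v k : ℝ))‖ ≤
        C * Real.exp (-h t) := by
  obtain ⟨w, hw0, hw⟩ := H.short t ht
  have hC := H.upper_pos
  have hr : 0 ≤ C * Real.exp (-h t) := by positivity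
  refine ⟨fun j => w (Sum.inl j), fun k => -w (Sum.inr k), fun h0 => hw0 ?_, ?_, ?_⟩
  · funext i
    rcases i with j | k
    · exact congrFun (congrArg Prod.fst h0) j
    · simpa using congrFun (congrArg Prod.snd h0) k
  · rw [← le_div_iff₀' (Real.exp_pos _), pi_norm_le_iff_of_nonneg (by positivity)]
    intro j
    rw [le_div_iff₀' (Real.exp_pos _)]
    exact (flowNorm_inl_le (ξ := ξ) (t := t) (w := fun i => (w i : ℝ)) j).trans hw
  · rw [← le_div_iff₀' (Real.exp_pos _), pi_norm_le_iff_of_nonneg (by positivity)]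
    intro k
    rw [le_div_iff₀' (Real.exp_pos _)]
    refine le_trans (le_of_eq ?_)
      ((flowNorm_inr_le (ξ := ξ) (t := t) (w := fun i => (w i : ℝ)) k).trans hw)
    rw [Real.norm_eq_abs]
    congr 2
    simp [Matrix.mulVec, dotProduct]
    ring

theorem one_le_norm_of_ne_zero {v : Fin n → ℤ} (hv : v ≠ 0) : 1 ≤ ‖(fun k => (v k : ℝ))‖ := by
  obtain ⟨k, hk⟩ := Function.ne_iff.mp hv
  refine le_trans ?_ (norm_le_pi_norm (fun k => (v k : ℝ)) k)
  rw [Real.norm_eq_abs]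
  exact_mod_cast Int.one_le_abs hk

theorem exists_short_of_lt (H : HasFlowProfile ξ c C θ h) {t : ℝ} (ht : 0 ≤ t)
    (htC : C < Real.exp (t / n)) :
    ∃ (u : Fin m → ℤ) (v : Fin n → ℤ), u ≠ 0 ∧
      ‖(fun j => (u j : ℝ))‖ ≤ C * Real.exp (t / m - h t) ∧
      ‖ξ.mulVec (fun j => (u j : ℝ)) - (fun k => (v k : ℝ))‖ ≤
        C * Real.exp (-(t / n) - h t) := by
  obtain ⟨u, v, huv, hu, hv⟩ := H.exists_short ht
  refine ⟨u, v, fun h0 => ?_, ?_, ?_⟩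
  · subst h0
    have hv0 : v ≠ 0 := fun hv0 => huv (by rw [hv0]; rfl)
    have h1 : ‖ξ.mulVec (fun j => (((0 : Fin m → ℤ) j : ℤ) : ℝ)) - (fun k => (v k : ℝ))‖ =
        ‖(fun k => (v k : ℝ))‖ := by
      have : (fun j => (((0 : Fin m → ℤ) j : ℤ) : ℝ)) = 0 := by ext; simp
      rw [this, Matrix.mulVec_zero, zero_sub, norm_neg]
    rw [h1] at hv
    have h2 := one_le_norm_of_ne_zero hv0
    have h3 : Real.exp (-h t) ≤ 1 := Real.exp_le_one_iff.2 (by linarith [H.profile_nonneg t ht])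
    have h4 : Real.exp (t / n) * 1 ≤ Real.exp (t / n) * ‖(fun k => (v k : ℝ))‖ := by gcongr
    have h5 : C * Real.exp (-h t) ≤ C * 1 := by
      have := H.upper_pos
      gcongr
    linarith
  · rw [Real.exp_neg, inv_mul_le_iff₀ (Real.exp_pos _)] at hu
    rw [sub_eq_add_neg, Real.exp_add]
    linarith
  · rw [← le_div_iff₀' (Real.exp_pos _)] at hv
    refine hv.trans (le_of_eq ?_)
    rw [sub_eq_add_neg (-(t / (n : ℝ))), Real.exp_add, Real.exp_neg (t / n), div_eq_mul_inv]
    ring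

theorem totallyIrrational (H : HasFlowProfile ξ c C θ h) (hθ : θ < 1 / m) :
    TotallyIrrational ξ := by
  intro u v huv
  by_contra! hle
  have h0 : ‖ξ.mulVec (fun j => (u j : ℝ)) - (fun k => (v k : ℝ))‖ = 0 :=
    le_antisymm hle (norm_nonneg _)
  have hbd : ∀ t : ℝ, 0 ≤ t → c * Real.exp ((1 / m - θ) * t) ≤ ‖(fun j => (u j : ℝ))‖ := by
    intro t ht
    have h1 := H.le_of_forall_le ht huv le_rfl (by rw [h0, mul_zero]; positivity)
    have h2 : c * Real.exp (-(θ * t)) ≤ c * Real.exp (-h t) := by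
      have := H.lower_pos
      have := H.profile_le ht
      gcongr
    have h3 := h2.trans h1
    rw [Real.exp_neg (t / m), ← div_eq_inv_mul, le_div_iff₀ (Real.exp_pos _), mul_assoc,
      ← Real.exp_add] at h3
    rwa [show -(θ * t) + t / m = (1 / m - θ) * t by ring] at h3
  have htend : Filter.Tendsto (fun t : ℝ => c * Real.exp ((1 / m - θ) * t)) Filter.atTop
      Filter.atTop :=
    (Real.tendsto_exp_atTop.comp
      (Filter.tendsto_id.const_mul_atTop (by linarith))).const_mul_atTop H.lower_pos
  obtain ⟨t, ht, ht0⟩ := ((htend.eventually_gt_atTop ‖(fun j => (u j : ℝ))‖).and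
    (Filter.eventually_ge_atTop 0)).exists
  exact ht.not_ge (hbd t ht0)

theorem exists_balanced_time {X L : ℝ} (hm : 1 ≤ m) (hn : 1 ≤ n) (hX : 1 ≤ X) (hL0 : 0 < L)
    (hL : L ≤ 1) :
    ∃ t, 0 ≤ t ∧ Real.exp (-(t / m)) * X = Real.exp (t / n) * L ∧
      Real.log X ≤ t * (1 / m + 1 / n) := by
  have hm0 : (0 : ℝ) < m := by exact_mod_cast hm
  have hn0 : (0 : ℝ) < n := by exact_mod_cast hn
  have hlX := Real.log_nonneg hX
  have hlL := Real.log_nonpos hL0.le hL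
  have hτ : (0 : ℝ) < 1 / m + 1 / n := by positivity
  have ht : (Real.log X - Real.log L) / (1 / m + 1 / n) * (1 / m + 1 / n) =
      Real.log X - Real.log L := div_mul_cancel₀ _ hτ.ne'
  refine ⟨(Real.log X - Real.log L) / (1 / m + 1 / n), div_nonneg (by linarith) hτ.le, ?_,
    by linarith⟩
  generalize (Real.log X - Real.log L) / (1 / (m : ℝ) + 1 / n) = t at ht
  have h1 : -(t / m) + Real.log X = t / n + Real.log L := by
    have : t * (1 / m + 1 / n) = t / m + t / n := by ring
    linarith
  simpa [Real.exp_add, Real.exp_log hL0, Real.exp_log (by linarith : 0 < X)] using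
    congrArg Real.exp h1

variable {x : ℕ → Fin m → ℤ} {y : ℕ → Fin n → ℤ}

theorem propC (H : HasFlowProfile ξ c C θ h) (hm : 1 ≤ m) (hn : 1 ≤ n)
    (hθ : θ < 1 / m) (hxy : IsBestApproxSeq ξ x y) (hL : Lval ξ x y 0 ≤ 1 / 2) :
    PropC ξ x y := by
  have hc := H.lower_pos
  have hC := H.upper_pos
  obtain ⟨σ, hσ, hσ0⟩ : ∃ σ, C < c * Real.exp ((1 / m - θ) * σ) ∧ 0 ≤ σ :=
    ((((Real.tendsto_exp_atTop.comp
      (Filter.tendsto_id.const_mul_atTop (by linarith))).const_mul_atTop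
        hc).eventually_gt_atTop C).and (Filter.eventually_ge_atTop 0)).exists
  have hLpos : ∀ i, 0 < Lval ξ x y i := fun i =>
    H.totallyIrrational hθ (x i) (y i) fun h0 => hxy.nonzero i (congrArg Prod.fst h0)
  refine ⟨C / c * Real.exp (θ * σ + σ / n), fun i => ?_⟩
  have hX : 1 ≤ Xval x (i + 1) := by
    rw [← hxy.first]
    exact hxy.xStrictMono.monotone (Nat.zero_le _)
  have hLi : Lval ξ x y i ≤ 1 / 2 := (hxy.lStrictAnti.antitone (Nat.zero_le i)).trans hL
  obtain ⟨t, ht, hbal, -⟩ := exists_balanced_time hm hn hX (hLpos i) (by linarith)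
  have hshort : Real.exp (t / n) * Lval ξ x y i ≤ C * Real.exp (-h t) := by
    obtain ⟨u, v, huv, hu, hv⟩ := H.exists_short ht
    by_cases hu0 : u = 0
    · subst hu0
      have hv0 : v ≠ 0 := fun hv0 => huv (by rw [hv0]; rfl)
      refine le_trans ?_ hv
      gcongr
      have : (fun j => (((0 : Fin m → ℤ) j : ℤ) : ℝ)) = 0 := by ext; simp
      rw [this, Matrix.mulVec_zero, zero_sub, norm_neg]
      linarith [one_le_norm_of_ne_zero hv0]
    · rcases lt_or_ge ‖(fun j => (u j : ℝ))‖ (Xval x (i + 1)) with hlt | hge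
      · refine le_trans ?_ hv
        gcongr
        exact hxy.best i u v hu0 hlt
      · rw [← hbal]
        refine le_trans ?_ hu
        gcongr
  have hprof : c * Real.exp (-h t) * Real.exp (-(θ * σ)) ≤ c * Real.exp (-h (t + σ)) := by
    rw [mul_assoc, ← Real.exp_add]
    gcongr
    linarith [H.profile_add_le t σ ht hσ0]
  have hX' : Real.exp (-((t + σ) / m)) * Xval x (i + 1) < c * Real.exp (-h (t + σ)) := by
    refine lt_of_lt_of_le ?_ hprof
    have h1 : Real.exp (-((t + σ) / m)) * Xval x (i + 1) =
        Real.exp (-(σ / m)) * (Real.exp (t / n) * Lval ξ x y i) := by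
      rw [← hbal, ← mul_assoc, ← Real.exp_add]
      congr 2
      ring
    calc _ = Real.exp (-(σ / m)) * (Real.exp (t / n) * Lval ξ x y i) := h1
      _ ≤ Real.exp (-(σ / m)) * (C * Real.exp (-h t)) := by gcongr
      _ < Real.exp (-(σ / m)) * (c * Real.exp ((1 / m - θ) * σ) * Real.exp (-h t)) := by gcongr
      _ = c * Real.exp (-h t) * (Real.exp (-(σ / m)) * Real.exp ((1 / m - θ) * σ)) := by ring
      _ = c * Real.exp (-h t) * Real.exp (-(θ * σ)) := by
        rw [← Real.exp_add]
        congr 2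
        ring
  have hL' : c * Real.exp (-h (t + σ)) ≤ Real.exp ((t + σ) / n) * Lval ξ x y (i + 1) := by
    by_contra! hlt
    exact (max_lt hX' hlt).not_ge (H.le_of_forall_le (by linarith : 0 ≤ t + σ)
      (u := x (i + 1)) (v := y (i + 1)) (fun h0 => hxy.nonzero _ (congrArg Prod.fst h0))
      (le_max_left _ _) (le_max_right _ _))
  rw [div_le_iff₀ (hLpos _)]
  have h1 : c * (Real.exp (t / n) * Lval ξ x y i) * Real.exp (-(θ * σ)) ≤
      C * (Real.exp ((t + σ) / n) * Lval ξ x y (i + 1)) := by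
    calc _ ≤ c * (C * Real.exp (-h t)) * Real.exp (-(θ * σ)) := by gcongr
      _ = C * (c * Real.exp (-h t) * Real.exp (-(θ * σ))) := by ring
      _ ≤ _ := by
        exact mul_le_mul_of_nonneg_left (hprof.trans hL') hC.le
  have h2 : Real.exp ((t + σ) / n) = Real.exp (t / n) * Real.exp (σ / n) := by
    rw [← Real.exp_add, add_div]
  rw [h2, Real.exp_neg] at h1
  rw [Real.exp_add]
  have h3 := Real.exp_pos (t / n)
  have h4 := Real.exp_pos (θ * σ)
  field_simp at h1 ⊢
  linarith

end HasFlowProfile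

end flow_profile

section flow_profile_exponent

variable {m n : ℕ} {ξ : Matrix (Fin n) (Fin m) ℝ} {c C θ η : ℝ} {h : ℝ → ℝ}
  {x : ℕ → Fin m → ℤ} {y : ℕ → Fin n → ℤ}

theorem IsBestApproxSeq.one_le_Xval (hxy : IsBestApproxSeq ξ x y) (i : ℕ) : 1 ≤ Xval x i := by
  rw [← hxy.first]
  exact hxy.xStrictMono.monotone (Nat.zero_le _)

theorem IsBestApproxSeq.tendsto_Xval (hxy : IsBestApproxSeq ξ x y) :
    Filter.Tendsto (Xval x) Filter.atTop Filter.atTop := by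
  have hnat : StrictMono fun i => Finset.univ.sup fun j => (x i j).natAbs := fun i j hij => by
    have := hxy.xStrictMono hij
    rw [Xval, Xval, norm_intCast_eq_sup_natAbs, norm_intCast_eq_sup_natAbs] at this
    exact_mod_cast this
  have heq : Xval x = fun i => ((Finset.univ.sup fun j => (x i j).natAbs : ℕ) : ℝ) :=
    funext fun i => norm_intCast_eq_sup_natAbs _
  rw [heq]
  exact tendsto_natCast_atTop_atTop.comp hnat.tendsto_atTop

theorem IsBestApproxSeq.exists_Lval_le (hxy : IsBestApproxSeq ξ x y) {u : Fin m → ℤ} (hu : u ≠ 0)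
    (v : Fin n → ℤ) :
    ∃ i, Xval x i ≤ ‖(fun j => (u j : ℝ))‖ ∧
      Lval ξ x y i ≤ ‖ξ.mulVec (fun j => (u j : ℝ)) - (fun k => (v k : ℝ))‖ := by
  classical
  have hex : ∃ i, ‖(fun j => (u j : ℝ))‖ < Xval x (i + 1) :=
    (((Filter.tendsto_add_atTop_iff_nat 1).2 hxy.tendsto_Xval).eventually_gt_atTop _).exists
  refine ⟨Nat.find hex, ?_, hxy.best _ u v hu (Nat.find_spec hex)⟩
  rcases hi : Nat.find hex with _ | i
  · rw [hxy.first]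
    exact HasFlowProfile.one_le_norm_of_ne_zero hu
  · exact not_lt.1 (Nat.find_min hex (by omega : i < Nat.find hex))

namespace HasFlowProfile

theorem tendsto_neg_div_sub (H : HasFlowProfile ξ c C θ h) (hn : 1 ≤ n) {ε : ℝ} (hε : 0 < ε) :
    ∃ t₀, 0 ≤ t₀ ∧ ∀ t, t₀ ≤ t → C < Real.exp (t / n) ∧ C * Real.exp (-(t / n) - h t) < ε := by
  have hn0 : (0 : ℝ) < n := by exact_mod_cast hn
  have htend : Filter.Tendsto (fun t : ℝ => Real.exp (t / n)) Filter.atTop Filter.atTop :=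
    Real.tendsto_exp_atTop.comp (Filter.tendsto_id.atTop_div_const hn0)
  obtain ⟨t₀, ht₀⟩ := Filter.eventually_atTop.1
    ((htend.eventually_gt_atTop C).and (htend.eventually_gt_atTop (C / ε)))
  refine ⟨max t₀ 0, le_max_right _ _, fun t ht => ⟨(ht₀ t ((le_max_left _ _).trans ht)).1, ?_⟩⟩
  have h1 := (ht₀ t ((le_max_left _ _).trans ht)).2
  have h2 := H.profile_nonneg t ((le_max_right _ _).trans ht)
  have hC := H.upper_pos
  calc C * Real.exp (-(t / n) - h t) ≤ C * Real.exp (-(t / n)) := by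
        gcongr
        linarith
    _ = C / Real.exp (t / n) := by rw [Real.exp_neg, ← div_eq_mul_inv]
    _ < ε := by
        rw [div_lt_iff₀ (Real.exp_pos _)]
        rw [div_lt_iff₀ hε] at h1
        linarith

theorem exists_small (H : HasFlowProfile ξ c C θ h) (hn : 1 ≤ n) {ε : ℝ} (hε : 0 < ε) :
    ∃ (u : Fin m → ℤ) (v : Fin n → ℤ), u ≠ 0 ∧
      ‖ξ.mulVec (fun j => (u j : ℝ)) - (fun k => (v k : ℝ))‖ < ε := by
  obtain ⟨t, ht, h1⟩ := H.tendsto_neg_div_sub hn hε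
  obtain ⟨u, v, hu, -, hv⟩ := H.exists_short_of_lt ht (h1 t le_rfl).1
  exact ⟨u, v, hu, hv.trans_lt (h1 t le_rfl).2⟩

theorem exists_pow_mul_pow_lt (H : HasFlowProfile ξ c C θ h) (hm : 1 ≤ m) (hn : 1 ≤ n)
    (hunb : ∀ t₀, ∃ t, t₀ ≤ t ∧ t₀ ≤ h t) {ε : ℝ} (hε : 0 < ε) :
    ∃ (u : Fin m → ℤ) (v : Fin n → ℤ), u ≠ 0 ∧
      ‖ξ.mulVec (fun j => (u j : ℝ)) - (fun k => (v k : ℝ))‖ < 1 ∧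
      ‖(fun j => (u j : ℝ))‖ ^ m *
        ‖ξ.mulVec (fun j => (u j : ℝ)) - (fun k => (v k : ℝ))‖ ^ n < ε := by
  have hm0 : (0 : ℝ) < m := by exact_mod_cast hm
  have hn0 : (0 : ℝ) < n := by exact_mod_cast hn
  have hC := H.upper_pos
  obtain ⟨t₀, ht₀, h1⟩ := H.tendsto_neg_div_sub hn one_pos
  obtain ⟨s, hs⟩ := (Real.tendsto_exp_atTop.eventually_gt_atTop (C ^ (m + n) / ε)).exists
  obtain ⟨t, ht, hht⟩ := hunb (max t₀ s)
  have ht1 : t₀ ≤ t := (le_max_left _ _).trans ht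
  obtain ⟨u, v, hu, huX, hvL⟩ := H.exists_short_of_lt (ht₀.trans ht1) (h1 t ht1).1
  refine ⟨u, v, hu, hvL.trans_lt (h1 t ht1).2, ?_⟩
  have hnn := H.profile_nonneg t (ht₀.trans ht1)
  calc _ ≤ (C * Real.exp (t / m - h t)) ^ m * (C * Real.exp (-(t / n) - h t)) ^ n := by gcongr
    _ = C ^ (m + n) * Real.exp (-((m + n) * h t)) := by
        rw [mul_pow, mul_pow, ← Real.exp_nat_mul, ← Real.exp_nat_mul, pow_add,
          mul_mul_mul_comm, ← Real.exp_add]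
        congr 2
        field_simp
        ring
    _ ≤ C ^ (m + n) * Real.exp (-s) := by
        gcongr
        have h2 : (1 : ℝ) ≤ m := by exact_mod_cast hm
        have h3 : 0 ≤ (m + n - 1 : ℝ) * h t := mul_nonneg (by linarith) hnn
        linarith [le_max_right t₀ s]
    _ < ε := by
        rw [Real.exp_neg, ← div_eq_mul_inv, div_lt_iff₀ (Real.exp_pos _)]
        rw [div_lt_iff₀ hε] at hs
        linarith

theorem Lval_pos (H : HasFlowProfile ξ c C θ h) (hθ : θ < 1 / m) (hxy : IsBestApproxSeq ξ x y)
    (i : ℕ) : 0 < Lval ξ x y i :=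
  H.totallyIrrational hθ (x i) (y i) fun h0 => hxy.nonzero i (congrArg Prod.fst h0)

theorem eventually_ratio_le (H : HasFlowProfile ξ c C θ h) (hm : 1 ≤ m) (hn : 1 ≤ n)
    (hθ : θ < 1 / m) (hxy : IsBestApproxSeq ξ x y) (hL : Lval ξ x y 0 ≤ 1 / 2)
    (hupper : ∀ δ > 0, ∃ t₀, ∀ t, t₀ ≤ t → h t ≤ (η + δ) * t) {δ : ℝ} (hδ : 0 < δ)
    (hη : 0 ≤ η) (hδη : η + 2 * δ < 1 / m) :
    ∀ᶠ i in Filter.atTop, -Real.log (Lval ξ x y i) / Real.log (Xval x i) ≤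
      (1 / n + (η + 2 * δ)) / (1 / m - (η + 2 * δ)) := by
  have hm0 : (0 : ℝ) < m := by exact_mod_cast hm
  have hn0 : (0 : ℝ) < n := by exact_mod_cast hn
  obtain ⟨t₀, ht₀⟩ := hupper δ hδ
  have hlog : Filter.Tendsto (fun i => Real.log (Xval x i)) Filter.atTop Filter.atTop :=
    Real.tendsto_log_atTop.comp hxy.tendsto_Xval
  set s := max (max t₀ 1) (|Real.log c| / δ) with hs
  filter_upwards [hlog.eventually_ge_atTop (s * (1 / m + 1 / n))] with i hi
  have hX := hxy.one_le_Xval i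
  have hLpos := H.Lval_pos hθ hxy i
  obtain ⟨t, ht, hbal, hlogt⟩ := exists_balanced_time hm hn hX hLpos
    (by linarith [hxy.lStrictAnti.antitone (Nat.zero_le i)])
  have hst : s ≤ t := le_of_mul_le_mul_right (hi.trans hlogt) (by positivity)
  have ht1 : 1 ≤ t := ((le_max_right _ _).trans (le_max_left _ _)).trans hst
  have h1 : h t ≤ (η + δ) * t := ht₀ t (((le_max_left _ _).trans (le_max_left _ _)).trans hst)
  have h2 : -Real.log c ≤ δ * t := by
    have h3 : |Real.log c| / δ ≤ t := (le_max_right _ _).trans hst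
    rw [div_le_iff₀ hδ] at h3
    linarith [neg_abs_le (Real.log c)]
  have h3 := H.le_of_forall_le ht (u := x i) (v := y i) (r := Real.exp (t / n) * Lval ξ x y i)
    (fun h0 => hxy.nonzero _ (congrArg Prod.fst h0)) hbal.le le_rfl
  have h4 : Real.log c - h t ≤ t / n + Real.log (Lval ξ x y i) := by
    have := Real.log_le_log (mul_pos H.lower_pos (Real.exp_pos _)) h3
    rwa [Real.log_mul H.lower_pos.ne' (Real.exp_ne_zero _), Real.log_exp,
      Real.log_mul (Real.exp_ne_zero _) hLpos.ne', Real.log_exp] at this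
  have h5 : -(t / m) + Real.log (Xval x i) = t / n + Real.log (Lval ξ x y i) := by
    have := congrArg Real.log hbal
    rwa [Real.log_mul (Real.exp_ne_zero _) hLpos.ne', Real.log_exp,
      Real.log_mul (Real.exp_ne_zero _) (by linarith), Real.log_exp] at this
  have h6 : -Real.log (Lval ξ x y i) ≤ (1 / n + (η + 2 * δ)) * t := by
    have : (1 / n + (η + 2 * δ)) * t = t / n + (η + δ) * t + δ * t := by ring
    linarith
  have h7 : (1 / m - (η + 2 * δ)) * t ≤ Real.log (Xval x i) := by
    have : (1 / m - (η + 2 * δ)) * t = t / m - (η + δ) * t - δ * t := by ring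
    linarith
  have h8 : 0 < 1 / m - (η + 2 * δ) := by linarith
  calc _ ≤ (1 / n + (η + 2 * δ)) * t / ((1 / m - (η + 2 * δ)) * t) :=
        div_le_div₀ (by positivity) h6 (by positivity) h7
    _ = _ := mul_div_mul_right _ _ (by linarith)

theorem frequently_le_ratio (H : HasFlowProfile ξ c C θ h) (hm : 1 ≤ m) (hn : 1 ≤ n)
    (hθ : θ < 1 / m) (hxy : IsBestApproxSeq ξ x y)
    (hlower : ∀ δ > 0, ∀ t₀, ∃ t, t₀ ≤ t ∧ (η - δ) * t ≤ h t ∧ t₀ ≤ h t)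
    {δ : ℝ} (hδ : 0 < δ) (hη : 0 ≤ η) (hδη : 2 * δ < 1 / n) :
    ∃ᶠ i in Filter.atTop, (1 / n + (η - 2 * δ)) / (1 / m - (η - 2 * δ)) ≤
      -Real.log (Lval ξ x y i) / Real.log (Xval x i) := by
  have hm0 : (0 : ℝ) < m := by exact_mod_cast hm
  have hn0 : (0 : ℝ) < n := by exact_mod_cast hn
  have hC := H.upper_pos
  rw [Filter.frequently_atTop]
  intro I
  obtain ⟨t₀, ht₀, hsmall⟩ := H.tendsto_neg_div_sub hn (H.Lval_pos hθ hxy I)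
  obtain ⟨t, ht, hlow, -⟩ := hlower δ hδ (max (max t₀ 1) (|Real.log C| / δ))
  have ht1 : 1 ≤ t := ((le_max_right _ _).trans (le_max_left _ _)).trans ht
  have htt₀ : t₀ ≤ t := ((le_max_left _ _).trans (le_max_left _ _)).trans ht
  have hlogC : Real.log C ≤ δ * t := by
    have h3 : |Real.log C| / δ ≤ t := (le_max_right _ _).trans ht
    rw [div_le_iff₀ hδ] at h3
    linarith [le_abs_self (Real.log C)]
  obtain ⟨u, v, hu, huX, hvL⟩ := H.exists_short_of_lt (by linarith) (hsmall t htt₀).1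
  obtain ⟨i, hXi, hLi⟩ := hxy.exists_Lval_le hu v
  have hIi : I < i :=
    hxy.lStrictAnti.lt_iff_gt.1 ((hLi.trans hvL).trans_lt (hsmall t htt₀).2)
  refine ⟨i, hIi.le, ?_⟩
  have hX1 : 1 < Xval x i := by
    rw [← hxy.first]
    exact hxy.xStrictMono (Nat.zero_lt_of_lt hIi)
  have h1 : Real.log (Xval x i) ≤ (1 / m - (η - 2 * δ)) * t := by
    have h2 := Real.log_le_log (by linarith) (hXi.trans huX)
    rw [Real.log_mul hC.ne' (Real.exp_ne_zero _), Real.log_exp] at h2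
    have : (1 / m - (η - 2 * δ)) * t = t / m - (η - δ) * t + δ * t := by ring
    linarith
  have h3 : (1 / n + (η - 2 * δ)) * t ≤ -Real.log (Lval ξ x y i) := by
    have h2 := Real.log_le_log (H.Lval_pos hθ hxy i) (hLi.trans hvL)
    rw [Real.log_mul hC.ne' (Real.exp_ne_zero _), Real.log_exp] at h2
    have : (1 / n + (η - 2 * δ)) * t = t / n + (η - δ) * t - δ * t := by ring
    linarith
  have h4 : 0 < 1 / n + (η - 2 * δ) := by linarith
  calc _ = (1 / n + (η - 2 * δ)) * t / ((1 / m - (η - 2 * δ)) * t) :=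
        (mul_div_mul_right _ _ (by linarith)).symm
    _ ≤ _ := div_le_div₀ (le_trans (by positivity) h3) h3 (Real.log_pos hX1) h1

theorem ordExp_eq (H : HasFlowProfile ξ c C θ h) (hm : 1 ≤ m) (hn : 1 ≤ n)
    (hθ : θ < 1 / m) (hxy : IsBestApproxSeq ξ x y) (hL : Lval ξ x y 0 ≤ 1 / 2)
    (hη : 0 ≤ η) (hηm : η < 1 / m)
    (hupper : ∀ δ > 0, ∃ t₀, ∀ t, t₀ ≤ t → h t ≤ (η + δ) * t)
    (hlower : ∀ δ > 0, ∀ t₀, ∃ t, t₀ ≤ t ∧ (η - δ) * t ≤ h t ∧ t₀ ≤ h t) :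
    ordExp ξ x y = (((1 / n + η) / (1 / m - η) : ℝ) : EReal) := by
  have hn0 : (0 : ℝ) < n := by exact_mod_cast hn
  have hcont : ContinuousAt (fun δ : ℝ => (1 / n + (η + 2 * δ)) / (1 / m - (η + 2 * δ))) 0 :=
    ContinuousAt.div (by fun_prop) (by fun_prop) (by
      rw [mul_zero, add_zero]
      exact (sub_pos.2 hηm).ne')
  have hcont₀ : Filter.Tendsto (fun δ : ℝ => (1 / n + (η + 2 * δ)) / (1 / m - (η + 2 * δ)))
      (nhds 0) (nhds ((1 / n + η) / (1 / m - η))) := by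
    simpa [ContinuousAt] using hcont
  refine le_antisymm (EReal.le_of_forall_lt_iff_le.1 fun z hz => ?_)
    (EReal.ge_of_forall_gt_iff_ge.1 fun z hz => ?_)
  · have hz' : (1 / n + η) / (1 / m - η) < z := EReal.coe_lt_coe_iff.1 hz
    have h1 := hcont₀.eventually (gt_mem_nhds hz')
    have h2 : ∀ᶠ δ : ℝ in nhds 0, η + 2 * δ < 1 / m :=
      ContinuousAt.eventually_lt (by fun_prop) continuousAt_const (by simpa using hηm)
    obtain ⟨δ, ⟨h1, h2⟩, hδ⟩ := (((h1.and h2).filter_mono nhdsWithin_le_nhds).and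
      (self_mem_nhdsWithin : ∀ᶠ δ : ℝ in nhdsWithin 0 (Set.Ioi 0), δ ∈ Set.Ioi (0 : ℝ))).exists
    refine Filter.limsup_le_of_le (by isBoundedDefault) ?_
    filter_upwards [H.eventually_ratio_le hm hn hθ hxy hL hupper hδ hη h2] with i hi
    exact EReal.coe_le_coe_iff.2 (hi.trans h1.le)
  · have hz' : z < (1 / n + η) / (1 / m - η) := EReal.coe_lt_coe_iff.1 hz
    have h1 := hcont₀.eventually (lt_mem_nhds hz')
    have h2 : ∀ᶠ δ : ℝ in nhds 0, -(1 / (2 * n : ℝ)) < δ :=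
      lt_mem_nhds (by rw [neg_lt_zero]; positivity)
    obtain ⟨δ, ⟨h1, h2⟩, hδ⟩ := (((h1.and h2).filter_mono nhdsWithin_le_nhds).and
      (self_mem_nhdsWithin : ∀ᶠ δ : ℝ in nhdsWithin 0 (Set.Iio 0), δ ∈ Set.Iio (0 : ℝ))).exists
    have hδ0 : 0 < -δ := neg_pos.2 hδ
    have h2n : 2 * -δ < 1 / n := by
      have : (1 : ℝ) / n = 2 * (1 / (2 * n)) := by field_simp
      linarith
    refine Filter.le_limsup_of_frequently_le ?_ (by isBoundedDefault)
    refine (H.frequently_le_ratio hm hn hθ hxy hlower hδ0 hη h2n).mono fun i hi => ?_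
    rw [show η - 2 * -δ = η + 2 * δ by ring] at hi
    exact EReal.coe_le_coe_iff.2 (h1.le.trans hi)

end HasFlowProfile

end flow_profile_exponent

theorem exists_matrix_of_exponent {m n : ℕ} (hm : 1 ≤ m) (hn : 2 ≤ n) {ω : ℝ} (hω₁ : m ≤ ω * n)
    (hω₂ : ω * (n - 1) ≤ m) :
    ∃ (ξ : Matrix (Fin n) (Fin m) ℝ) (x : ℕ → Fin m → ℤ) (y : ℕ → Fin n → ℤ),
      TotallyIrrational ξ ∧ IsBestApproxSeq ξ x y ∧ PropC ξ x y ∧ ordExp ξ x y = (ω : EReal) ∧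
      ∀ ε > 0, ∃ (u : Fin m → ℤ) (v : Fin n → ℤ), u ≠ 0 ∧
        ‖ξ.mulVec (fun j => (u j : ℝ)) - (fun k => (v k : ℝ))‖ < 1 ∧
        ‖(fun j => (u j : ℝ))‖ ^ m *
          ‖ξ.mulVec (fun j => (u j : ℝ)) - (fun k => (v k : ℝ))‖ ^ n < ε := by
  have hm0 : (0 : ℝ) < m := by exact_mod_cast hm
  have hm1 : (1 : ℝ) ≤ m := by exact_mod_cast hm
  have hn2 : (2 : ℝ) ≤ n := by exact_mod_cast hn
  have hn0 : (0 : ℝ) < n := by linarith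
  have hω0 : 0 < ω := pos_of_mul_pos_left (hm0.trans_le hω₁) hn0.le
  obtain ⟨D, hD⟩ : ∃ D, D + 1 = m + n := ⟨m + n - 1, by omega⟩
  have hDR : (D : ℝ) = m + n - 1 := by
    have : (D : ℝ) + 1 = m + n := by exact_mod_cast hD
    linarith
  have hD0 : (0 : ℝ) < D := by linarith
  have hη₀ : 0 ≤ (ω / m - 1 / n) / (1 + ω) := by
    refine div_nonneg (sub_nonneg.2 ?_) (by linarith)
    rw [div_le_div_iff₀ hn0 hm0]
    linarith
  have hη₁ : (ω / m - 1 / n) / (1 + ω) ≤ 1 / (n * D) := by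
    rw [div_le_div_iff₀ (by linarith) (by positivity), div_sub_div _ _ hm0.ne' hn0.ne',
      div_mul_eq_mul_div, div_le_iff₀ (by positivity), hDR]
    have := mul_le_mul_of_nonneg_right hω₂ (by positivity : 0 ≤ (m + n) * (n : ℝ))
    linarith
  have hη₂ : 1 / (m : ℝ) - (ω / m - 1 / n) / (1 + ω) = (1 / m + 1 / n) / (1 + ω) := by
    field_simp
    ring
  have hη₃ : (1 / n + (ω / m - 1 / n) / (1 + ω)) / (1 / m - (ω / m - 1 / n) / (1 + ω)) = ω := by
    rw [hη₂]
    field_simp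
    ring
  have hη₄ : (ω / m - 1 / n) / (1 + ω) < 1 / m := by
    have : 0 < (1 / (m : ℝ) + 1 / n) / (1 + ω) := by positivity
    linarith
  have hθ : 1 / ((n : ℝ) * D) < 1 / m := by
    refine one_div_lt_one_div_of_lt hm0 ?_
    rw [hDR]
    nlinarith
  obtain ⟨ξ, c, hc, C, hC, h, h₁, h₂, h₃, h₄, h₅, h₆⟩ :=
    exists_matrix_following_profile hm hn hD hη₀ hη₁
  have H : HasFlowProfile ξ c C (1 / (n * D)) h :=
    ⟨hc, hC, fun t ht => (h₁ t ht).1, fun t ht => (h₁ t ht).2, h₂, h₃, fun t σ ht hσ => by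
      rw [one_div_mul_eq_div]
      exact h₄ t σ ht hσ⟩
  have hn1 : 1 ≤ n := by omega
  obtain ⟨x, y, hxy, hL⟩ := exists_isBestApproxSeq hm (H.totallyIrrational hθ)
    fun ε hε => H.exists_small hn1 hε
  refine ⟨ξ, x, y, H.totallyIrrational hθ, hxy, H.propC hm hn1 hθ hxy hL, ?_, fun ε hε =>
    H.exists_pow_mul_pow_lt hm hn1 (fun t₀ => ?_) hε⟩
  · rw [H.ordExp_eq hm hn1 hθ hxy hL hη₀ hη₄ h₅ h₆, hη₃]
  · obtain ⟨t, ht, -, ht'⟩ := h₆ 1 one_pos t₀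
    exact ⟨t, ht, ht'⟩

section padding

variable {m k n : ℕ}

/-- Extension of a tuple by zeros. -/
def padZero {R : Type*} [Zero R] (n : ℕ) (a : Fin k → R) : Fin n → R :=
  fun i => if hi : (i : ℕ) < k then a ⟨i, hi⟩ else 0

theorem padZero_castLE {R : Type*} [Zero R] (hkn : k ≤ n) (a : Fin k → R) (i : Fin k) :
    padZero n a (Fin.castLE hkn i) = a i := by
  simp [padZero]

theorem intCast_padZero (v : Fin k → ℤ) :
    (fun i => ((padZero n v i : ℤ) : ℝ)) = padZero n (fun i => (v i : ℝ)) := by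
  funext i
  unfold padZero
  split <;> simp

/-- Extension of a matrix by zero rows. -/
def padRows (n : ℕ) (ξ : Matrix (Fin k) (Fin m) ℝ) : Matrix (Fin n) (Fin m) ℝ :=
  Matrix.of (padZero n fun i j => ξ i j)

theorem padRows_mulVec (ξ : Matrix (Fin k) (Fin m) ℝ) (a : Fin m → ℝ) :
    (padRows n ξ).mulVec a = padZero n (ξ.mulVec a) := by
  funext i
  by_cases hi : (i : ℕ) < k <;> simp [Matrix.mulVec, dotProduct, padRows, padZero, hi]

theorem padZero_sub (a b : Fin k → ℝ) : padZero n a - padZero n b = padZero n (a - b) := by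
  funext i
  simp only [Pi.sub_apply]
  unfold padZero
  split <;> simp

theorem norm_comp_castLE_le (hkn : k ≤ n) (b : Fin n → ℝ) :
    ‖(fun i => b (Fin.castLE hkn i))‖ ≤ ‖b‖ :=
  (pi_norm_le_iff_of_nonneg (norm_nonneg _)).2 fun i => norm_le_pi_norm b (Fin.castLE hkn i)

theorem norm_padZero (hkn : k ≤ n) (a : Fin k → ℝ) : ‖padZero n a‖ = ‖a‖ := by
  refine le_antisymm ((pi_norm_le_iff_of_nonneg (norm_nonneg _)).2 fun i => ?_) ?_
  · unfold padZero
    split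
    · exact norm_le_pi_norm a _
    · simp
  · simpa only [padZero_castLE] using norm_comp_castLE_le hkn (padZero n a)

theorem norm_padRows_mulVec_sub (hkn : k ≤ n) (ξ : Matrix (Fin k) (Fin m) ℝ) (a : Fin m → ℝ)
    (v : Fin k → ℤ) :
    ‖(padRows n ξ).mulVec a - (fun i => ((padZero n v i : ℤ) : ℝ))‖ =
      ‖ξ.mulVec a - (fun i => (v i : ℝ))‖ := by
  rw [intCast_padZero, padRows_mulVec, padZero_sub, norm_padZero hkn]

theorem norm_mulVec_sub_le_padRows (hkn : k ≤ n) (ξ : Matrix (Fin k) (Fin m) ℝ) (a : Fin m → ℝ)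
    (v : Fin n → ℤ) :
    ‖ξ.mulVec a - (fun i => (v (Fin.castLE hkn i) : ℝ))‖ ≤
      ‖(padRows n ξ).mulVec a - (fun i => (v i : ℝ))‖ := by
  rw [padRows_mulVec]
  refine le_of_eq_of_le ?_ (norm_comp_castLE_le hkn _)
  congr 1
  funext i
  simp [padZero_castLE]

theorem Lval_padRows (hkn : k ≤ n) (ξ : Matrix (Fin k) (Fin m) ℝ) (x : ℕ → Fin m → ℤ)
    (y : ℕ → Fin k → ℤ) :
    Lval (padRows n ξ) x (fun i => padZero n (y i)) = Lval ξ x y :=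
  funext fun _ => norm_padRows_mulVec_sub hkn ξ _ _

theorem TotallyIrrational.padRows (hkn : k ≤ n) {ξ : Matrix (Fin k) (Fin m) ℝ}
    (hξ : TotallyIrrational ξ) : TotallyIrrational (padRows n ξ) := by
  intro u v huv
  by_cases hu : u = 0
  · subst hu
    have hv : v ≠ 0 := fun hv => huv (by rw [hv]; rfl)
    have : (fun j => (((0 : Fin m → ℤ) j : ℤ) : ℝ)) = 0 := by ext; simp
    rw [this, Matrix.mulVec_zero, zero_sub, norm_neg]
    exact one_pos.trans_le (HasFlowProfile.one_le_norm_of_ne_zero hv)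
  · exact (hξ u (fun i => v (Fin.castLE hkn i)) fun h0 => hu (congrArg Prod.fst h0)).trans_le
      (norm_mulVec_sub_le_padRows hkn ξ _ v)

theorem IsBestApproxSeq.padRows (hkn : k ≤ n) {ξ : Matrix (Fin k) (Fin m) ℝ}
    {x : ℕ → Fin m → ℤ} {y : ℕ → Fin k → ℤ} (hxy : IsBestApproxSeq ξ x y) :
    IsBestApproxSeq (padRows n ξ) x (fun i => padZero n (y i)) where
  nonzero := hxy.nonzero
  first := hxy.first
  xStrictMono := hxy.xStrictMono
  lStrictAnti := by
    rw [Lval_padRows hkn]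
    exact hxy.lStrictAnti
  best i u v hu h := by
    rw [Lval_padRows hkn]
    exact (hxy.best i u (fun i => v (Fin.castLE hkn i)) hu h).trans
      (norm_mulVec_sub_le_padRows hkn ξ _ v)

end padding

/-- For `n ≥ 2, m ≥ 1` and any real `ω ∈ [m/n, m]`, there is a
totally irrational `ξ` satisfying (C), not (A), with ordinary exponent `ω`. -/
theorem stmt_10 (m n : ℕ) (hm : 1 ≤ m) (hn : 2 ≤ n)
    (ω : ℝ) (hω₁ : (m : ℝ) / (n : ℝ) ≤ ω) (hω₂ : ω ≤ (m : ℝ)) :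
    ∃ (ξ : Matrix (Fin n) (Fin m) ℝ) (x : ℕ → Fin m → ℤ) (y : ℕ → Fin n → ℤ),
      TotallyIrrational ξ ∧ IsBestApproxSeq ξ x y ∧ PropC ξ x y ∧ ¬ PropA ξ ∧
      ordExp ξ x y = (ω : EReal) := by
  classical
  have hn0 : (0 : ℝ) < n := by exact_mod_cast (by omega : 0 < n)
  have hex : ∃ k : ℕ, 2 ≤ k ∧ (m : ℝ) ≤ ω * k := ⟨n, hn, (div_le_iff₀ hn0).1 hω₁⟩
  obtain ⟨k, hk⟩ : ∃ k, k = Nat.find hex := ⟨_, rfl⟩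
  have hkn : k ≤ n := hk ▸ Nat.find_min' hex ⟨hn, (div_le_iff₀ hn0).1 hω₁⟩
  obtain ⟨hk2, hωk⟩ : 2 ≤ k ∧ (m : ℝ) ≤ ω * k := hk ▸ Nat.find_spec hex
  have hωk' : ω * (k - 1) ≤ m := by
    rcases hk2.eq_or_lt with rfl | hlt
    · norm_num
      exact hω₂
    · have h1 := Nat.find_min hex (by omega : k - 1 < Nat.find hex)
      rw [not_and, not_le, Nat.cast_sub (by omega), Nat.cast_one] at h1
      exact (h1 (by omega)).le
  obtain ⟨ξ, x, y, hTI, hxy, ⟨M, hM⟩, hexp, hA⟩ := exists_matrix_of_exponent hm hk2 hωk hωk'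
  refine ⟨padRows n ξ, x, fun i => padZero n (y i), hTI.padRows hkn, hxy.padRows hkn,
    ⟨M, fun i => by rw [Lval_padRows hkn]; exact hM i⟩, ?_, ?_⟩
  · rintro ⟨c, hc, hbad⟩
    obtain ⟨u, v, hu, hL, hlt⟩ := hA c hc
    have h1 := hbad u (padZero n v) hu
    rw [norm_padRows_mulVec_sub hkn] at h1
    refine (h1.trans ?_).not_gt hlt
    gcongr ?_ * ?_
    exact pow_le_pow_of_le_one (norm_nonneg _) hL.le hkn
  · rw [← hexp, ordExp, ordExp, Lval_padRows hkn]
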